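/- arXiv:1108.4751 — 6 statements merged into one kernel-verified Lean document; each statement's English description precedes it below -/
import Mathlib

section
/- Every finite simple graph G with maximum degree Δ(G) ≤ 3 satisfies τ₂(G) ≤ 8. -/
/-- A `t`-tone `k`-coloring of a simple graph `G` assigns to each vertex a `t`-element
subset of `{1, …, k}` so that any two distinct vertices `u`, `v` share fewer than
`d(u,v)` colors (vertices at infinite distance impose no constraint). -/
def IsTToneColoring {V : Type*} (G : SimpleGraph V) (t k : ℕ) (f : V → Finset ℕ) : Prop :=
  (∀ v, (f v).card = t ∧ f v ⊆ Finset.Icc 1 k) ∧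
  ∀ u v : V, u ≠ v → ((f u ∩ f v).card : ℕ∞) < G.edist u v

/-- The `t`-tone chromatic number: the least `k` admitting a `t`-tone `k`-coloring. -/
noncomputable def toneNumber {V : Type*} (G : SimpleGraph V) (t : ℕ) : ℕ :=
  sInf {k | ∃ f : V → Finset ℕ, IsTToneColoring G t k f}

namespace TT

abbrev Lab := Fin 28

def loT : List (Fin 8) := [0,0,0,0,0,0,0,1,1,1,1,1,1,2,2,2,2,2,3,3,3,3,4,4,4,5,5,6]
def hiT : List (Fin 8) := [1,2,3,4,5,6,7,2,3,4,5,6,7,3,4,5,6,7,4,5,6,7,5,6,7,6,7,7]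
def lo (q : Lab) : Fin 8 := loT.getD q.val 0
def hi (q : Lab) : Fin 8 := hiT.getD q.val 0
def dmT : List ℕ := [268427264, 268181248, 264494720, 238796160, 163019648, 91158400, 48099200, 268173436, 264487034, 238788726, 163012718, 91152478, 48095294, 264248953, 238558581, 162798445, 90969949, 47976253, 235117811, 159603435, 88266459, 46255803, 137574887, 69907927, 35237303, 19297231, 9792431, 5040031]
def dmf (q : Lab) : ℕ := dmT.getD q.val 0
def dj (a b : Lab) : Bool := (dmf a).testBit b.val

def encT : List Lab :=
  [0,0,1,2,3,4,5,6, 0,0,7,8,9,10,11,12, 1,7,0,13,14,15,16,17, 2,8,13,0,18,19,20,21,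
   3,9,14,18,0,22,23,24, 4,10,15,19,22,0,25,26, 5,11,16,20,23,25,0,27, 6,12,17,21,24,26,27,0]
def enc (a b : Fin 8) : Lab := encT.getD (8 * a.val + b.val) 0

theorem dj_iff : ∀ a b : Lab, dj a b = true ↔ (lo a ≠ lo b ∧ lo a ≠ hi b ∧ hi a ≠ lo b ∧ hi a ≠ hi b) := by
  decide +kernel
theorem enc_spec : ∀ a b : Fin 8, a ≠ b → ((lo (enc a b) = a ∧ hi (enc a b) = b) ∨ (lo (enc a b) = b ∧ hi (enc a b) = a)) := by
  decide +kernel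
theorem enc_comm' : ∀ a b : Fin 8, enc a b = enc b a := by decide +kernel
theorem enc_lohi : ∀ q : Lab, enc (lo q) (hi q) = q := by decide +kernel
theorem lo_ne_hi : ∀ q : Lab, lo q ≠ hi q := by decide +kernel
theorem dj_comm : ∀ a b : Lab, dj a b = dj b a := by decide +kernel
theorem dj_irrefl : ∀ a : Lab, dj a a = false := by decide +kernel
theorem dj_ne {a b : Lab} (h : dj a b = true) : a ≠ b := by
  rintro rfl; simp [dj_irrefl] at h
theorem dj_symm {a b : Lab} (h : dj a b = true) : dj b a = true := by rw [dj_comm]; exact h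
theorem dmf_lt : ∀ a : Lab, dmf a < 2 ^ 28 := by decide +kernel
theorem dmT_eq : dmT = (List.finRange 28).map dmf := by decide +kernel

def actF (σ : Equiv.Perm (Fin 8)) (q : Lab) : Lab := enc (σ (lo q)) (σ (hi q))

theorem actF_spec (σ : Equiv.Perm (Fin 8)) (q : Lab) :
    (lo (actF σ q) = σ (lo q) ∧ hi (actF σ q) = σ (hi q)) ∨ (lo (actF σ q) = σ (hi q) ∧ hi (actF σ q) = σ (lo q)) :=
  enc_spec _ _ (fun h => lo_ne_hi q (σ.injective h))

theorem actF_inv (σ τ : Equiv.Perm (Fin 8)) (h : ∀ x, τ (σ x) = x) (q : Lab) : actF τ (actF σ q) = q := by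
  rcases actF_spec σ q with ⟨h1, h2⟩ | ⟨h1, h2⟩
  · rw [actF, h1, h2, h, h, enc_lohi]
  · rw [actF, h1, h2, h, h, enc_comm', enc_lohi]

def act (σ : Equiv.Perm (Fin 8)) : Lab ≃ Lab where
  toFun := actF σ
  invFun := actF σ⁻¹
  left_inv := actF_inv _ _ (by simp)
  right_inv := actF_inv _ _ (by simp)

theorem act_dj (σ : Equiv.Perm (Fin 8)) (p q : Lab) : dj (act σ p) (act σ q) = dj p q := by
  rw [Bool.eq_iff_iff, dj_iff, dj_iff]
  change (lo (actF σ p) ≠ lo (actF σ q) ∧ lo (actF σ p) ≠ hi (actF σ q) ∧ hi (actF σ p) ≠ lo (actF σ q) ∧ hi (actF σ p) ≠ hi (actF σ q)) ↔ _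
  rcases actF_spec σ p with ⟨h1, h2⟩ | ⟨h1, h2⟩ <;> rcases actF_spec σ q with ⟨h3, h4⟩ | ⟨h3, h4⟩ <;>
    simp only [h1, h2, h3, h4, ne_eq, EmbeddingLike.apply_eq_iff_eq] <;> tauto

def cmn (v x : Lab) : Fin 8 := if lo v = lo x ∨ lo v = hi x then lo v else hi v
def oth (v : Lab) (c : Fin 8) : Fin 8 := if lo v = c then hi v else lo v

theorem norm_aux : ∀ u v x : Lab, dj u v = true → dj u x = true → dj v x = false → v ≠ x →
    [lo u, hi u, cmn v x, oth v (cmn v x), oth x (cmn v x)].Nodup ∧ enc (cmn v x) (oth v (cmn v x)) = v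
      ∧ enc (cmn v x) (oth x (cmn v x)) = x := by decide +kernel

theorem act_enc (σ : Equiv.Perm (Fin 8)) (a b : Fin 8) (h : a ≠ b) : act σ (enc a b) = enc (σ a) (σ b) := by
  change enc _ _ = _
  rcases enc_spec a b h with ⟨h1, h2⟩ | ⟨h1, h2⟩
  · rw [h1, h2]
  · rw [h1, h2, enc_comm']

theorem norm3 (u v x : Lab) (h1 : dj u v = true) (h2 : dj u x = true) (h3 : dj v x = false) (h4 : v ≠ x) :
    ∃ π : Lab ≃ Lab, (∀ p q, dj (π p) (π q) = dj p q) ∧ π u = 0 ∧ π v = 13 ∧ π x = 14 := by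
  obtain ⟨hn, hv, hx⟩ := norm_aux u v x h1 h2 h3 h4
  set c := cmn v x
  set d := oth v c
  set e := oth x c
  have hinj : Function.Injective ([lo u, hi u, c, d, e].get) := List.nodup_iff_injective_get.mp hn
  let f : Fin 5 ↪ Fin 8 := ⟨[lo u, hi u, c, d, e].get, hinj⟩
  let g : Fin 5 ↪ Fin 8 := ⟨Fin.castLE (by norm_num), Fin.castLE_injective _⟩
  obtain ⟨σ, hσ⟩ := (Equiv.Perm.isMultiplyPretransitive (Fin 8) 5).exists_smul_eq f g
  have hs : ∀ i, σ (f i) = g i := fun i => by rw [← hσ]; rfl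
  have s0 : σ (lo u) = 0 := hs 0
  have s1 : σ (hi u) = 1 := hs 1
  have s2 : σ c = 2 := hs 2
  have s3 : σ d = 3 := hs 3
  have s4 : σ e = 4 := hs 4
  refine ⟨act σ, act_dj σ, ?_, ?_, ?_⟩
  · change enc _ _ = _
    rw [s0, s1]; decide
  · rw [← hv, act_enc _ _ _ (by rintro h; rw [h, s3] at s2; revert s2; decide), s2, s3]; decide
  · rw [← hx, act_enc _ _ _ (by rintro h; rw [h, s4] at s2; revert s2; decide), s2, s4]; decide

/-- masks -/
def force {α : Type} (m : ℕ) (f : ℕ → α) : α :=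
  match m with
  | 0 => f 0
  | k + 1 => f (k + 1)
theorem force_eq {α : Type} (m : ℕ) (f : ℕ → α) : force m f = f m := by cases m <;> rfl

def one (k : ℕ) : Bool := Nat.blt 0 k
def two (k : ℕ) : Bool := Nat.blt 0 (Nat.land k (Nat.sub k 1))
def cnt (f : ℕ → Bool) : List ℕ → ℕ
  | [] => 0
  | d :: l => Nat.add (cnt f l) (bif f d then 1 else 0)

def allSub (P : ℕ → Bool) : List ℕ → ℕ → ℕ → Bool
  | [], 0, m => P m
  | [], _ + 1, _ => true
  | _ :: _, 0, m => P m
  | q :: l, k + 1, m => and (force (Nat.lor m q) (allSub P l k)) (allSub P l (k + 1) m)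

def allRem (P : ℕ → Bool) : List ℕ → ℕ → ℕ → Bool
  | [], _, m => P m
  | q :: l, 0, m => force (Nat.lor m q) (allRem P l 0)
  | q :: l, j + 1, m => and (force (Nat.lor m q) (allRem P l (j + 1))) (allRem P l j m)

/-- powers of two for a list of labels -/
def pw (l : List Lab) : List ℕ := l.map (fun q => 2 ^ q.val)

def MSub (m : ℕ) (D : Finset Lab) : Prop := ∀ q : Lab, m.testBit q.val = true → q ∈ D

theorem testBit_pw (q p : Lab) : (2 ^ q.val).testBit p.val = true ↔ p = q := by
  rw [Nat.testBit_two_pow]; simp [Fin.ext_iff, eq_comm]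

theorem MSub_or {m : ℕ} {D : Finset Lab} (q : Lab) (h : MSub m D) (hq : q ∈ D) : MSub (Nat.lor m (2 ^ q.val)) D := by
  intro p hp
  change (m ||| 2 ^ q.val).testBit p.val = true at hp
  rw [Nat.testBit_or, Bool.or_eq_true, testBit_pw] at hp
  rcases hp with hp | rfl
  · exact h p hp
  · exact hq

theorem allSub_spec (P : ℕ → Bool) (D : Finset Lab) : ∀ (l : List Lab) (k m : ℕ), allSub P (pw l) k m = true →
    k ≤ l.countP (fun q => decide (q ∈ D)) → MSub m D → ∃ m', P m' = true ∧ MSub m' D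
  | [], 0, m, h, _, hm => ⟨m, by simpa [pw, allSub] using h, hm⟩
  | [], k + 1, m, _, h2, _ => by simp at h2
  | q :: l, 0, m, h, _, hm => ⟨m, by simpa [pw, allSub] using h, hm⟩
  | q :: l, k + 1, m, h, h2, hm => by
    have h' : and (force (Nat.lor m (2 ^ q.val)) (allSub P (pw l) k)) (allSub P (pw l) (k + 1) m) = true := h
    rw [Bool.and_eq_true, force_eq] at h'
    by_cases hq : q ∈ D
    · rw [List.countP_cons_of_pos (by simpa using hq)] at h2
      exact allSub_spec P D l k _ h'.1 (by omega) (MSub_or q hm hq)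
    · rw [List.countP_cons_of_neg (by simpa using hq)] at h2
      exact allSub_spec P D l (k + 1) m h'.2 h2 hm

theorem allRem_spec (P : ℕ → Bool) (D : Finset Lab) : ∀ (l : List Lab) (j m : ℕ), allRem P (pw l) j m = true →
    l.countP (fun q => decide (q ∉ D)) ≤ j → ∃ m', P m' = true ∧
      ∀ q : Lab, m'.testBit q.val = true ↔ (m.testBit q.val = true ∨ (q ∈ l ∧ q ∈ D))
  | [], j, m, h, _ => ⟨m, by simpa [pw, allRem] using h, by simp⟩
  | q :: l, 0, m, h, h2 => by
    have h' : force (Nat.lor m (2 ^ q.val)) (allRem P (pw l) 0) = true := h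
    rw [force_eq] at h'
    by_cases hq : q ∈ D
    · rw [List.countP_cons_of_neg (by simpa using hq)] at h2
      obtain ⟨m', hP, hm'⟩ := allRem_spec P D l 0 _ h' h2
      refine ⟨m', hP, fun p => ?_⟩
      rw [hm' p]
      change (m ||| 2 ^ q.val).testBit p.val = true ∨ _ ↔ _
      rw [Nat.testBit_or, Bool.or_eq_true, testBit_pw, List.mem_cons]
      constructor
      · rintro ((h | rfl) | h) <;> tauto
      · rintro (h | ⟨rfl | h, h'⟩) <;> tauto
    · rw [List.countP_cons_of_pos (by simpa using hq)] at h2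
      omega
  | q :: l, j + 1, m, h, h2 => by
    have h' : and (force (Nat.lor m (2 ^ q.val)) (allRem P (pw l) (j + 1))) (allRem P (pw l) j m) = true := h
    rw [Bool.and_eq_true, force_eq] at h'
    by_cases hq : q ∈ D
    · rw [List.countP_cons_of_neg (by simpa using hq)] at h2
      obtain ⟨m', hP, hm'⟩ := allRem_spec P D l (j + 1) _ h'.1 h2
      refine ⟨m', hP, fun p => ?_⟩
      rw [hm' p]
      change (m ||| 2 ^ q.val).testBit p.val = true ∨ _ ↔ _
      rw [Nat.testBit_or, Bool.or_eq_true, testBit_pw, List.mem_cons]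
      constructor
      · rintro ((h | rfl) | h) <;> tauto
      · rintro (h | ⟨rfl | h, h'⟩) <;> tauto
    · rw [List.countP_cons_of_pos (by simpa using hq)] at h2
      obtain ⟨m', hP, hm'⟩ := allRem_spec P D l j _ h'.2 (by omega)
      refine ⟨m', hP, fun p => ?_⟩
      rw [hm' p, List.mem_cons]
      constructor
      · rintro (h | h) <;> tauto
      · rintro (h | ⟨rfl | h, h'⟩) <;> tauto

theorem one_spec {k : ℕ} (h : one k = true) : ∃ i, k.testBit i = true := by
  have : k ≠ 0 := by
    rintro rfl; exact absurd h (by decide)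
  exact Nat.exists_testBit_of_ne_zero this

theorem two_spec {k : ℕ} (h : two k = true) : ∃ i j, i ≠ j ∧ k.testBit i = true ∧ k.testBit j = true := by
  have h1 : (k &&& (k - 1)) ≠ 0 := by
    intro h0
    unfold two at h
    change Nat.blt 0 (k &&& (k - 1)) = true at h
    rw [h0] at h; exact absurd h (by decide)
  obtain ⟨i, hi⟩ := Nat.exists_testBit_of_ne_zero h1
  have hk : k ≠ 0 := by rintro rfl; simp at h1
  have hne : k &&& (k - 1) ≠ k := by
    have : k &&& (k - 1) ≤ k - 1 := Nat.and_le_right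
    omega
  obtain ⟨j, hj⟩ := Nat.exists_testBit_ne_of_ne hne
  rw [Nat.testBit_and] at hi hj
  rw [Bool.and_eq_true] at hi
  refine ⟨i, j, ?_, hi.1, ?_⟩
  · rintro rfl
    simp [hi.1, hi.2] at hj
  · by_contra hc
    simp at hc
    simp [hc] at hj

def A (u : Lab) : Finset Lab := Finset.univ.filter (fun q => dj u q = true)
def N1 (D : Finset Lab) : Finset Lab := Finset.univ.filter (fun q => ∃ p ∈ D, dj q p = true)
def N2 (D : Finset Lab) : Finset Lab :=
  Finset.univ.filter (fun q => ∃ p ∈ D, ∃ p' ∈ D, p ≠ p' ∧ dj q p = true ∧ dj q p' = true)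

theorem mem_A {u q : Lab} : q ∈ A u ↔ dj u q = true := by simp [A]
theorem mem_N1 {D : Finset Lab} {q : Lab} : q ∈ N1 D ↔ ∃ p ∈ D, dj q p = true := by simp [N1]
theorem mem_N2 {D : Finset Lab} {q : Lab} : q ∈ N2 D ↔ ∃ p ∈ D, ∃ p' ∈ D, p ≠ p' ∧ dj q p = true ∧ dj q p' = true := by
  simp [N2]

theorem bit_lab {q : Lab} {i : ℕ} (h : (dmf q).testBit i = true) : i < 28 := by
  by_contra hc
  have := Nat.testBit_lt_two_pow (lt_of_lt_of_le (dmf_lt q) (Nat.pow_le_pow_right (by norm_num) (not_lt.mp hc)))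
  simp [this] at h

theorem one_N1 {m : ℕ} {D : Finset Lab} (hm : MSub m D) {q : Lab} (h : one (Nat.land (dmf q) m) = true) : q ∈ N1 D := by
  obtain ⟨i, hi⟩ := one_spec h
  change (dmf q &&& m).testBit i = true at hi
  rw [Nat.testBit_and, Bool.and_eq_true] at hi
  exact mem_N1.mpr ⟨⟨i, bit_lab hi.1⟩, hm _ hi.2, hi.1⟩

theorem two_N2 {m : ℕ} {D : Finset Lab} (hm : MSub m D) {q : Lab} (h : two (Nat.land (dmf q) m) = true) : q ∈ N2 D := by
  obtain ⟨i, j, hij, hi, hj⟩ := two_spec h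
  change (dmf q &&& m).testBit i = true at hi
  change (dmf q &&& m).testBit j = true at hj
  rw [Nat.testBit_and, Bool.and_eq_true] at hi hj
  exact mem_N2.mpr ⟨⟨i, bit_lab hi.1⟩, hm _ hi.2, ⟨j, bit_lab hj.1⟩, hm _ hj.2, by simpa using hij, hi.1, hj.1⟩

theorem cnt_card (f : ℕ → Bool) (S : Finset Lab) : ∀ (l : List Lab) , l.Nodup →
    (∀ q ∈ l, f (dmf q) = true → q ∈ S) → cnt f (l.map dmf) ≤ (S.filter (· ∈ l)).card
  | [], _, _ => by simp [cnt]
  | q :: l, hn, hS => by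
    have ih := cnt_card f S l (List.nodup_cons.mp hn).2 (fun p hp => hS p (List.mem_cons_of_mem _ hp))
    have hq := (List.nodup_cons.mp hn).1
    change cnt f (l.map dmf) + (bif f (dmf q) then 1 else 0) ≤ _
    by_cases h : f (dmf q) = true
    · rw [h]
      have : insert q (S.filter (· ∈ l)) ⊆ S.filter (· ∈ q :: l) := by
        intro p hp
        rw [Finset.mem_insert, Finset.mem_filter] at hp
        rw [Finset.mem_filter, List.mem_cons]
        rcases hp with rfl | hp
        · exact ⟨hS _ List.mem_cons_self h, Or.inl rfl⟩
        · exact ⟨hp.1, Or.inr hp.2⟩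
      have h2 := Finset.card_le_card this
      rw [Finset.card_insert_of_notMem (by simp [hq])] at h2
      simpa using (Nat.add_le_add_right ih 1).trans h2
    · have h0 : f (dmf q) = false := by simpa using h
      rw [h0]
      refine (show _ ≤ _ from by simpa using ih).trans (Finset.card_le_card ?_)
      intro p hp
      rw [Finset.mem_filter] at hp ⊢
      exact ⟨hp.1, List.mem_cons_of_mem _ hp.2⟩

theorem cnt_card' (f : ℕ → Bool) (S : Finset Lab) (l : List Lab) (hn : l.Nodup)
    (hS : ∀ q ∈ l, f (dmf q) = true → q ∈ S) : cnt f (l.map dmf) ≤ S.card :=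
  (cnt_card f S l hn hS).trans (Finset.card_le_card (Finset.filter_subset _ _))

end TT

namespace TT

def LA0 : List Lab := [13,14,15,16,17,18,19,20,21,22,23,24,25,26,27]
def l10 : List Lab := [0,4,5,6,10,11,12,25,26,27]
def stars : List (Fin 8) := [0,1,2,3,4,5,6,7]
def noc (o : Fin 8) : List Lab := (List.finRange 28).filter (fun q => lo q ≠ o ∧ hi q ≠ o)
def nocT : List (List ℕ) := stars.map (fun o => (noc o).map dmf)

def allL (f : ℕ → Bool) : List ℕ → Bool
  | [] => true
  | d :: l => and (f d) (allL f l)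
def anyL (f : List ℕ → Bool) : List (List ℕ) → Bool
  | [] => false
  | d :: l => or (f d) (anyL f l)
theorem allL_iff (f : ℕ → Bool) (l : List ℕ) : allL f l = true ↔ ∀ d ∈ l, f d = true := by
  induction l with
  | nil => simp [allL]
  | cons a l ih => simp [allL, ih]
theorem anyL_iff (f : List ℕ → Bool) (l : List (List ℕ)) : anyL f l = true ↔ ∃ d ∈ l, f d = true := by
  induction l with
  | nil => simp [anyL]
  | cons a l ih => simp [anyL, ih]

def P1 (T : List (List ℕ)) (m : ℕ) : Bool :=
  or (Nat.blt 21 (cnt (fun d => two (Nat.land d m)) dmT)) (anyL (allL (fun d => two (Nat.land d m))) T)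

def CE (m : ℕ) : Bool := Nat.blt 24 (cnt (fun d => one (Nat.land d m)) dmT)
def l6 : List Lab := [22,23,24,25,26,27]
def L5 (u3 : Lab) : List Lab := l10.filter (fun q => q ≠ 0 ∧ q ≠ u3)
def M5 (u3 : Lab) : List Lab := (List.finRange 28).filter (fun q => dj u3 q ∧ q ≠ 13 ∧ q ≠ 14)
def P5 (T : List ℕ) (m : ℕ) : Bool := Nat.blt 7 (cnt (fun d => two (Nat.land d m)) T)
def P5' (m : ℕ) : Bool := Nat.blt 26 (cnt (fun d => one (Nat.land d m)) dmT)
def nb (m k : ℕ) : Bool := !(m.testBit k)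
def clos (m : ℕ) : Bool := (nb m 14 && nb m 18) || (nb m 15 && nb m 19) || (nb m 16 && nb m 20) || (nb m 17 && nb m 21)
def P9 (m : ℕ) : Bool := clos m || Nat.blt 3 (cnt (fun d => CE (Nat.land (Nat.land m d) 268427263)) (l6.map dmf))
def l8 : List Lab := [14,15,16,17,18,19,20,21]
def P7 (m : ℕ) : Bool := (List.finRange 28).any (fun q => m.testBit q && one (Nat.land (dmf q) m))
def R8 (s t : Lab) : List Lab := (List.finRange 28).filter (fun q => dj q t ∧ ¬ dj q s ∧ q ≠ 0)
def X8 (t : Lab) : List Lab := l8.filter (fun q => q ≠ t)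
def P8 (T : List ℕ) (m : ℕ) : Bool := Nat.blt 2 (cnt (fun d => one (Nat.land d m)) T)

theorem ck1 : allSub (P1 nocT) (pw LA0) 5 0 = true := by decide +kernel
theorem ck6 : allRem CE (pw l10) 5 0 = true := by decide +kernel
theorem ck5' : allRem P5' (pw l10) 4 0 = true := by decide +kernel
theorem ck6' : allRem CE (pw l6) 2 0 = true := by decide +kernel
theorem ck5 : ∀ u3 : Lab, allRem (P5 ((M5 u3).map dmf)) (pw (L5 u3)) 3 0 = true := by decide +kernel
theorem ck9 : allRem P9 (pw LA0) 3 0 = true := by decide +kernel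
theorem ck7 : allRem P7 (pw l8) 3 0 = true := by decide +kernel
theorem ck8 : ∀ t s : Lab, dj s t = false → s ≠ t →
    allRem (P8 ((X8 t).map dmf)) (pw (R8 s t)) 2 0 = true := by decide +kernel

end TT

namespace TT

def Aut (π : Lab ≃ Lab) : Prop := ∀ p q, dj (π p) (π q) = dj p q

theorem norm_ex_u : ∀ v x : Lab, dj v x = false → v ≠ x → ∃ u, dj u v = true ∧ dj u x = true := by decide +kernel
theorem norm_ex_x : ∀ u v : Lab, dj u v = true → ∃ x, dj u x = true ∧ dj v x = false ∧ v ≠ x := by decide +kernel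
theorem norm_ex_v : ∀ u : Lab, ∃ v, dj u v = true := by decide +kernel

theorem normS (v x : Lab) (h : dj v x = false) (hne : v ≠ x) : ∃ π, Aut π ∧ π v = 13 ∧ π x = 14 := by
  obtain ⟨u, h1, h2⟩ := norm_ex_u v x h hne
  obtain ⟨π, h1, h2, h3, h4⟩ := norm3 u v x h1 h2 h hne
  exact ⟨π, h1, h3, h4⟩
theorem normD (u v : Lab) (h : dj u v = true) : ∃ π, Aut π ∧ π u = 0 ∧ π v = 13 := by
  obtain ⟨x, h1, h2, h3⟩ := norm_ex_x u v h
  obtain ⟨π, h1, h2, h3, h4⟩ := norm3 u v x h h1 h2 h3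
  exact ⟨π, h1, h2, h3⟩
theorem norm1 (u : Lab) : ∃ π, Aut π ∧ π u = 0 := by
  obtain ⟨v, h⟩ := norm_ex_v u
  obtain ⟨π, h1, h2, h3⟩ := normD u v h
  exact ⟨π, h1, h2⟩

/-- image of a finset -/
def im (π : Lab ≃ Lab) (D : Finset Lab) : Finset Lab := D.map π.toEmbedding

theorem mem_im {π : Lab ≃ Lab} {D : Finset Lab} {q : Lab} : π q ∈ im π D ↔ q ∈ D := by
  simp [im]
theorem card_im (π : Lab ≃ Lab) (D : Finset Lab) : (im π D).card = D.card := Finset.card_map _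
theorem im_ext {π : Lab ≃ Lab} {D E : Finset Lab} (h : ∀ q, q ∈ D ↔ π q ∈ E) : im π D = E := by
  ext q
  obtain ⟨p, rfl⟩ := π.surjective q
  rw [mem_im, h]
theorem im_A {π : Lab ≃ Lab} (h : Aut π) (u : Lab) : im π (A u) = A (π u) :=
  im_ext fun q => by rw [mem_A, mem_A, h]
theorem im_N1 {π : Lab ≃ Lab} (h : Aut π) (D : Finset Lab) : im π (N1 D) = N1 (im π D) :=
  im_ext fun q => by
    rw [mem_N1, mem_N1]
    constructor
    · rintro ⟨p, hp, h1⟩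
      exact ⟨π p, mem_im.mpr hp, by rw [h]; exact h1⟩
    · rintro ⟨p, hp, h1⟩
      obtain ⟨p, rfl⟩ := π.surjective p
      exact ⟨p, mem_im.mp hp, by rwa [h] at h1⟩
theorem im_N2 {π : Lab ≃ Lab} (h : Aut π) (D : Finset Lab) : im π (N2 D) = N2 (im π D) :=
  im_ext fun q => by
    rw [mem_N2, mem_N2]
    constructor
    · rintro ⟨p, hp, p', hp', h1, h2, h3⟩
      exact ⟨π p, mem_im.mpr hp, π p', mem_im.mpr hp', by simpa using h1, by rwa [h], by rwa [h]⟩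
    · rintro ⟨p, hp, p', hp', h1, h2, h3⟩
      obtain ⟨p, rfl⟩ := π.surjective p
      obtain ⟨p', rfl⟩ := π.surjective p'
      exact ⟨p, mem_im.mp hp, p', mem_im.mp hp', by simpa using h1, by rwa [h] at h2, by rwa [h] at h3⟩
theorem im_inter (π : Lab ≃ Lab) (D E : Finset Lab) : im π (D ∩ E) = im π D ∩ im π E := Finset.map_inter _ _
theorem im_sdiff (π : Lab ≃ Lab) (D E : Finset Lab) : im π (D \ E) = im π D \ im π E :=
  im_ext fun q => by rw [Finset.mem_sdiff, Finset.mem_sdiff, mem_im, mem_im]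
theorem im_insert (π : Lab ≃ Lab) (a : Lab) (D : Finset Lab) : im π (insert a D) = insert (π a) (im π D) :=
  im_ext fun q => by rw [Finset.mem_insert, Finset.mem_insert, mem_im]; simp
theorem im_single (π : Lab ≃ Lab) (a : Lab) : im π {a} = {π a} := by simp [im]

theorem countP_in (D : Finset Lab) (l : List Lab) (hn : l.Nodup) :
    l.countP (fun q => decide (q ∈ D)) = (D.filter (· ∈ l)).card := by
  rw [List.countP_eq_length_filter, ← List.toFinset_card_of_nodup (hn.filter _)]
  congr 1; ext q; simp [and_comm]
theorem countP_notin (D : Finset Lab) (l : List Lab) (hn : l.Nodup) :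
    l.countP (fun q => decide (q ∉ D)) = (l.toFinset \ D).card := by
  rw [List.countP_eq_length_filter, ← List.toFinset_card_of_nodup (hn.filter _)]
  congr 1; ext q; simp

theorem rem_spec {P : ℕ → Bool} {l : List Lab} {j : ℕ} (h : allRem P (pw l) j 0 = true) (hn : l.Nodup)
    (D : Finset Lab) (hD : (l.toFinset \ D).card ≤ j) :
    ∃ m', P m' = true ∧ MSub m' D ∧ ∀ q : Lab, m'.testBit q.val = true ↔ q ∈ l ∧ q ∈ D := by
  obtain ⟨m', h1, h2⟩ := allRem_spec P D l j 0 h (by rw [countP_notin D l hn]; exact hD)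
  refine ⟨m', h1, fun q hq => ?_, fun q => ?_⟩
  · have := (h2 q).mp hq
    simp at this; exact this.2
  · rw [h2 q]; simp

theorem blt_iff {a b : ℕ} : Nat.blt a b = true ↔ a < b := by
  unfold Nat.blt; rw [Nat.ble_eq]; exact Iff.rfl

theorem CE_spec {m : ℕ} {D : Finset Lab} (hm : MSub m D) (h : CE m = true) : 25 ≤ (N1 D).card := by
  unfold CE at h
  rw [blt_iff, dmT_eq] at h
  exact le_trans h (cnt_card' _ _ _ (List.nodup_finRange 28) (fun q _ hq => one_N1 hm hq))

/-! K6 -/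
theorem l10_eq : l10.toFinset = A 13 ∩ A 14 := by decide +kernel
theorem l6_eq : l6.toFinset = A 0 ∩ A 13 := by decide +kernel
theorem LA0_eq : LA0.toFinset = A 0 := by decide +kernel

theorem K6 (s r : Lab) (h : dj s r = false) (hne : s ≠ r) (E : Finset Lab) (hE : ((A s ∩ A r) \ E).card ≤ 5) :
    25 ≤ (N1 E).card := by
  obtain ⟨π, hπ, h1, h2⟩ := normS s r h hne
  rw [← card_im π, im_N1 hπ]
  rw [← card_im π, im_sdiff, im_inter, im_A hπ, im_A hπ, h1, h2, ← l10_eq] at hE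
  obtain ⟨m, hm, hs, _⟩ := rem_spec ck6 (by decide) _ hE
  exact CE_spec hs hm

theorem K6' (s r : Lab) (h : dj s r = true) (E : Finset Lab) (hE : ((A s ∩ A r) \ E).card ≤ 2) :
    25 ≤ (N1 E).card := by
  obtain ⟨π, hπ, h1, h2⟩ := normD s r h
  rw [← card_im π, im_N1 hπ]
  rw [← card_im π, im_sdiff, im_inter, im_A hπ, im_A hπ, h1, h2, ← l6_eq] at hE
  obtain ⟨m, hm, hs, _⟩ := rem_spec ck6' (by decide) _ hE
  exact CE_spec hs hm

theorem K5' (v x : Lab) (h : dj v x = false) (hne : v ≠ x) (E : Finset Lab) (hE : ((A v ∩ A x) \ E).card ≤ 4) :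
    27 ≤ (N1 E).card := by
  obtain ⟨π, hπ, h1, h2⟩ := normS v x h hne
  rw [← card_im π, im_N1 hπ]
  rw [← card_im π, im_sdiff, im_inter, im_A hπ, im_A hπ, h1, h2, ← l10_eq] at hE
  obtain ⟨m, hm, hs, _⟩ := rem_spec ck5' (by decide) _ hE
  unfold P5' at hm
  rw [blt_iff, dmT_eq] at hm
  exact le_trans hm (cnt_card' _ _ _ (List.nodup_finRange 28) (fun q _ hq => one_N1 hs hq))

theorem L5_eq : ∀ u3, (L5 u3).toFinset = (A 13 ∩ A 14) \ {0, u3} := by decide +kernel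
theorem L5_nd : ∀ u3, (L5 u3).Nodup := fun _ => List.Nodup.filter _ (by decide)
theorem M5_mem (u3 q : Lab) : q ∈ M5 u3 ↔ q ∈ A u3 \ {13, 14} := by
  simp [M5, mem_A]
theorem M5_nd : ∀ u3, (M5 u3).Nodup := fun _ => List.Nodup.filter _ (List.nodup_finRange 28)

theorem K5 (u v x u3 : Lab) (h1 : dj u v = true) (h2 : dj u x = true) (h3 : dj v x = false) (h4 : v ≠ x)
    (S : Finset Lab) (hS : (((A v ∩ A x) \ {u, u3}) \ S).card ≤ 3) :
    8 ≤ ((A u3 \ {v, x}) ∩ N2 S).card := by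
  obtain ⟨π, hπ, e1, e2, e3⟩ := norm3 u v x h1 h2 h3 h4
  rw [← card_im π, im_inter, im_sdiff, im_N2 hπ, im_A hπ, im_insert, im_single, e2, e3]
  rw [← card_im π, im_sdiff, im_sdiff, im_inter, im_A hπ, im_A hπ, im_insert, im_single, e1, e2, e3, ← L5_eq] at hS
  obtain ⟨m, hm, hs, _⟩ := rem_spec (ck5 _) (L5_nd _) _ hS
  unfold P5 at hm
  rw [blt_iff] at hm
  refine le_trans hm (cnt_card' _ _ _ (M5_nd _) (fun q hq h => ?_))
  rw [Finset.mem_inter]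
  exact ⟨(M5_mem _ _).mp hq, two_N2 hs h⟩

theorem noc_nd (o) : (noc o).Nodup := List.Nodup.filter _ (List.nodup_finRange 28)
theorem star_cnt : ∀ (o : Fin 8) (u : Lab), 9 ≤ ((noc o).toFinset ∩ A u).card := by decide +kernel
theorem cardA : ∀ u : Lab, (A u).card = 15 := by decide +kernel
theorem mem_stars : ∀ o : Fin 8, o ∈ stars := by decide

theorem K1 (u u' : Lab) (W : Finset Lab) (hW : W ⊆ A u) (h5 : 5 ≤ W.card) : 9 ≤ (A u' ∩ N2 W).card := by
  obtain ⟨π, hπ, e1⟩ := norm1 u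
  rw [← card_im π, im_inter, im_N2 hπ, im_A hπ]
  have hW' : im π W ⊆ A 0 := by
    intro q hq
    obtain ⟨q, rfl⟩ := π.surjective q
    have := hW (mem_im.mp hq)
    rw [← e1, ← im_A hπ]; exact mem_im.mpr this
  rw [← card_im π] at h5
  generalize im π W = W at *
  generalize π u' = u'
  obtain ⟨m, hm, hs⟩ := allSub_spec _ W LA0 5 0 ck1 (by
    rw [countP_in W LA0 (by decide)]
    rw [Finset.filter_true_of_mem]
    · exact h5
    · intro q hq
      rw [← List.mem_toFinset, LA0_eq]; exact hW' hq) (by intro q hq; simp at hq)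
  unfold P1 at hm
  rw [Bool.or_eq_true, blt_iff, dmT_eq] at hm
  rcases hm with hm | hm
  · have h22 : 22 ≤ (N2 W).card := le_trans hm (cnt_card' _ _ _ (List.nodup_finRange 28) (fun q _ hq => two_N2 hs hq))
    have := Finset.card_union_add_card_inter (A u') (N2 W)
    have h28 : (A u' ∪ N2 W).card ≤ 28 := by simpa using Finset.card_le_univ (A u' ∪ N2 W)
    rw [cardA] at this
    omega
  · rw [anyL_iff] at hm
    obtain ⟨T, hT, hm⟩ := hm
    unfold nocT at hT
    rw [List.mem_map] at hT
    obtain ⟨o, _, rfl⟩ := hT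
    rw [allL_iff] at hm
    refine le_trans (star_cnt o u') (Finset.card_le_card ?_)
    intro q hq
    rw [Finset.mem_inter, List.mem_toFinset] at hq
    rw [Finset.mem_inter]
    exact ⟨hq.2, two_N2 hs (hm _ (List.mem_map_of_mem hq.1))⟩

theorem l8_eq : l8.toFinset = A 0 \ (A 13 ∪ {13}) := by decide +kernel

theorem im_union (π : Lab ≃ Lab) (D E : Finset Lab) : im π (D ∪ E) = im π D ∪ im π E := Finset.map_union _ _

theorem K7 (t s : Lab) (h : dj t s = true) (R : Finset Lab) (hR : ((A t \ (A s ∪ {s})) \ R).card ≤ 3) :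
    ∃ r1 ∈ R, ∃ r2 ∈ R, r1 ∈ A t \ (A s ∪ {s}) ∧ r2 ∈ A t \ (A s ∪ {s}) ∧ dj r1 r2 = true := by
  obtain ⟨π, hπ, h1, h2⟩ := normD t s h
  have hR' := hR
  rw [← card_im π, im_sdiff, im_sdiff, im_union, im_A hπ, im_A hπ, im_single, h1, h2, ← l8_eq] at hR'
  obtain ⟨m, hm, hs, hb⟩ := rem_spec ck7 (by decide) _ hR'
  unfold P7 at hm
  rw [List.any_eq_true] at hm
  obtain ⟨q, _, hq⟩ := hm
  rw [Bool.and_eq_true] at hq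
  obtain ⟨i, hi⟩ := one_spec hq.2
  change (dmf q &&& m).testBit i = true at hi
  rw [Nat.testBit_and, Bool.and_eq_true] at hi
  have hq1 := (hb q).mp hq.1
  have hq2 := (hb ⟨i, bit_lab hi.1⟩).mp hi.2
  have hd : dj q ⟨i, bit_lab hi.1⟩ = true := hi.1
  generalize (⟨i, bit_lab hi.1⟩ : Lab) = p at *
  rw [← List.mem_toFinset, l8_eq, ← h1, ← h2, ← im_A hπ, ← im_A hπ, ← im_single, ← im_union, ← im_sdiff] at hq1 hq2
  obtain ⟨q, rfl⟩ := π.surjective q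
  obtain ⟨p, rfl⟩ := π.surjective p
  rw [mem_im, mem_im] at hq1 hq2
  exact ⟨q, hq1.2, p, hq2.2, hq1.1, hq2.1, by rwa [hπ] at hd⟩

theorem R8_eq (s t : Lab) : (R8 s t).toFinset = (A t \ A s) \ {0} := by
  ext q; simp [R8, mem_A, dj_comm, and_assoc]
theorem R8_nd (s t : Lab) : (R8 s t).Nodup := List.Nodup.filter _ (List.nodup_finRange 28)
theorem X8_nd (t : Lab) : (X8 t).Nodup := List.Nodup.filter _ (by decide)
theorem X8_mem (t q : Lab) : q ∈ X8 t ↔ q ∈ (A 0 \ (A 13 ∪ {13})) \ {t} := by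
  rw [← l8_eq]; simp [X8]

theorem K8 (u v t s : Lab) (h : dj u v = true) (hst : dj s t = false) (hne : s ≠ t) (R : Finset Lab)
    (hR : (((A t \ A s) \ {u}) \ R).card ≤ 2) : 3 ≤ (((A u \ (A v ∪ {v})) \ {t}) ∩ N1 R).card := by
  obtain ⟨π, hπ, h1, h2⟩ := normD u v h
  rw [← card_im π, im_sdiff, im_sdiff, im_sdiff, im_A hπ, im_A hπ, im_single, h1, ← R8_eq] at hR
  rw [← card_im π, im_inter, im_sdiff, im_sdiff, im_union, im_N1 hπ, im_A hπ, im_A hπ, im_single, im_single, h1, h2]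
  obtain ⟨m, hm, hs, _⟩ := rem_spec (ck8 (π t) (π s) (by rw [hπ]; exact hst) (by simpa using hne)) (R8_nd _ _) _ hR
  unfold P8 at hm
  rw [blt_iff] at hm
  refine le_trans hm (cnt_card' _ _ _ (X8_nd _) (fun q hq h => ?_))
  rw [Finset.mem_inter]
  exact ⟨(X8_mem _ _).mp hq, one_N1 hs h⟩

/-! K9 -/
def tri (x y z : Lab) : Prop := dj x y = false ∧ dj x z = false ∧ dj y z = false ∧ x ≠ y ∧ x ≠ z ∧ y ≠ z ∧
  ∀ q, dj q y = true → dj q z = true → dj q x = true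
instance (x y z : Lab) : Decidable (tri x y z) := by unfold tri; infer_instance

theorem tri13 : tri 13 14 18 ∧ tri 13 15 19 ∧ tri 13 16 20 ∧ tri 13 17 21 := by decide +kernel

theorem tri_im {π : Lab ≃ Lab} (h : Aut π) {x y z : Lab} : tri (π x) (π y) (π z) ↔ tri x y z := by
  unfold tri
  rw [h, h, h]
  simp only [ne_eq, EmbeddingLike.apply_eq_iff_eq]
  refine and_congr_right fun _ => and_congr_right fun _ => and_congr_right fun _ => and_congr_right fun _ =>
    and_congr_right fun _ => and_congr_right fun _ => ?_
  constructor
  · intro H q; have := H (π q); rwa [h, h, h] at this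
  · intro H q
    obtain ⟨q, rfl⟩ := π.surjective q
    rw [h, h, h]; exact H q

theorem tri_unique (y z : Lab) : ∃ x0, ∀ x, tri x y z → x = x0 := by
  by_cases h : dj y z = false ∧ y ≠ z
  · obtain ⟨π, hπ, h1, h2⟩ := normS y z h.1 h.2
    refine ⟨π.symm 18, fun x hx => ?_⟩
    rw [← tri_im hπ, h1, h2] at hx
    rw [Equiv.eq_symm_apply]
    revert hx; generalize π x = x; revert x; decide +kernel
  · exact ⟨0, fun x hx => absurd ⟨hx.2.2.1, hx.2.2.2.2.2.1⟩ h⟩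

def G9 (t x : Lab) (D : Finset Lab) : Finset Lab :=
  (A t ∩ A x).filter (fun r => 25 ≤ (N1 ((D ∩ A r) \ {x})).card)

theorem K9_norm (D : Finset Lab) (hD : (A 0 \ D).card ≤ 3)
    (hc : ∀ y z, tri 13 y z → y ∈ A 0 → z ∈ A 0 → y ∈ D ∨ z ∈ D) : 4 ≤ (G9 0 13 D).card := by
  rw [← LA0_eq] at hD
  obtain ⟨m, hm, hs, hb⟩ := rem_spec ck9 (by decide) _ hD
  unfold P9 at hm
  rw [Bool.or_eq_true, blt_iff] at hm
  rcases hm with hm | hm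
  · exfalso
    have key : ∀ y z : Lab, tri 13 y z → y ∈ LA0 → z ∈ LA0 → (nb m y.val && nb m z.val) = true → False := by
      intro y z ht hy hz h
      rw [Bool.and_eq_true] at h
      unfold nb at h
      rcases hc y z ht (by rw [← LA0_eq, List.mem_toFinset]; exact hy) (by rw [← LA0_eq, List.mem_toFinset]; exact hz) with h' | h'
      · have := (hb y).mpr ⟨hy, h'⟩
        rw [this] at h; simp at h
      · have := (hb z).mpr ⟨hz, h'⟩
        rw [this] at h; simp at h
    unfold clos at hm
    rw [Bool.or_eq_true, Bool.or_eq_true, Bool.or_eq_true] at hm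
    obtain ⟨t1, t2, t3, t4⟩ := tri13
    rcases hm with ((hm | hm) | hm) | hm
    · exact key 14 18 t1 (by decide) (by decide) hm
    · exact key 15 19 t2 (by decide) (by decide) hm
    · exact key 16 20 t3 (by decide) (by decide) hm
    · exact key 17 21 t4 (by decide) (by decide) hm
  · refine le_trans hm (cnt_card' _ _ _ (by decide) (fun q hq h => ?_))
    unfold G9
    rw [Finset.mem_filter]
    refine ⟨by rw [← l6_eq, List.mem_toFinset]; exact hq, CE_spec ?_ h⟩
    intro p hp
    change ((m &&& dmf q) &&& 268427263).testBit p.val = true at hp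
    rw [Nat.testBit_and, Nat.testBit_and, Bool.and_eq_true, Bool.and_eq_true] at hp
    rw [Finset.mem_sdiff, Finset.mem_inter, mem_A, Finset.mem_singleton]
    refine ⟨⟨hs _ hp.1.1, hp.1.2⟩, ?_⟩
    rintro rfl
    exact absurd hp.2 (by decide)

theorem im_G9 {π : Lab ≃ Lab} (h : Aut π) (t x : Lab) (D : Finset Lab) : im π (G9 t x D) = G9 (π t) (π x) (im π D) :=
  im_ext fun q => by
    unfold G9
    rw [Finset.mem_filter, Finset.mem_filter, ← im_A h, ← im_A h, ← im_A h, ← im_inter, ← im_inter, mem_im, ← im_single,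
      ← im_sdiff, ← im_N1 h, card_im]

theorem K9 (t x : Lab) (h : dj t x = true) (D : Finset Lab) (hD : (A t \ D).card ≤ 3)
    (hc : ∀ y z, tri x y z → y ∈ A t → z ∈ A t → y ∈ D ∨ z ∈ D) : 4 ≤ (G9 t x D).card := by
  obtain ⟨π, hπ, h1, h2⟩ := normD t x h
  rw [← card_im π, im_G9 hπ, h1, h2]
  apply K9_norm
  · rw [← h1, ← im_A hπ, ← im_sdiff, card_im]; exact hD
  · intro y z
    obtain ⟨y, rfl⟩ := π.surjective y
    obtain ⟨z, rfl⟩ := π.surjective z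
    rw [← h2, tri_im hπ, ← h1, ← im_A hπ, mem_im, mem_im, mem_im, mem_im]
    exact hc y z

/-! small facts -/
theorem card_fl (f : Lab → Bool) (S : Finset Lab) (h : ∀ q, q ∈ S ↔ f q = true) :
    S.card = (List.finRange 28).countP f := by
  rw [List.countP_eq_length_filter, ← List.toFinset_card_of_nodup ((List.nodup_finRange 28).filter _)]
  congr 1; ext q; simp [h]
theorem cardAA (u v : Lab) : 6 ≤ (A u ∩ A v).card := by
  rw [card_fl (fun q => dj u q && dj v q) _ (by simp [mem_A])]
  revert u v; decide +kernel
theorem cardAA' (u v : Lab) (h : dj u v = false) : 10 ≤ (A u ∩ A v).card := by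
  rw [card_fl (fun q => dj u q && dj v q) _ (by simp [mem_A])]
  revert u v; decide +kernel
theorem cardX (u v : Lab) (h : dj u v = true) : 8 ≤ (A u \ (A v ∪ {v})).card := by
  rw [card_fl (fun q => dj u q && (!decide (q = v) && !(dj v q))) _ (by simp [mem_A])]
  revert u v; decide +kernel
theorem cardY (u v : Lab) (h : dj u v = false) (h' : u ≠ v) : 5 ≤ (A u \ A v).card := by
  rw [card_fl (fun q => dj u q && !(dj v q)) _ (by simp [mem_A])]
  revert u v; decide +kernel
theorem lemC (u v : Lab) (h : dj u v = true) : (Finset.univ \ (A u ∪ A v)).card ≤ 4 := by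
  rw [card_fl (fun q => !(dj u q) && !(dj v q)) _ (by simp [mem_A])]
  revert u v; decide +kernel

theorem K3a_norm (g g' : Lab) : 3 ≤ ((A 0).filter (fun x => (g ∉ A x ∨ g ∉ A 0) ∧ (g' ∉ A x ∨ g' ∉ A 0))).card := by
  rw [card_fl (fun q => dj 0 q && ((!(dj q g) || !(dj 0 g)) && (!(dj q g') || !(dj 0 g')))) _ (by simp [mem_A])]
  revert g g'; decide +kernel
theorem K4a_norm (x f : Lab) : 3 ≤ ((A 0 ∩ A x).filter (fun r => f ∉ A r ∨ f ∉ A 0 ∨ f = x)).card := by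
  rw [card_fl (fun q => (dj 0 q && dj x q) && (!(dj q f) || (!(dj 0 f) || decide (f = x)))) _ (by simp [mem_A])]
  revert x f; decide +kernel

theorem K3a (u g g' : Lab) : 3 ≤ ((A u).filter (fun x => (g ∉ A x ∨ g ∉ A u) ∧ (g' ∉ A x ∨ g' ∉ A u))).card := by
  obtain ⟨π, hπ, h1⟩ := norm1 u
  have := K3a_norm (π g) (π g')
  rw [← card_im π]
  refine le_of_le_of_eq this (congrArg _ (im_ext fun q => ?_).symm)
  rw [← h1, Finset.mem_filter, Finset.mem_filter, ← im_A hπ, ← im_A hπ, mem_im, mem_im, mem_im, mem_im, mem_im]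

theorem K4a (t x f : Lab) : 3 ≤ ((A t ∩ A x).filter (fun r => f ∉ A r ∨ f ∉ A t ∨ f = x)).card := by
  obtain ⟨π, hπ, h1⟩ := norm1 t
  have := K4a_norm (π x) (π f)
  rw [← card_im π]
  refine le_of_le_of_eq this (congrArg _ (im_ext fun q => ?_).symm)
  rw [← h1, Finset.mem_filter, Finset.mem_filter, ← im_A hπ, ← im_A hπ, ← im_A hπ, ← im_inter, mem_im, mem_im, mem_im]
  simp

end TT

namespace TT

structure Lin (n : ℕ) (L : ℕ → Finset Lab) (m : ℕ → Lab) : Prop where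
  d1 : ∀ i, i + 1 < n → dj (m i) (m (i + 1)) = true
  d2 : dj (m (n - 1)) (m 0) = true
  e1 : ∀ i, i + 2 < n → m i ≠ m (i + 2)
  e2 : m (n - 2) ≠ m 0
  e3 : m (n - 1) ≠ m 1
  mem : ∀ i, i < n → m i ∈ L i

structure Cyc (n : ℕ) (L : ℕ → Finset Lab) (m : ℕ → Lab) : Prop where
  per : ∀ i, m (i + n) = m i
  d : ∀ i, dj (m i) (m (i + 1)) = true
  e : ∀ i, m i ≠ m (i + 2)
  mem : ∀ i, m i ∈ L i

theorem per_mod {α : Type*} {n : ℕ} {f : ℕ → α} (h : ∀ i, f (i + n) = f i) (i : ℕ) : f (i % n) = f i := by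
  have : ∀ k j, f (j + n * k) = f j := by
    intro k
    induction k with
    | zero => simp
    | succ k ih => intro j; rw [Nat.mul_succ, ← add_assoc, h, ih]
  conv_rhs => rw [← Nat.mod_add_div i n]
  rw [this]

theorem Lin.toCyc {n : ℕ} (hn : 3 ≤ n) {L : ℕ → Finset Lab} (hL : ∀ i, L (i + n) = L i) {m : ℕ → Lab} (h : Lin n L m) :
    Cyc n L (fun i => m (i % n)) where
  per i := by simp
  d i := by
    have h1 : i % n < n := Nat.mod_lt _ (by omega)
    by_cases hc : i % n + 1 < n
    · have : (i + 1) % n = i % n + 1 := by rw [Nat.add_mod, Nat.mod_eq_of_lt (by omega : 1 < n), Nat.mod_eq_of_lt hc]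
      simp only [this]; exact h.d1 _ hc
    · have : (i + 1) % n = 0 := by
        rw [Nat.add_mod, Nat.mod_eq_of_lt (by omega : 1 < n), show i % n + 1 = n by omega, Nat.mod_self]
      simp only [this, show i % n = n - 1 by omega]; exact h.d2
  e i := by
    have h1 : i % n < n := Nat.mod_lt _ (by omega)
    by_cases hc : i % n + 2 < n
    · have : (i + 2) % n = i % n + 2 := by rw [Nat.add_mod, Nat.mod_eq_of_lt (by omega : 2 < n), Nat.mod_eq_of_lt hc]
      simp only [this]; exact h.e1 _ hc
    · by_cases hc2 : i % n + 2 = n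
      · have : (i + 2) % n = 0 := by
          rw [Nat.add_mod, Nat.mod_eq_of_lt (by omega : 2 < n), hc2, Nat.mod_self]
        simp only [this, show i % n = n - 2 by omega]; exact h.e2
      · have : (i + 2) % n = 1 := by
          rw [Nat.add_mod, Nat.mod_eq_of_lt (by omega : 2 < n), show i % n + 2 = 1 + n by omega, Nat.add_mod_right,
            Nat.mod_eq_of_lt (by omega)]
        simp only [this, show i % n = n - 1 by omega]; exact h.e3
  mem i := by
    have := h.mem (i % n) (Nat.mod_lt _ (by omega))
    rwa [per_mod hL] at this

structure Good (L : ℕ → Finset Lab) (x r : Lab) (j : ℕ) (S : Finset Lab) : Prop where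
  sub : S ⊆ L j
  card : 5 ≤ S.card
  path : ∀ q ∈ S, ∀ y, (j = 1 → y ≠ x) → ∃ p : ℕ → Lab, p 0 = x ∧ p 1 ≠ r ∧ p j = q ∧ p (j - 1) ≠ y ∧
    (∀ i, i < j → dj (p i) (p (i + 1)) = true) ∧ (∀ i, i + 2 ≤ j → p i ≠ p (i + 2)) ∧ ∀ i, i ≤ j → p i ∈ L i

theorem Good.step {L : ℕ → Finset Lab} {x r : Lab} {j : ℕ} (hj : 1 ≤ j) {S : Finset Lab} (h : Good L x r j S)
    {S' : Finset Lab} (hS' : S' ⊆ L (j + 1)) (hN : S' ⊆ N2 S) (h5 : 5 ≤ S'.card) (hx : j = 1 → x ∉ S') :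
    Good L x r (j + 1) S' where
  sub := hS'
  card := h5
  path := by
    intro q hq y _
    obtain ⟨p1, hp1, p2, hp2, hne, hd1, hd2⟩ := mem_N2.mp (hN hq)
    have : ∃ p ∈ S, dj q p = true ∧ p ≠ y := by
      by_cases hy : p1 = y
      · exact ⟨p2, hp2, hd2, fun h => hne (hy.trans h.symm)⟩
      · exact ⟨p1, hp1, hd1, hy⟩
    obtain ⟨p0, hp0, hd, hy⟩ := this
    obtain ⟨p, h0, h1, h2, h3, h4, h5, h6⟩ := h.path p0 hp0 q (fun hj1 hqx => hx hj1 (hqx ▸ hq))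
    refine ⟨fun i => if i ≤ j then p i else q, by simp [h0], by simp [hj, h1], by simp, by simpa [h2] using hy, ?_, ?_, ?_⟩
    · intro i hi
      rcases Nat.lt_or_ge i j with hij | hij
      · simpa [show i ≤ j by omega, show i + 1 ≤ j by omega] using h4 i hij
      · have : i = j := by omega
        subst this
        simpa [h2] using dj_symm hd
    · intro i hi
      by_cases hij : i + 2 ≤ j
      · simpa [show i ≤ j by omega, hij] using h5 i hij
      · have : i = j - 1 := by omega
        subst this
        simpa [show ¬ (j - 1 + 2 ≤ j) by omega] using h3
    · intro i hi
      by_cases hij : i ≤ j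
      · simpa [hij] using h6 i hij
      · have : i = j + 1 := by omega
        subst this
        simpa using hS' hq

theorem card_inter_sdiff {X Y : Finset Lab} : X.card ≤ (Y ∩ X).card + (X \ Y).card := by
  rw [Finset.inter_comm, ← Finset.card_inter_add_card_sdiff X Y]

theorem core (n : ℕ) (hn : 4 ≤ n) (L : ℕ → Finset Lab) (b : ℕ → Lab) (hL : ∀ i, L i ⊆ A (b i))
    (hL4 : ∀ i, (A (b i) \ L i).card ≤ 4) (x r : Lab) (hx : x ∈ L 0) (hr : r ∈ L (n - 1)) (hd : dj r x = true)
    (h1 : 5 ≤ ((L 1 ∩ A x) \ {r}).card)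
    (h2 : 5 ≤ ((L 2 \ {x}) ∩ N2 ((L 1 ∩ A x) \ {r})).card)
    (hE : 25 ≤ (N1 ((L (n - 2) ∩ A r) \ {x})).card) : ∃ m, Lin n L m := by
  set S1 := (L 1 ∩ A x) \ {r} with hS1
  have g1 : Good L x r 1 S1 := by
    refine ⟨fun q hq => by simp [hS1] at hq; exact hq.1.1, h1, ?_⟩
    intro q hq y hy
    simp only [hS1, Finset.mem_sdiff, Finset.mem_inter, mem_A, Finset.mem_singleton] at hq
    refine ⟨fun i => if i = 0 then x else q, by simp, by simpa using hq.2, by simp, by simpa using (hy rfl).symm, ?_, ?_, ?_⟩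
    · intro i hi
      have : i = 0 := by omega
      subst this; simpa using hq.1.2
    · intro i hi; omega
    · intro i hi
      by_cases h0 : i = 0
      · subst h0; simpa using hx
      · have : i = 1 := by omega
        subst this; simpa using hq.1.1
  have g2 : Good L x r 2 ((L 2 \ {x}) ∩ N2 S1) :=
    g1.step le_rfl (fun q hq => by simp at hq; exact hq.1.1) Finset.inter_subset_right h2 (by simp)
  have gk : ∀ k, ∃ S, Good L x r (k + 1) S := by
    intro k
    induction k with
    | zero => exact ⟨_, g1⟩
    | succ k ih =>
      rcases Nat.eq_zero_or_pos k with rfl | hk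
      · exact ⟨_, g2⟩
      · obtain ⟨S, hS⟩ := ih
        refine ⟨L (k + 1 + 1) ∩ N2 S, hS.step (by omega) Finset.inter_subset_left Finset.inter_subset_right ?_ (by omega)⟩
        have hk1 := K1 (b (k + 1)) (b (k + 1 + 1)) S (hS.sub.trans (hL _)) hS.card
        have hk2 := hL4 (k + 1 + 1)
        have : A (b (k + 1 + 1)) ∩ N2 S ⊆ (L (k + 1 + 1) ∩ N2 S) ∪ (A (b (k + 1 + 1)) \ L (k + 1 + 1)) := by
          intro q hq
          simp only [Finset.mem_inter, Finset.mem_union, Finset.mem_sdiff] at hq ⊢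
          tauto
        have := (Finset.card_le_card this).trans (Finset.card_union_le _ _)
        omega
  obtain ⟨S, hS⟩ := gk (n - 4)
  rw [show n - 4 + 1 = n - 3 by omega] at hS
  set E := (L (n - 2) ∩ A r) \ {x} with hEd
  have : ∃ q ∈ S, q ≠ r ∧ q ∈ N1 E := by
    by_contra hc
    push Not at hc
    have hdis : Disjoint (S \ {r}) (N1 E) := by
      rw [Finset.disjoint_left]
      intro q hq
      simp only [Finset.mem_sdiff, Finset.mem_singleton] at hq
      exact hc q hq.1 hq.2
    have c1 := Finset.card_union_of_disjoint hdis
    have c2 : (S \ {r} ∪ N1 E).card ≤ 28 := by simpa using Finset.card_le_univ (S \ {r} ∪ N1 E)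
    have c3 := Finset.le_card_sdiff {r} S
    have := hS.card
    simp at c3
    omega
  obtain ⟨q, hq, hqr, hqE⟩ := this
  obtain ⟨t, ht, hqt⟩ := mem_N1.mp hqE
  simp only [hEd, Finset.mem_sdiff, Finset.mem_inter, mem_A, Finset.mem_singleton] at ht
  obtain ⟨p, p0, p1, pj, py, pd, pe, pm⟩ := hS.path q hq t (fun _ => ht.2)
  refine ⟨fun i => if i ≤ n - 3 then p i else if i = n - 2 then t else r, ?_, ?_, ?_, ?_, ?_, ?_⟩
  · intro i hi
    by_cases h : i < n - 3
    · simpa [show i ≤ n - 3 by omega, show i + 1 ≤ n - 3 by omega] using pd i h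
    · by_cases h' : i = n - 3
      · subst h'
        simpa [show n - 3 + 1 = n - 2 by omega, show ¬ (n - 2 ≤ n - 3) by omega, pj] using hqt
      · have : i = n - 2 := by omega
        subst this
        simpa [show ¬ (n - 2 ≤ n - 3) by omega, show ¬ (n - 2 + 1 ≤ n - 3) by omega] using dj_symm ht.1.2
  · simpa [show ¬ (n - 1 ≤ n - 3) by omega, show ¬ (n - 1 = n - 2) by omega, p0] using hd
  · intro i hi
    by_cases h : i + 2 ≤ n - 3
    · simpa [show i ≤ n - 3 by omega, h] using pe i h
    · by_cases h' : i = n - 4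
      · subst h'
        have := py
        rw [show n - 3 - 1 = n - 4 by omega] at this
        simpa [show n - 4 ≤ n - 3 by omega, show n - 4 + 2 = n - 2 by omega, show ¬ (n - 2 ≤ n - 3) by omega] using this
      · have : i = n - 3 := by omega
        subst this
        simpa [show ¬ (n - 3 + 2 ≤ n - 3) by omega, show ¬ (n - 3 + 2 = n - 2) by omega, pj] using hqr
  · simpa [show ¬ (n - 2 ≤ n - 3) by omega, p0] using ht.2
  · simpa [show ¬ (n - 1 ≤ n - 3) by omega, show ¬ (n - 1 = n - 2) by omega, show 1 ≤ n - 3 by omega] using p1.symm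
  · intro i hi
    by_cases h : i ≤ n - 3
    · simpa [h] using pm i h
    · by_cases h' : i = n - 2
      · subst h'
        simpa [show ¬ (n - 2 ≤ n - 3) by omega] using ht.1.1
      · have : i = n - 1 := by omega
        subst this
        simpa [show ¬ (n - 1 ≤ n - 3) by omega, show ¬ (n - 1 = n - 2) by omega] using hr

end TT

namespace TT

def LL (n : ℕ) (u g h : ℕ → Lab) (i : ℕ) : Finset Lab := A (u i) \ {g i, h i, u (i + 1), u (i + (n - 1))}

theorem mem_LL {n : ℕ} {u g h : ℕ → Lab} {i : ℕ} {q : Lab} : q ∈ LL n u g h i ↔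
    dj (u i) q = true ∧ q ≠ g i ∧ q ≠ h i ∧ q ≠ u (i + 1) ∧ q ≠ u (i + (n - 1)) := by
  simp [LL, mem_A]

theorem pick {S T : Finset Lab} (h : T.card < S.card) : ∃ x ∈ S, x ∉ T := Finset.exists_mem_notMem_of_card_lt_card h
theorem pick2 {S : Finset Lab} (h : 3 ≤ S.card) (a b : Lab) : ∃ x ∈ S, x ≠ a ∧ x ≠ b := by
  obtain ⟨x, hx, hn⟩ := pick (S := S) (T := {a, b}) (lt_of_le_of_lt Finset.card_le_two h)
  simp at hn; exact ⟨x, hx, hn⟩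
theorem pick3 {S : Finset Lab} (h : 4 ≤ S.card) (a b c : Lab) : ∃ x ∈ S, x ≠ a ∧ x ≠ b ∧ x ≠ c := by
  obtain ⟨x, hx, hn⟩ := pick (S := S) (T := {a, b, c}) (lt_of_le_of_lt Finset.card_le_three h)
  simp at hn; exact ⟨x, hx, hn⟩
theorem card_cov {X Y F : Finset Lab} (h : ∀ q ∈ X, q ∈ Y ∨ q ∈ F) : X.card ≤ Y.card + F.card :=
  (Finset.card_le_card (fun q hq => Finset.mem_union.mpr (h q hq))).trans (Finset.card_union_le _ _)
theorem card_miss {X E F : Finset Lab} (h : ∀ q ∈ X, q ∉ E → q ∈ F) : (X \ E).card ≤ F.card :=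
  Finset.card_le_card (fun q hq => by rw [Finset.mem_sdiff] at hq; exact h q hq.1 hq.2)
theorem meet28 {S T : Finset Lab} (h : 28 < S.card + T.card) : ∃ q ∈ S, q ∈ T := by
  by_contra hc
  push Not at hc
  have c1 := Finset.card_union_of_disjoint (Finset.disjoint_left.mpr hc)
  have c2 : (S ∪ T).card ≤ 28 := by simpa using Finset.card_le_univ (S ∪ T)
  omega
theorem c5 (a b c d e : Lab) : ({a, b, c, d, e} : Finset Lab).card ≤ 5 := Finset.card_le_five
theorem c4 (a b c d : Lab) : ({a, b, c, d} : Finset Lab).card ≤ 4 := Finset.card_le_four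
theorem c3 (a b c : Lab) : ({a, b, c} : Finset Lab).card ≤ 3 := Finset.card_le_three
theorem c2 (a b : Lab) : ({a, b} : Finset Lab).card ≤ 2 := Finset.card_le_two

theorem ne_of_dj {a b c : Lab} (h1 : dj a b = true) (h2 : dj a c = false) : b ≠ c := by
  rintro rfl; rw [h1] at h2; exact absurd h2 (by decide)

theorem lin3 (L : ℕ → Finset Lab) (x p t : Lab) (hx : x ∈ L 0) (hp : p ∈ L 1) (ht : t ∈ L 2) (h1 : dj x p = true)
    (h2 : dj x t = true) (h3 : dj t p = true) : ∃ m, Lin 3 L m := by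
  refine ⟨fun i => if i = 0 then x else if i = 1 then p else t, ?_, ?_, ?_, ?_, ?_, ?_⟩
  · intro i hi
    have : i < 2 := by omega
    clear hi; interval_cases i
    · simpa using h1
    · simpa using dj_symm h3
  · simpa using dj_symm h2
  · intro i hi
    have : i < 1 := by omega
    clear hi; interval_cases i
    simpa using dj_ne h2
  · simpa using (dj_ne h1).symm
  · simpa using dj_ne h3
  · intro i hi
    interval_cases i
    · simpa using hx
    · simpa using hp
    · simpa using ht

theorem LL_miss (n : ℕ) (u g h : ℕ → Lab) (i : ℕ) : (A (u i) \ LL n u g h i).card ≤ 4 :=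
  (card_miss (F := {g i, h i, u (i + 1), u (i + (n - 1))}) (fun q hq hn => by
    rw [mem_LL] at hn; rw [mem_A] at hq
    simp only [Finset.mem_insert, Finset.mem_singleton]; tauto)).trans (c4 _ _ _ _)

theorem LL_sub (n : ℕ) (u g h : ℕ → Lab) (i : ℕ) : LL n u g h i ⊆ A (u i) := Finset.sdiff_subset

theorem N4_norm : ∀ x : Lab, 3 ≤ ((A 14 \ A 13) ∩ A x).card ∨
    ((∀ r, dj 14 r = true → dj x r = true → dj 13 r = true) ∧ x ∉ A 13) := by decide +kernel
theorem N4 (s t x : Lab) (h : dj s t = false) (hne : s ≠ t) : 3 ≤ ((A t \ A s) ∩ A x).card ∨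
    ((∀ r, dj t r = true → dj x r = true → dj s r = true) ∧ x ∉ A s) := by
  obtain ⟨π, hπ, h1, h2⟩ := normS s t h hne
  have := N4_norm (π x)
  rw [← h1, ← h2, ← im_A hπ, ← im_A hπ, ← im_A hπ, ← im_sdiff, ← im_inter, card_im, mem_im] at this
  rcases this with h | ⟨h, h'⟩
  · exact Or.inl h
  · refine Or.inr ⟨fun r hr hr' => ?_, h'⟩
    have := h (π r)
    rw [hπ, hπ, hπ] at this
    exact this hr hr'
theorem K4b_norm (x f : Lab) (h : dj 0 x = false) : 4 ≤ ((A 0 ∩ A x).filter (fun r => f ∉ A r ∨ f ∉ A 0)).card := by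
  rw [card_fl (fun q => (dj 0 q && dj x q) && (!(dj q f) || !(dj 0 f))) _ (by simp [mem_A])]
  revert x f; decide +kernel
theorem K4b (t x f : Lab) (h : dj t x = false) : 4 ≤ ((A t ∩ A x).filter (fun r => f ∉ A r ∨ f ∉ A t)).card := by
  obtain ⟨π, hπ, h1⟩ := norm1 t
  have := K4b_norm (π x) (π f) (by rw [← h1, hπ]; exact h)
  rw [← card_im π]
  refine le_of_le_of_eq this (congrArg _ (im_ext fun q => ?_).symm)
  rw [← h1, Finset.mem_filter, Finset.mem_filter, ← im_A hπ, ← im_A hπ, ← im_A hπ, ← im_inter, mem_im, mem_im, mem_im]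

section N
variable (n : ℕ) (hn : 3 ≤ n) (u g h : ℕ → Lab) (pu : ∀ i, u (i + n) = u i) (hN : ∀ i, dj (u i) (u (i + 1)) = false)
include hn pu hN

theorem mem_LL_N {i : ℕ} {q : Lab} : q ∈ LL n u g h i ↔ dj (u i) q = true ∧ q ≠ g i ∧ q ≠ h i := by
  rw [mem_LL]
  constructor
  · tauto
  · rintro ⟨h1, h2, h3⟩
    refine ⟨h1, h2, h3, ne_of_dj h1 (hN i), ne_of_dj h1 ?_⟩
    have := hN (i + (n - 1))
    rw [show i + (n - 1) + 1 = i + n by omega, pu] at this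
    rw [dj_comm]; exact this

theorem N_x : ∃ x ∈ LL n u g h 0, 6 ≤ (LL n u g h 1 ∩ A x).card ∧ 25 ≤ (N1 (LL n u g h 1 ∩ A x)).card := by
  have key : ∀ x, ∀ q ∈ A (u 1) ∩ A x, q ∉ LL n u g h 1 ∩ A x → q = g 1 ∨ q = h 1 := by
    intro x q hq hn'
    rw [Finset.mem_inter, mem_A, mem_A] at hq
    rw [Finset.mem_inter, mem_LL_N n hn u g h pu hN, mem_A] at hn'
    tauto
  by_cases hne : u 0 = u 1
  · obtain ⟨x, hx, hg, hh⟩ := pick2 (K3a (u 1) (g 1) (h 1)) (g 0) (h 0)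
    rw [Finset.mem_filter, mem_A] at hx
    have hsub : A (u 1) ∩ A x ⊆ LL n u g h 1 ∩ A x := by
      intro q hq
      by_contra hc
      rw [Finset.mem_inter] at hq
      rcases key x q (Finset.mem_inter.mpr hq) hc with rfl | rfl <;> tauto
    refine ⟨x, (mem_LL_N n hn u g h pu hN).mpr ⟨by rw [hne]; exact hx.1, hg, hh⟩, ?_, ?_⟩
    · exact (cardAA _ _).trans (Finset.card_le_card hsub)
    · apply K6' (u 1) x hx.1
      rw [Finset.sdiff_eq_empty_iff_subset.mpr hsub]; simp
  · obtain ⟨x, hx, hg, hh⟩ := pick2 (S := A (u 0) \ A (u 1)) (le_trans (by norm_num) (cardY _ _ (hN 0) hne)) (g 0) (h 0)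
    rw [Finset.mem_sdiff, mem_A, mem_A, Bool.not_eq_true] at hx
    refine ⟨x, (mem_LL_N n hn u g h pu hN).mpr ⟨hx.1, hg, hh⟩, ?_, ?_⟩
    · have h1 := cardAA' (u 1) x hx.2
      have h2 := card_cov (X := A (u 1) ∩ A x) (Y := LL n u g h 1 ∩ A x) (F := {g 1, h 1}) (fun q hq => by
        by_contra hc
        push Not at hc
        have := key x q hq hc.1
        simp at hc; tauto)
      have := c2 (g 1) (h 1)
      omega
    · apply K6 (u 1) x hx.2 (ne_of_dj hx.1 (hN 0)).symm
      refine (card_miss (F := {g 1, h 1}) (fun q hq hn' => ?_)).trans ((c2 _ _).trans (by norm_num))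
      simpa using key x q hq hn'

theorem N_r (hn4 : 4 ≤ n) (x : Lab) : ∃ r ∈ LL n u g h (n - 1), dj r x = true ∧
    25 ≤ (N1 ((LL n u g h (n - 2) ∩ A r) \ {x})).card := by
  have hst : dj (u (n - 2)) (u (n - 1)) = false := by
    have := hN (n - 2); rwa [show n - 2 + 1 = n - 1 by omega] at this
  have key : ∀ r, ∀ q ∈ A (u (n - 2)) ∩ A r, q ∉ (LL n u g h (n - 2) ∩ A r) \ {x} → q = g (n - 2) ∨ q = h (n - 2) ∨ q = x := by
    intro r q hq hn'
    rw [Finset.mem_inter, mem_A, mem_A] at hq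
    rw [Finset.mem_sdiff, Finset.mem_inter, mem_LL_N n hn u g h pu hN, mem_A, Finset.mem_singleton] at hn'
    tauto
  by_cases hne : u (n - 2) = u (n - 1)
  · obtain ⟨r, hr, hg, hh⟩ := pick2 (K4a (u (n - 1)) x (g (n - 2))) (g (n - 1)) (h (n - 1))
    rw [Finset.mem_filter, Finset.mem_inter, mem_A, mem_A] at hr
    refine ⟨r, (mem_LL_N n hn u g h pu hN).mpr ⟨hr.1.1, hg, hh⟩, dj_symm hr.1.2, ?_⟩
    apply K6' (u (n - 2)) r (by rw [hne]; exact hr.1.1)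
    refine (card_miss (F := {h (n - 2), x}) (fun q hq hn' => ?_)).trans (c2 _ _)
    rw [Finset.mem_insert, Finset.mem_singleton]
    rw [hne] at hq
    have hk := key r q (by rw [hne]; exact hq) hn'
    rw [Finset.mem_inter] at hq
    rcases hk with rfl | hk | hk
    · tauto
    · tauto
    · tauto
  · rcases N4 _ _ x hst hne with h3 | ⟨h3, h3'⟩
    · obtain ⟨r, hr, hg, hh⟩ := pick2 h3 (g (n - 1)) (h (n - 1))
      rw [Finset.mem_inter, Finset.mem_sdiff, mem_A, mem_A, mem_A, Bool.not_eq_true] at hr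
      refine ⟨r, (mem_LL_N n hn u g h pu hN).mpr ⟨hr.1.1, hg, hh⟩, dj_symm hr.2, ?_⟩
      apply K6 (u (n - 2)) r hr.1.2 (ne_of_dj hr.1.1 (by rw [dj_comm]; exact hst)).symm
      refine (card_miss (F := {g (n - 2), h (n - 2), x}) (fun q hq hn' => ?_)).trans ((c3 _ _ _).trans (by norm_num))
      simpa using key r q hq hn'
    · obtain ⟨r, hr, hg, hh⟩ := pick2 (le_trans (by norm_num) (cardAA (u (n - 1)) x)) (g (n - 1)) (h (n - 1))
      rw [Finset.mem_inter, mem_A, mem_A] at hr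
      refine ⟨r, (mem_LL_N n hn u g h pu hN).mpr ⟨hr.1, hg, hh⟩, dj_symm hr.2, ?_⟩
      apply K6' (u (n - 2)) r (h3 r hr.1 hr.2)
      refine (card_miss (F := {g (n - 2), h (n - 2)}) (fun q hq hn' => ?_)).trans (c2 _ _)
      rw [Finset.mem_insert, Finset.mem_singleton]
      have hk := key r q hq hn'
      rw [Finset.mem_inter] at hq
      rcases hk with hk | hk | rfl
      · tauto
      · tauto
      · tauto

theorem worldN : ∃ m, Lin n (LL n u g h) m := by
  obtain ⟨x, hx, h6, h25⟩ := N_x n hn u g h pu hN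
  by_cases h3 : n = 3
  · have hE : 6 ≤ (A (u 2) ∩ A x).card := cardAA _ _
    have hE2 := card_cov (X := A (u 2) ∩ A x) (Y := LL n u g h 2 ∩ A x) (F := {g 2, h 2}) (fun q hq => by
        rw [Finset.mem_inter, mem_A, mem_A] at hq
        rw [Finset.mem_inter, mem_LL_N n hn u g h pu hN, mem_A, Finset.mem_insert, Finset.mem_singleton]
        clear * - hq; tauto)
    have := c2 (g 2) (h 2)
    obtain ⟨t, ht, htN⟩ := meet28 (S := LL n u g h 2 ∩ A x) (T := N1 (LL n u g h 1 ∩ A x)) (by omega)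
    obtain ⟨p, hp, hd⟩ := mem_N1.mp htN
    rw [Finset.mem_inter, mem_A] at ht hp
    subst h3
    exact lin3 _ x p t hx hp.1 ht.1 hp.2 ht.2 hd
  · obtain ⟨r, hr, hd, hE⟩ := N_r n hn u g h pu hN (by omega) x
    have hS1 : 5 ≤ ((LL n u g h 1 ∩ A x) \ {r}).card := by
      have := Finset.le_card_sdiff {r} (LL n u g h 1 ∩ A x)
      simp at this; omega
    refine core n (by omega) _ u (LL_sub n u g h) (LL_miss n u g h) x r hx hr hd hS1 ?_ hE
    have hk := K1 (u 1) (u 2) _ (fun q hq => LL_sub n u g h 1 (by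
      rw [Finset.mem_sdiff, Finset.mem_inter] at hq; exact hq.1.1)) hS1
    have h2 := card_cov (X := A (u 2) ∩ N2 ((LL n u g h 1 ∩ A x) \ {r}))
      (Y := (LL n u g h 2 \ {x}) ∩ N2 ((LL n u g h 1 ∩ A x) \ {r})) (F := {g 2, h 2, x}) (fun q hq => by
        rw [Finset.mem_inter, mem_A] at hq
        rw [Finset.mem_inter, Finset.mem_sdiff, mem_LL_N n hn u g h pu hN]
        simp only [Finset.mem_insert, Finset.mem_singleton]
        clear * - hq; tauto)
    have := c3 (g 2) (h 2) x
    omega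
end N

section D
variable (n : ℕ) (hn : 3 ≤ n) (u g h : ℕ → Lab) (pu : ∀ i, u (i + n) = u i) (hD : dj (u 0) (u 1) = true)
include hn pu hD

theorem D_xr (hn4 : 4 ≤ n) : ∃ x ∈ A (u 0) \ (A (u 1) ∪ {u 1}), (x ≠ u (n - 1) ∧ x ≠ g 0 ∧ x ≠ h 0) ∧
    ∃ r ∈ LL n u g h (n - 1), dj r x = true ∧ 25 ≤ (N1 ((LL n u g h (n - 2) ∩ A r) \ {x})).card := by
  have e1 : u (n - 1 + 1) = u 0 := by rw [show n - 1 + 1 = 0 + n by omega, pu]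
  have e2 : u (n - 1 + (n - 1)) = u (n - 2) := by rw [show n - 1 + (n - 1) = n - 2 + n by omega, pu]
  have e3 : u (n - 2 + 1) = u (n - 1) := by rw [show n - 2 + 1 = n - 1 by omega]
  have mr : ∀ r, r ∈ LL n u g h (n - 1) ↔ dj (u (n - 1)) r = true ∧ r ≠ g (n - 1) ∧ r ≠ h (n - 1) ∧ r ≠ u 0 ∧ r ≠ u (n - 2) := by
    intro r; rw [mem_LL, e1, e2]
  have ms : ∀ r, r ∈ LL n u g h (n - 2) ↔ dj (u (n - 2)) r = true ∧ r ≠ g (n - 2) ∧ r ≠ h (n - 2) ∧ r ≠ u (n - 1) ∧ r ≠ u (n - 2 + (n - 1)) := by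
    intro r; rw [mem_LL, e3]
  generalize u (n - 2 + (n - 1)) = w at *
  generalize u (n - 2) = s at *
  generalize u (n - 1) = t at *
  have hX := cardX _ _ hD
  have hX' : 5 ≤ ((A (u 0) \ (A (u 1) ∪ {u 1})) \ {t, g 0, h 0}).card := by
    have := Finset.le_card_sdiff {t, g 0, h 0} (A (u 0) \ (A (u 1) ∪ {u 1}))
    have := c3 t (g 0) (h 0)
    omega
  have key : ∀ x r, ∀ q ∈ A s ∩ A r, q ∉ (LL n u g h (n - 2) ∩ A r) \ {x} →
      q = g (n - 2) ∨ q = h (n - 2) ∨ q = t ∨ q = w ∨ q = x := by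
    intro x r q hq hn'
    rw [Finset.mem_inter, mem_A, mem_A] at hq
    rw [Finset.mem_sdiff, Finset.mem_inter, ms, mem_A, Finset.mem_singleton] at hn'
    tauto
  have fin6 : ∀ x r, dj s r = false → s ≠ r → 25 ≤ (N1 ((LL n u g h (n - 2) ∩ A r) \ {x})).card := by
    intro x r h1 h2
    apply K6 s r h1 h2
    refine (card_miss (F := {g (n - 2), h (n - 2), t, w, x}) (fun q hq hn' => ?_)).trans (c5 _ _ _ _ _)
    simpa using key x r q hq hn'
  by_cases hts : dj t s = true
  · obtain ⟨r1, hr1, r2, hr2, -, -, hd⟩ := K7 t s hts ((A t \ (A s ∪ {s})) \ {u 0, g (n - 1), h (n - 1)})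
      ((card_miss (F := {u 0, g (n - 1), h (n - 1)}) (fun q hq hn' => by
        rw [Finset.mem_sdiff] at hn'; tauto)).trans (c3 _ _ _))
    have hm : ∀ r ∈ (A t \ (A s ∪ {s})) \ {u 0, g (n - 1), h (n - 1)},
        r ∈ LL n u g h (n - 1) ∧ dj s r = false ∧ s ≠ r := by
      intro r hr
      simp only [Finset.mem_sdiff, Finset.mem_union, mem_A, Finset.mem_insert, Finset.mem_singleton] at hr
      push Not at hr
      simp only [Bool.not_eq_true] at hr
      rw [mr]
      exact ⟨⟨hr.1.1, hr.2.2.1, hr.2.2.2, hr.2.1, hr.1.2.2⟩, hr.1.2.1, hr.1.2.2.symm⟩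
    obtain ⟨x, hx, hxn⟩ := pick (lt_of_le_of_lt (lemC r1 r2 hd) hX')
    rw [Finset.mem_sdiff] at hx
    have hx2 := hx.2
    simp only [Finset.mem_insert, Finset.mem_singleton, not_or] at hx2
    simp only [Finset.mem_sdiff, Finset.mem_univ, true_and, not_not, Finset.mem_union, mem_A] at hxn
    refine ⟨x, hx.1, hx2, ?_⟩
    rcases hxn with hxn | hxn
    · obtain ⟨a, b, c⟩ := hm r1 hr1
      exact ⟨r1, a, hxn, fin6 x r1 b c⟩
    · obtain ⟨a, b, c⟩ := hm r2 hr2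
      exact ⟨r2, a, hxn, fin6 x r2 b c⟩
  · rw [Bool.not_eq_true] at hts
    by_cases hne : s = t
    · subst hne
      obtain ⟨z1, hz1⟩ := tri_unique (g (n - 2)) (h (n - 2))
      obtain ⟨z2, hz2⟩ := tri_unique (g (n - 2)) w
      obtain ⟨z3, hz3⟩ := tri_unique (h (n - 2)) w
      obtain ⟨x, hx, n1, n2, n3⟩ := pick3 (le_trans (by norm_num) hX') z1 z2 z3
      rw [Finset.mem_sdiff] at hx
      have hx2 := hx.2
      simp only [Finset.mem_insert, Finset.mem_singleton, not_or] at hx2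
      refine ⟨x, hx.1, hx2, ?_⟩
      by_cases hsx : dj s x = true
      · have k9 := K9 s x hsx (A s \ {g (n - 2), h (n - 2), w})
          ((card_miss (F := {g (n - 2), h (n - 2), w}) (fun q hq hn' => by
            rw [Finset.mem_sdiff] at hn'; tauto)).trans (c3 _ _ _)) (by
          intro y z htri hy hz
          have htri' : tri x z y := by
            obtain ⟨a1, a2, a3, a4, a5, a6, a7⟩ := htri
            exact ⟨a2, a1, by rw [dj_comm]; exact a3, a5, a4, a6.symm, fun q h1 h2 => a7 q h2 h1⟩
          have hyz : y ≠ z := htri.2.2.2.2.2.1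
          by_contra hc
          push Not at hc
          simp only [Finset.mem_sdiff, Finset.mem_insert, Finset.mem_singleton, hy, hz, true_and, not_not] at hc
          obtain ⟨rfl | rfl | rfl, c | c | c⟩ := hc
          all_goals first
            | exact hyz c.symm
            | (rw [c] at htri htri'
               first
               | exact n1 (hz1 _ htri) | exact n2 (hz2 _ htri) | exact n3 (hz3 _ htri)
               | exact n1 (hz1 _ htri') | exact n2 (hz2 _ htri') | exact n3 (hz3 _ htri')))
        obtain ⟨r, hr, a1, a2, a3⟩ := pick3 k9 (u 0) (g (n - 1)) (h (n - 1))
        unfold G9 at hr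
        rw [Finset.mem_filter, Finset.mem_inter, mem_A, mem_A] at hr
        refine ⟨r, (mr r).mpr ⟨hr.1.1, a2, a3, a1, (dj_ne hr.1.1).symm⟩, dj_symm hr.1.2, hr.2.trans (Finset.card_le_card ?_)⟩
        intro q hq
        obtain ⟨p, hp, hd⟩ := mem_N1.mp hq
        refine mem_N1.mpr ⟨p, ?_, hd⟩
        simp only [Finset.mem_sdiff, Finset.mem_inter, mem_A, Finset.mem_insert, Finset.mem_singleton, not_or, ms] at hp ⊢
        exact ⟨⟨⟨hp.1.1.1, hp.1.1.2.1, hp.1.1.2.2.1, (dj_ne hp.1.1.1).symm, hp.1.1.2.2.2⟩, hp.1.2⟩, hp.2⟩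
      · obtain ⟨r, hr, a1, a2, a3⟩ := pick3 (K4b s x w (by simpa using hsx)) (u 0) (g (n - 1)) (h (n - 1))
        rw [Finset.mem_filter, Finset.mem_inter, mem_A, mem_A] at hr
        refine ⟨r, (mr r).mpr ⟨hr.1.1, a2, a3, a1, (dj_ne hr.1.1).symm⟩, dj_symm hr.1.2, ?_⟩
        apply K6' s r hr.1.1
        refine (card_miss (F := {g (n - 2), h (n - 2)}) (fun q hq hn' => ?_)).trans (c2 _ _)
        rw [Finset.mem_insert, Finset.mem_singleton]
        have hk := key x r q hq hn'
        rw [Finset.mem_inter, mem_A] at hq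
        rcases hk with hk | hk | rfl | rfl | rfl
        · tauto
        · tauto
        · exact absurd rfl (dj_ne hq.1)
        · rw [mem_A, mem_A] at hr
          rw [mem_A] at hq; tauto
        · tauto
    · have k8 := K8 (u 0) (u 1) t s hD (by rw [dj_comm]; exact hts) hne ((A t \ A s) \ {u 0, g (n - 1), h (n - 1)})
        ((card_miss (F := {g (n - 1), h (n - 1)}) (fun q hq hn' => by
          simp only [Finset.mem_sdiff, Finset.mem_insert, Finset.mem_singleton] at hq hn' ⊢
          tauto)).trans (c2 _ _))
      obtain ⟨x, hx, b1, b2⟩ := pick2 k8 (g 0) (h 0)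
      rw [Finset.mem_inter, Finset.mem_sdiff, Finset.mem_singleton] at hx
      obtain ⟨r, hr, hd⟩ := mem_N1.mp hx.2
      simp only [Finset.mem_sdiff, mem_A, Finset.mem_insert, Finset.mem_singleton, not_or, Bool.not_eq_true] at hr
      have hrs := ne_of_dj hr.1.1 hts
      exact ⟨x, hx.1.1, ⟨hx.1.2, b1, b2⟩, r, (mr r).mpr ⟨hr.1.1, hr.2.2.1, hr.2.2.2, hr.2.1, hrs⟩, dj_symm hd,
        fin6 x r hr.1.2 hrs.symm⟩

theorem worldD : ∃ m, Lin n (LL n u g h) m := by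
  have m1 : ∀ q, q ∈ LL n u g h 1 ↔ dj (u 1) q = true ∧ q ≠ g 1 ∧ q ≠ h 1 ∧ q ≠ u 2 ∧ q ≠ u 0 := by
    intro q; rw [mem_LL, show 1 + (n - 1) = 0 + n by omega, pu]
  have m0 : ∀ q, q ∈ LL n u g h 0 ↔ dj (u 0) q = true ∧ q ≠ g 0 ∧ q ≠ h 0 ∧ q ≠ u 1 ∧ q ≠ u (n - 1) := by
    intro q; rw [mem_LL, show 0 + (n - 1) = n - 1 by omega, show 0 + 1 = 1 by rfl]
  have m2 : ∀ q, q ∈ LL n u g h 2 ↔ dj (u 2) q = true ∧ q ≠ g 2 ∧ q ≠ h 2 ∧ q ≠ u 3 ∧ q ≠ u 1 := by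
    intro q; rw [mem_LL, show 2 + (n - 1) = 1 + n by omega, pu]
  have hX0 : ∀ x ∈ A (u 0) \ (A (u 1) ∪ {u 1}), dj (u 0) x = true ∧ dj (u 1) x = false ∧ u 1 ≠ x := by
    intro x hx
    simp only [Finset.mem_sdiff, Finset.mem_union, mem_A, Finset.mem_singleton, not_or, Bool.not_eq_true] at hx
    exact ⟨hx.1, hx.2.1, Ne.symm hx.2.2⟩
  by_cases h3 : n = 3
  · obtain ⟨x, hx, b1, b2, b3⟩ := pick3 (le_trans (by norm_num) (cardX _ _ hD)) (u (n - 1)) (g 0) (h 0)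
    obtain ⟨x1, x2, x3⟩ := hX0 x hx
    have h27 := K5' (u 1) x x2 x3 (LL n u g h 1 ∩ A x) ((card_miss (F := {g 1, h 1, u 2, u 0}) (fun q hq hn' => by
      simp only [Finset.mem_inter, m1, mem_A, Finset.mem_insert, Finset.mem_singleton] at hq hn' ⊢
      clear * - hq hn'; tauto)).trans (c4 _ _ _ _))
    have hE : 6 ≤ (A (u 2) ∩ A x).card := cardAA _ _
    have hE2 := card_cov (X := A (u 2) ∩ A x) (Y := LL n u g h 2 ∩ A x) (F := {g 2, h 2, u 3, u 1}) (fun q hq => by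
        simp only [Finset.mem_inter, m2, mem_A, Finset.mem_insert, Finset.mem_singleton] at hq ⊢
        clear * - hq; tauto)
    have := c4 (g 2) (h 2) (u 3) (u 1)
    obtain ⟨t, ht, htN⟩ := meet28 (S := LL n u g h 2 ∩ A x) (T := N1 (LL n u g h 1 ∩ A x)) (by omega)
    obtain ⟨p, hp, hd⟩ := mem_N1.mp htN
    rw [Finset.mem_inter, mem_A] at ht hp
    have hx0 := (m0 x).mpr ⟨x1, b2, b3, x3.symm, b1⟩
    subst h3
    exact lin3 _ x p t hx0 hp.1 ht.1 hp.2 ht.2 hd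
  · obtain ⟨x, hx, ⟨b1, b2, b3⟩, r, hr, hd, hE⟩ := D_xr n hn u g h pu hD (by omega)
    obtain ⟨x1, x2, x3⟩ := hX0 x hx
    have hx0 := (m0 x).mpr ⟨x1, b2, b3, x3.symm, b1⟩
    refine core n (by omega) _ u (LL_sub n u g h) (LL_miss n u g h) x r hx0 hr hd ?_ ?_ hE
    · have hk := cardAA' (u 1) x x2
      have h2 := card_cov (X := A (u 1) ∩ A x) (Y := (LL n u g h 1 ∩ A x) \ {r}) (F := {g 1, h 1, u 2, u 0, r}) (fun q hq => by
        simp only [Finset.mem_sdiff, Finset.mem_inter, m1, mem_A, Finset.mem_insert, Finset.mem_singleton] at hq ⊢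
        clear * - hq; tauto)
      have := c5 (g 1) (h 1) (u 2) (u 0) r
      omega
    · have hk := K5 (u 0) (u 1) x (u 2) hD x1 x2 x3 ((LL n u g h 1 ∩ A x) \ {r})
        ((card_miss (F := {g 1, h 1, r}) (fun q hq hn' => by
          simp only [Finset.mem_sdiff, Finset.mem_inter, m1, mem_A, Finset.mem_insert, Finset.mem_singleton] at hq hn' ⊢
          clear * - hq hn'; tauto)).trans (c3 _ _ _))
      have h2 := card_cov (X := (A (u 2) \ {u 1, x}) ∩ N2 ((LL n u g h 1 ∩ A x) \ {r}))
        (Y := (LL n u g h 2 \ {x}) ∩ N2 ((LL n u g h 1 ∩ A x) \ {r})) (F := {g 2, h 2, u 3}) (fun q hq => by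
          rw [Finset.mem_inter] at hq ⊢
          have hq2 := hq.2
          have hq1 := hq.1
          simp only [Finset.mem_sdiff, m2, mem_A, Finset.mem_insert, Finset.mem_singleton] at hq1 ⊢
          clear * - hq1 hq2; tauto)
      have := c3 (g 2) (h 2) (u 3)
      omega
end D

theorem per_add {α : Type*} {n : ℕ} {f : ℕ → α} (h : ∀ i, f (i + n) = f i) (i k : ℕ) : f (i + k * n) = f i := by
  rw [← per_mod h, ← per_mod h i]; simp

theorem cycle_lemma (n : ℕ) (hn : 3 ≤ n) (u g h : ℕ → Lab) (pu : ∀ i, u (i + n) = u i) (pg : ∀ i, g (i + n) = g i)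
    (ph : ∀ i, h (i + n) = h i) : ∃ m, Cyc n (LL n u g h) m := by
  have pL : ∀ i, LL n u g h (i + n) = LL n u g h i := by
    intro i
    unfold LL
    rw [pu, pg, ph, show i + n + 1 = i + 1 + n by omega, pu, show i + n + (n - 1) = i + (n - 1) + n by omega, pu]
  by_cases hN : ∀ i, dj (u i) (u (i + 1)) = false
  · obtain ⟨m, hm⟩ := worldN n hn u g h pu hN
    exact ⟨_, hm.toCyc hn pL⟩
  · push Not at hN
    obtain ⟨k, hk⟩ := hN
    have hk : dj (u k) (u (k + 1)) = true := by simpa using hk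
    have pu' : ∀ i, u (i + n + k) = u (i + k) := fun i => by rw [show i + n + k = i + k + n by omega, pu]
    obtain ⟨m, hm⟩ := worldD n hn (fun i => u (i + k)) (fun i => g (i + k)) (fun i => h (i + k)) pu'
      (by simpa [add_comm] using hk)
    have hLL : ∀ i, LL n (fun i => u (i + k)) (fun i => g (i + k)) (fun i => h (i + k)) i = LL n u g h (i + k) := by
      intro i
      unfold LL
      simp only [show i + 1 + k = i + k + 1 by omega, show i + (n - 1) + k = i + k + (n - 1) by omega]
    have hc := hm.toCyc hn (fun i => by rw [hLL, hLL, show i + n + k = i + k + n by omega, pL])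
    generalize (fun i => m (i % n)) = m' at hc
    refine ⟨fun i => m' (i + k * (n - 1)), ⟨fun i => ?_, fun i => ?_, fun i => ?_, fun i => ?_⟩⟩
    · change m' _ = m' _
      rw [show i + n + k * (n - 1) = i + k * (n - 1) + n by omega, hc.per]
    · change dj (m' _) (m' _) = true
      rw [show i + 1 + k * (n - 1) = i + k * (n - 1) + 1 by omega]; exact hc.d _
    · change m' _ ≠ m' _
      rw [show i + 2 + k * (n - 1) = i + k * (n - 1) + 2 by omega]; exact hc.e _
    · have := hc.mem (i + k * (n - 1))
      rw [hLL] at this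
      have e : i + k * (n - 1) + k = i + k * n := by
        obtain ⟨n, rfl⟩ : ∃ n', n = n' + 1 := ⟨n - 1, by omega⟩
        simp; ring
      rw [e, per_add pL] at this
      exact this

end TT

namespace TT

section Gr
variable {V : Type*}

def Valid (G : SimpleGraph V) (S : Set V) (f : V → Lab) : Prop :=
  (∀ u ∈ S, ∀ v ∈ S, G.Adj u v → dj (f u) (f v) = true) ∧
  ∀ u ∈ S, ∀ v ∈ S, u ≠ v → ∀ w, G.Adj w u → G.Adj w v → f u ≠ f v

def col (q : Lab) : Finset ℕ := {(lo q : ℕ) + 1, (hi q : ℕ) + 1}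

theorem col_card (q : Lab) : (col q).card = 2 ∧ col q ⊆ Finset.Icc 1 8 := by
  revert q; decide +kernel
theorem col_dj (p q : Lab) (h : dj p q = true) : (col p ∩ col q).card = 0 := by
  revert p q; decide +kernel
theorem col_ne (p q : Lab) (h : p ≠ q) : (col p ∩ col q).card ≤ 1 := by
  revert p q; decide +kernel

theorem tone_of_valid (G : SimpleGraph V) (f : V → Lab) (h : Valid G Set.univ f) :
    IsTToneColoring G 2 8 (fun v => col (f v)) := by
  refine ⟨fun v => col_card _, fun u v huv => ?_⟩
  by_cases hr : G.Reachable u v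
  · rw [← hr.coe_dist_eq_edist]
    norm_cast
    obtain ⟨p, hp⟩ := hr.exists_walk_length_eq_dist
    rw [← hp]
    match p, huv with
    | .nil, huv => exact absurd rfl huv
    | .cons a .nil, _ =>
      rw [col_dj _ _ (h.1 _ trivial _ trivial a)]; simp
    | .cons a (.cons b .nil), huv =>
      have := col_ne _ _ (h.2 _ trivial _ trivial huv _ a.symm b)
      simp; omega
    | .cons a (.cons b (.cons c q)), _ =>
      have := Finset.card_le_card (Finset.inter_subset_left (s₁ := col (f u)) (s₂ := col (f v)))
      rw [(col_card _).1] at this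
      simp; omega
  · rw [SimpleGraph.edist_eq_top_of_not_reachable hr]
    exact ENat.natCast_lt_top _

theorem comp_glue (G : SimpleGraph V) (h : ∀ r, ∃ f, Valid G {v | G.Reachable r v} f) : ∃ f, Valid G Set.univ f := by
  classical
  choose F hF using h
  let rep : V → V := fun v => (G.connectedComponentMk v).out
  have hrep : ∀ v, G.Reachable (rep v) v := fun v =>
    SimpleGraph.ConnectedComponent.exact (Quot.out_eq (G.connectedComponentMk v))
  have heq : ∀ u v, G.Reachable u v → rep u = rep v := by
    intro u v h
    simp only [rep, SimpleGraph.ConnectedComponent.sound h]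
  refine ⟨fun v => F (rep v) v, fun u _ v _ a => ?_, fun u _ v _ huv w a b => ?_⟩
  · have e := heq _ _ a.reachable
    have := (hF (rep v)).1 u (by rw [← e]; exact hrep u) v (hrep v) a
    simpa only [e] using this
  · have e := heq _ _ (a.symm.reachable.trans b.reachable)
    have := (hF (rep v)).2 u (by rw [← e]; exact hrep u) v (hrep v) huv w a b
    simpa only [e] using this

variable [Fintype V] [DecidableEq V] (G : SimpleGraph V) [DecidableRel G.Adj]

theorem extend (S : Finset V) (f : V → Lab) (hf : Valid G S f) (v : V) (hv : v ∉ S)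
    (h1 : (G.neighborFinset v ∩ S).card ≤ 2)
    (h2 : (((G.neighborFinset v).biUnion (fun w => (G.neighborFinset w).erase v)) ∩ S).card ≤ 5) :
    ∃ f, Valid G (insert v S : Finset V) f := by
  obtain ⟨a, b, hab⟩ : ∃ a b : V, G.neighborFinset v ∩ S ⊆ {a, b} := by
    generalize G.neighborFinset v ∩ S = N at h1
    have : N.card = 0 ∨ N.card = 1 ∨ N.card = 2 := by omega
    rcases this with h | h | h
    · rw [Finset.card_eq_zero] at h; exact ⟨v, v, by simp [h]⟩
    · rw [Finset.card_eq_one] at h; obtain ⟨a, rfl⟩ := h; exact ⟨a, a, by simp⟩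
    · rw [Finset.card_eq_two] at h; obtain ⟨a, b, -, rfl⟩ := h; exact ⟨a, b, by simp⟩
  obtain ⟨q, hq, hn⟩ := Finset.exists_mem_notMem_of_card_lt_card
    (s := (((G.neighborFinset v).biUnion (fun w => (G.neighborFinset w).erase v)) ∩ S).image f) (t := A (f a) ∩ A (f b))
    (lt_of_le_of_lt (Finset.card_image_le.trans h2) (cardAA _ _))
  rw [Finset.mem_inter, mem_A, mem_A] at hq
  have k1 : ∀ w ∈ S, G.Adj v w → dj (f w) q = true := by
    intro w hw a
    have := hab (Finset.mem_inter.mpr ⟨by simpa using a, hw⟩)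
    simp at this
    rcases this with rfl | rfl
    · exact hq.1
    · exact hq.2
  have k2 : ∀ w x, G.Adj w v → G.Adj w x → x ∈ S → x ≠ v → f x ≠ q := by
    intro w x a b hx hne he
    apply hn
    refine Finset.mem_image.mpr ⟨x, Finset.mem_inter.mpr ⟨Finset.mem_biUnion.mpr ⟨w, by simpa using a.symm, ?_⟩, hx⟩, he⟩
    simp [hne, b]
  have e1 : Function.update f v q v = q := by simp
  have e2 : ∀ x ∈ S, Function.update f v q x = f x := by
    intro x hx
    rw [Function.update_of_ne]; rintro rfl; exact hv hx
  have ne : ∀ x ∈ S, x ≠ v := by rintro x hx rfl; exact hv hx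
  refine ⟨Function.update f v q, ?_, ?_⟩
  · intro x hx y hy a
    simp only [Finset.coe_insert, Set.mem_insert_iff, Finset.mem_coe] at hx hy
    rcases hx with rfl | hx <;> rcases hy with rfl | hy
    · exact absurd rfl a.ne
    · rw [e1, e2 _ hy]; exact dj_symm (k1 y hy a)
    · rw [e1, e2 _ hx]; exact k1 x hx a.symm
    · rw [e2 _ hx, e2 _ hy]; exact hf.1 x hx y hy a
  · intro x hx y hy hne w a b
    simp only [Finset.coe_insert, Set.mem_insert_iff, Finset.mem_coe] at hx hy
    rcases hx with rfl | hx <;> rcases hy with rfl | hy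
    · exact absurd rfl hne
    · rw [e1, e2 _ hy]; exact (k2 w y a b hy (ne y hy)).symm
    · rw [e1, e2 _ hx]; exact k2 w x b a hx (ne x hx)
    · rw [e2 _ hx, e2 _ hy]; exact hf.2 x hx y hy hne w a b

theorem second_le (hd : ∀ v, G.degree v ≤ 3) (v w : V) (a : G.Adj v w) : ((G.neighborFinset w).erase v).card ≤ 2 := by
  rw [Finset.card_erase_of_mem (by simpa using a.symm)]
  have := hd w
  rw [← G.card_neighborFinset_eq_degree] at this
  omega

theorem extend_par (hd : ∀ v, G.degree v ≤ 3) (S : Finset V) (f : V → Lab) (hf : Valid G S f) (v p : V) (hv : v ∉ S)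
    (a : G.Adj v p) (hp : p ∉ S) (hp2 : G.degree p ≤ 2 ∨ ∃ y, G.Adj p y ∧ y ≠ v ∧ y ∉ S) :
    ∃ f, Valid G (insert v S : Finset V) f := by
  have dv := hd v
  rw [← G.card_neighborFinset_eq_degree] at dv
  have hpm : p ∈ G.neighborFinset v := by simpa using a
  have hc := Finset.card_erase_of_mem hpm
  have hpos := Finset.card_pos.mpr ⟨p, hpm⟩
  apply extend G S f hf v hv
  · have : G.neighborFinset v ∩ S ⊆ (G.neighborFinset v).erase p := by
      intro x hx
      rw [Finset.mem_inter] at hx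
      exact Finset.mem_erase.mpr ⟨by rintro rfl; exact hp hx.2, hx.1⟩
    have := Finset.card_le_card this
    omega
  · rw [Finset.biUnion_inter]
    refine Finset.card_biUnion_le.trans ?_
    rw [← Finset.add_sum_erase _ _ hpm]
    have s1 : ((G.neighborFinset p).erase v ∩ S).card ≤ 1 := by
      rcases hp2 with h | ⟨y, y1, y2, y3⟩
      · refine (Finset.card_le_card Finset.inter_subset_left).trans ?_
        rw [Finset.card_erase_of_mem (by simpa using a.symm), G.card_neighborFinset_eq_degree]; omega
      · have : (G.neighborFinset p).erase v ∩ S ⊆ ((G.neighborFinset p).erase v).erase y := by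
          intro x hx
          rw [Finset.mem_inter] at hx
          exact Finset.mem_erase.mpr ⟨by rintro rfl; exact y3 hx.2, hx.1⟩
        have := Finset.card_le_card this
        rw [Finset.card_erase_of_mem (by simp [y1, y2])] at this
        have := second_le G hd v p a
        omega
    have s2 := Finset.sum_le_card_nsmul ((G.neighborFinset v).erase p) (fun w => ((G.neighborFinset w).erase v ∩ S).card) 2
      (fun w hw => (Finset.card_le_card Finset.inter_subset_left).trans (second_le G hd v w (by simpa using Finset.mem_of_mem_erase hw)))
    simp only [smul_eq_mul] at s2
    omega

theorem greedy (hd : ∀ v, G.degree v ≤ 3) (r : V) (R : Set V) (hr : r ∈ R)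
    (hr2 : G.degree r ≤ 2 ∨ ∃ y ∈ R, G.Adj r y) (s : Finset V) :
    (∀ x ∈ s, G.Reachable r x ∧ x ∉ R) → ∃ f, Valid G s f := by
  have par : ∀ x, G.Reachable r x → x ≠ r → ∃ p, G.Adj x p ∧ G.dist r p < G.dist r x ∧ G.Reachable r p := by
    intro x hx hne
    obtain ⟨w, hw⟩ := hx.symm.exists_walk_length_eq_dist
    match w, hne with
    | .nil, hne => exact absurd rfl hne
    | .cons (v := p) a q, _ =>
      refine ⟨p, a, ?_, q.reverse.reachable⟩
      have := SimpleGraph.dist_le q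
      rw [SimpleGraph.dist_comm (u := r), SimpleGraph.dist_comm (u := r), ← hw]
      simp; omega
  induction s using Finset.induction_on_min_value (fun v => G.dist r v) with
  | empty => exact fun _ => ⟨fun _ => 0, by simp [Valid]⟩
  | insert v s hv hmin ih =>
    intro hs
    obtain ⟨f, hf⟩ := ih (fun x hx => hs x (Finset.mem_insert_of_mem hx))
    obtain ⟨hvr, hvR⟩ := hs v (Finset.mem_insert_self _ _)
    obtain ⟨p, a, hlt, hpr⟩ := par v hvr (by rintro rfl; exact hvR hr)
    have no : ∀ x, G.dist r x < G.dist r v → x ∉ s := fun x hx hxs => absurd (hmin x hxs) (by simpa using hx)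
    refine extend_par G hd s f hf v p hv a (no p hlt) ?_
    by_cases hpe : p = r
    · subst hpe
      rcases hr2 with h | ⟨y, y1, y2⟩
      · exact Or.inl h
      · exact Or.inr ⟨y, y2, by rintro rfl; exact hvR y1, fun hy => (hs y (Finset.mem_insert_of_mem hy)).2 y1⟩
    · obtain ⟨pp, a', hlt', -⟩ := par p hpr hpe
      exact Or.inr ⟨pp, a', by rintro rfl; omega, no _ (by omega)⟩

theorem case_deg2 (hd : ∀ v, G.degree v ≤ 3) (r : V) (h : G.degree r ≤ 2) : ∃ f, Valid G {v | G.Reachable r v} f := by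
  classical
  obtain ⟨f, hf⟩ := greedy G hd r {r} rfl (Or.inl h) (Finset.univ.filter (fun v => G.Reachable r v ∧ v ≠ r)) (by simp)
  have h' := h
  rw [← G.card_neighborFinset_eq_degree] at h'
  obtain ⟨f, hf⟩ := extend G _ f hf r (by simp) ((Finset.card_le_card Finset.inter_subset_left).trans h') (by
    refine (Finset.card_le_card Finset.inter_subset_left).trans (Finset.card_biUnion_le.trans ?_)
    have s2 := Finset.sum_le_card_nsmul (G.neighborFinset r) (fun w => ((G.neighborFinset w).erase r).card) 2
      (fun w hw => second_le G hd r w (by simpa using hw))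
    simp only [smul_eq_mul] at s2
    omega)
  refine ⟨f, ?_⟩
  convert hf using 1
  ext v
  by_cases hv : v = r <;> simp [hv]

end Gr
end TT

namespace TT

section Cu
variable {V : Type*}

structure CP (G : SimpleGraph V) (r : V) (n : ℕ) (p : ℕ → V) : Prop where
  three : 3 ≤ n
  inj : ∀ i j, i < j → j < n → p i ≠ p j
  adj : ∀ i, i + 1 < n → G.Adj (p i) (p (i + 1))
  clo : G.Adj (p (n - 1)) (p 0)
  rea : G.Reachable r (p 0)

theorem exists_CP [Finite V] (G : SimpleGraph V) (r : V)
    (h : ∀ v, G.Reachable r v → ∀ a, ∃ b, G.Adj v b ∧ b ≠ a) : ∃ n p, CP G r n p := by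
  classical
  have h' : ∀ s : {s : V × V // G.Reachable r s.2}, ∃ t : {s : V × V // G.Reachable r s.2},
      t.1.1 = s.1.2 ∧ G.Adj s.1.2 t.1.2 ∧ t.1.2 ≠ s.1.1 := by
    rintro ⟨⟨a, v⟩, hv⟩
    obtain ⟨b, hb, hn⟩ := h v hv a
    exact ⟨⟨(v, b), hv.trans hb.reachable⟩, rfl, hb, hn⟩
  choose F hF using h'
  let s : ℕ → {s : V × V // G.Reachable r s.2} := fun k => F^[k] ⟨(r, r), SimpleGraph.Reachable.refl _⟩
  have hs : ∀ k, s (k + 1) = F (s k) := fun k => Function.iterate_succ_apply' _ _ _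
  let w : ℕ → V := fun k => (s k).1.2
  have hadj : ∀ k, G.Adj (w k) (w (k + 1)) := by
    intro k; simp only [w, hs]; exact (hF _).2.1
  have hnb : ∀ k, w (k + 2) ≠ w k := by
    intro k
    have h1 := (hF (s (k + 1))).2.2
    rw [← hs] at h1
    have h2 := (hF (s k)).1
    rw [← hs] at h2
    rw [h2] at h1
    exact h1
  have hre : ∀ k, G.Reachable r (w k) := fun k => (s k).2
  clear_value w
  have hex : ∃ n, 0 < n ∧ ∃ i, w i = w (i + n) := by
    obtain ⟨i, j, hne, he⟩ := Finite.exists_ne_map_eq_of_infinite w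
    rcases lt_or_gt_of_ne hne with hl | hl
    · exact ⟨j - i, by omega, i, by rw [he]; congr 1; omega⟩
    · exact ⟨i - j, by omega, j, by rw [← he]; congr 1; omega⟩
  obtain ⟨hpos, i, hi⟩ := Nat.find_spec hex
  have hmin := fun m => Nat.find_min hex (m := m)
  generalize Nat.find hex = n at *
  have h3 : 3 ≤ n := by
    by_contra hc
    have : n = 1 ∨ n = 2 := by omega
    rcases this with rfl | rfl
    · exact (hadj i).ne hi
    · exact hnb i hi.symm
  refine ⟨n, fun k => w (i + k), h3, ?_, ?_, ?_, hre _⟩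
  · intro a b hab hb he
    refine hmin (b - a) (by omega) ⟨by omega, i + a, ?_⟩
    rw [show i + a + (b - a) = i + b by omega]; exact he
  · intro a _; exact hadj _
  · have := hadj (i + (n - 1))
    rw [show i + (n - 1) + 1 = i + n by omega, ← hi] at this
    exact this

theorem cubic_cycle [Finite V] (G : SimpleGraph V) (r : V)
    (h : ∀ v, G.Reachable r v → ∀ a, ∃ b, G.Adj v b ∧ b ≠ a) : ∃ n, ∃ c : ℕ → V, 3 ≤ n ∧ (∀ i, c (i + n) = c i) ∧
    (∀ i d, 0 < d → d < n → c i ≠ c (i + d)) ∧ (∀ i, G.Adj (c i) (c (i + 1))) ∧ (∀ i, G.Reachable r (c i)) ∧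
    (∀ i d, 2 ≤ d → d + 2 ≤ n → ¬ G.Adj (c i) (c (i + d))) ∧
    (∀ i d o, 3 ≤ d → d < n → (∀ k, o ≠ c k) → G.Adj (c i) o → ¬ G.Adj (c (i + d)) o) := by
  classical
  have hex := exists_CP G r h
  obtain ⟨p, hp⟩ := Nat.find_spec hex
  have hmin := fun m => Nat.find_min hex (m := m)
  generalize Nat.find hex = n at *
  have h3 := hp.three
  let c : ℕ → V := fun i => p (i % n)
  have per : ∀ i, c (i + n) = c i := fun i => by simp [c]
  have inj0 : ∀ i j, i < n → j < n → p i = p j → i = j := by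
    intro i j hi hj he
    by_contra hne
    rcases lt_or_gt_of_ne hne with hl | hl
    · exact hp.inj i j hl hj he
    · exact hp.inj j i hl hi he.symm
  have inj : ∀ i d, 0 < d → d < n → c i ≠ c (i + d) := by
    intro i d h0 hd he
    have := inj0 _ _ (Nat.mod_lt _ (by omega)) (Nat.mod_lt _ (by omega)) he
    have h2 : i + 0 ≡ i + d [MOD n] := this
    have h4 := Nat.ModEq.add_left_cancel' i h2
    rw [Nat.ModEq, Nat.mod_eq_of_lt hd] at h4
    simp at h4; omega
  have adj : ∀ i, G.Adj (c i) (c (i + 1)) := by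
    intro i
    have h1 : i % n < n := Nat.mod_lt _ (by omega)
    by_cases hc : i % n + 1 < n
    · have : (i + 1) % n = i % n + 1 := by rw [Nat.add_mod, Nat.mod_eq_of_lt (by omega : 1 < n), Nat.mod_eq_of_lt hc]
      simp only [c, this]; exact hp.adj _ hc
    · have : (i + 1) % n = 0 := by
        rw [Nat.add_mod, Nat.mod_eq_of_lt (by omega : 1 < n), show i % n + 1 = n by omega, Nat.mod_self]
      simp only [c, this, show i % n = n - 1 by omega]; exact hp.clo
  have rea : ∀ i, G.Reachable r (c i) := by
    intro i
    induction i with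
    | zero => simpa [c] using hp.rea
    | succ i ih => exact ih.trans (adj i).reachable
  clear_value c
  have win : ∀ i a b, a < b → b < n → c (i + a) ≠ c (i + b) := by
    intro i a b hab hb
    have := inj (i + a) (b - a) (by omega) (by omega)
    rwa [show i + a + (b - a) = i + b by omega] at this
  refine ⟨n, c, h3, per, inj, adj, rea, ?_, ?_⟩
  · intro i d h2 hd a
    refine hmin (d + 1) (by omega) ⟨fun k => c (i + k), by omega, ?_, ?_, ?_, rea _⟩
    · intro x y hxy hy; exact win i x y hxy (by omega)
    · intro x _; exact adj _
    · simpa using a.symm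
  · intro i d o h2 hd ho a1 a2
    refine hmin (n - d + 2) (by omega) ⟨fun k => if k = 0 then o else c (i + d + (k - 1)), by omega, ?_, ?_, ?_, ?_⟩
    · intro x y hxy hy
      by_cases hx : x = 0
      · simp only [hx, show y ≠ 0 by omega, if_true, if_false]; exact ho _
      · simp only [hx, show y ≠ 0 by omega, if_false]
        exact win _ _ _ (by omega) (by omega)
    · intro x hx
      by_cases hx0 : x = 0
      · simpa [hx0] using a2.symm
      · have := adj (i + d + (x - 1))
        rw [show i + d + (x - 1) + 1 = i + d + x by omega] at this
        simpa [hx0] using this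
    · simp only [show n - d + 2 - 1 ≠ 0 by omega, if_false, if_true]
      rw [show i + d + (n - d + 2 - 1 - 1) = i + n by omega, per]; exact a1
    · simpa using (rea i).trans a1.reachable

theorem mem_two {a b : V} {s : Finset V} [DecidableEq V] (h : s.card ≤ 3) (ha : a ∈ s) : ∃ x y, ∀ w ∈ s, w = a ∨ w = x ∨ w = y := by
  have h1 := Finset.card_erase_of_mem ha
  have : (s.erase a).card = 0 ∨ (s.erase a).card = 1 ∨ (s.erase a).card = 2 := by omega
  have key : ∀ w ∈ s, w = a ∨ w ∈ s.erase a := by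
    intro w hw
    by_cases h : w = a
    · exact Or.inl h
    · exact Or.inr (Finset.mem_erase.mpr ⟨h, hw⟩)
  rcases this with h | h | h
  · rw [Finset.card_eq_zero] at h; rw [h] at key
    exact ⟨a, a, fun w hw => by simpa using key w hw⟩
  · obtain ⟨x, h⟩ := Finset.card_eq_one.mp h; rw [h] at key
    exact ⟨x, x, fun w hw => by simpa using key w hw⟩
  · obtain ⟨x, y, -, h⟩ := Finset.card_eq_two.mp h; rw [h] at key
    exact ⟨x, y, fun w hw => by simpa using key w hw⟩

variable [Fintype V] [DecidableEq V] (G : SimpleGraph V) [DecidableRel G.Adj]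

theorem case_cubic (hd : ∀ v, G.degree v ≤ 3) (r : V) (h : ∀ v, G.Reachable r v → 3 ≤ G.degree v) :
    ∃ f, Valid G {v | G.Reachable r v} f := by
  classical
  obtain ⟨n, c, h3, per, inj, adj, rea, cho, oo⟩ := cubic_cycle G r (by
    intro v hv a
    have := h v hv
    rw [← G.card_neighborFinset_eq_degree] at this
    obtain ⟨b, hb, hn⟩ := Finset.exists_mem_notMem_of_card_lt_card (s := {a}) (t := G.neighborFinset v) (by simp at this ⊢; omega)
    exact ⟨b, by simpa using hb, by simpa using hn⟩)
  let R : Set V := Set.range c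
  have off : ∀ i, ∀ w ∈ R, ∃ d, d < n ∧ w = c (i + d) := by
    rintro i _ ⟨j, rfl⟩
    refine ⟨(j + (n - 1) * i) % n, Nat.mod_lt _ (by omega), ?_⟩
    rw [← per_mod per j, ← per_mod per (i + _)]
    congr 1
    rw [Nat.add_mod_mod, show i + (j + (n - 1) * i) = j + n * i by
      obtain ⟨n, rfl⟩ : ∃ n', n = n' + 1 := ⟨n - 1, by omega⟩
      simp; ring]
    simp
  have prev : ∀ i, G.Adj (c i) (c (i + (n - 1))) := by
    intro i
    have := adj (i + (n - 1))
    rw [show i + (n - 1) + 1 = i + n by omega, per] at this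
    exact this.symm
  have adjR : ∀ i, ∀ w ∈ R, G.Adj (c i) w → w = c (i + 1) ∨ w = c (i + (n - 1)) := by
    intro i w hw a
    obtain ⟨d, hdn, rfl⟩ := off i w hw
    by_cases h0 : d = 0
    · subst h0; exact absurd rfl a.ne
    by_cases h1 : d = 1
    · subst h1; exact Or.inl rfl
    by_cases h2 : d = n - 1
    · subst h2; exact Or.inr rfl
    exact absurd a (cho i d (by omega) (by omega))
  have hO : ∀ v ∈ R, ∃ o, o ∉ R ∧ G.Adj v o ∧ ∀ w, G.Adj v w → w ∈ R ∨ w = o := by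
    rintro _ ⟨i, rfl⟩
    have hdeg : (G.neighborFinset (c i)).card = 3 := by
      rw [G.card_neighborFinset_eq_degree]; exact le_antisymm (hd _) (h _ (rea i))
    have hne : c (i + 1) ≠ c (i + (n - 1)) := by
      have := inj (i + 1) (n - 2) (by omega) (by omega)
      rwa [show i + 1 + (n - 2) = i + (n - 1) by omega] at this
    have hsub : {c (i + 1), c (i + (n - 1))} ⊆ G.neighborFinset (c i) := by
      intro x hx
      simp at hx
      rcases hx with rfl | rfl
      · simpa using adj i
      · simpa using prev i
    have h1 : (G.neighborFinset (c i) \ {c (i + 1), c (i + (n - 1))}).card = 1 := by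
      rw [Finset.card_sdiff_of_subset hsub, hdeg, Finset.card_pair hne]
    obtain ⟨o, ho⟩ := Finset.card_eq_one.mp h1
    have hmem : ∀ x, x = o ↔ G.Adj (c i) x ∧ x ≠ c (i + 1) ∧ x ≠ c (i + (n - 1)) := by
      intro x
      rw [← Finset.mem_singleton, ← ho]; simp
    have hoo := (hmem o).mp rfl
    refine ⟨o, fun hR => ?_, hoo.1, fun w a => ?_⟩
    · rcases adjR i o hR hoo.1 with h | h
      · exact hoo.2.1 h
      · exact hoo.2.2 h
    · by_cases e1 : w = c (i + 1)
      · exact Or.inl ⟨_, e1.symm⟩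
      by_cases e2 : w = c (i + (n - 1))
      · exact Or.inl ⟨_, e2.symm⟩
      exact Or.inr ((hmem w).mpr ⟨a, e1, e2⟩)
  choose! O hO1 hO2 hO3 using hO
  have hgh : ∀ v ∈ R, ∃ a b, ∀ w, G.Adj (O v) w → w = v ∨ w = a ∨ w = b := by
    intro v hv
    have hc := hd (O v)
    rw [← G.card_neighborFinset_eq_degree] at hc
    obtain ⟨x, y, hxy⟩ := mem_two (b := v) hc (a := v) (by simpa using (hO2 v hv).symm)
    exact ⟨x, y, fun w a => hxy w (by simpa using a)⟩
  choose! GG HH hGH using hgh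
  have cR : ∀ i, c i ∈ R := fun i => ⟨i, rfl⟩
  have rr : ∀ v, G.Reachable r v → G.Reachable (c 0) v := fun v hv => (rea 0).symm.trans hv
  obtain ⟨f, hf⟩ := greedy G hd (c 0) R (cR 0) (Or.inr ⟨c 1, cR 1, adj 0⟩)
    (Finset.univ.filter (fun v => G.Reachable r v ∧ v ∉ R)) (by
      intro x hx
      simp only [Finset.mem_filter, Finset.mem_univ, true_and] at hx
      exact ⟨rr x hx.1, hx.2⟩)
  obtain ⟨m, hm⟩ := cycle_lemma n h3 (fun i => f (O (c i))) (fun i => f (GG (c i))) (fun i => f (HH (c i)))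
    (fun i => by simp only [per]) (fun i => by simp only [per]) (fun i => by simp only [per])
  have hmem := fun i => mem_LL.mp (hm.mem i)
  obtain ⟨F, hF1, hF2⟩ : ∃ F : V → Lab, (∀ i, F (c i) = m i) ∧ ∀ v, v ∉ R → F v = f v := by
    have hidx : ∀ v ∈ R, ∃ i, c i = v := fun v hv => hv
    choose! idx hidx using hidx
    refine ⟨fun v => if v ∈ R then m (idx v) else f v, fun i => ?_, fun v hv => by simp [hv]⟩
    simp only [cR, if_true]
    obtain ⟨d, hdn, hd'⟩ := off (idx (c i)) (c i) (cR i)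
    have e := hidx (c i) (cR i)
    have e1 : (idx (c i)) % n = i % n := by
      by_contra hc
      have l1 : idx (c i) % n < n := Nat.mod_lt _ (by omega)
      have l2 : i % n < n := Nat.mod_lt _ (by omega)
      have e' : c (idx (c i) % n) = c (i % n) := by rw [per_mod per, per_mod per, e]
      rcases lt_or_gt_of_ne hc with hl | hl
      · refine inj _ (i % n - idx (c i) % n) (by omega) (by omega) (e'.trans ?_)
        congr 1; omega
      · refine inj _ (idx (c i) % n - i % n) (by omega) (by omega) (e'.symm.trans ?_)
        congr 1; omega
    rw [← per_mod hm.per, e1, per_mod hm.per]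
  have hin : ∀ v, G.Reachable r v → v ∉ R → v ∈ ((Finset.univ.filter (fun v => G.Reachable r v ∧ v ∉ R) : Finset V) : Set V) := by
    intro v h1 h2
    simp only [Finset.coe_filter, Finset.mem_univ, true_and, Set.mem_setOf_eq]; exact ⟨h1, h2⟩
  have mprev : ∀ i, m (i + (n - 1) + 1) = m i := by
    intro i; rw [show i + (n - 1) + 1 = i + n by omega, hm.per]
  have cprev : ∀ i, c (i + (n - 1) + 1) = c i := by
    intro i; rw [show i + (n - 1) + 1 = i + n by omega, per]
  have A1 : ∀ i, ∀ v, v ∉ R → G.Adj (c i) v → dj (F (c i)) (F v) = true := by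
    intro i v hv a
    rcases hO3 _ (cR i) v a with h | rfl
    · exact absurd h hv
    · rw [hF1, hF2 _ hv]; exact dj_symm (hmem i).1
  have A2 : ∀ i, ∀ v, v ∉ R → ∀ w, G.Adj w (c i) → G.Adj w v → F (c i) ≠ F v := by
    intro i v hv w a b
    rw [hF1, hF2 _ hv]
    by_cases hw : w ∈ R
    · obtain ⟨k, rfl⟩ := hw
      rcases hO3 _ (cR k) v b with h | rfl
      · exact absurd h hv
      have hk : m i = F (c i) := (hF1 i).symm
      rcases adjR k _ (cR i) a with e | e
      · rw [hk, e, hF1]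
        have := (hmem (k + 1)).2.2.2.2
        simpa only [show k + 1 + (n - 1) = k + n by omega, per] using this
      · rw [hk, e, hF1]
        have := (hmem (k + (n - 1))).2.2.2.1
        simpa only [cprev] using this
    · have e : w = O (c i) := by
        rcases hO3 _ (cR i) w a.symm with h | h
        · exact absurd h hw
        · exact h
      subst e
      rcases hGH _ (cR i) v b with rfl | rfl | rfl
      · exact absurd (cR i) hv
      · exact (hmem i).2.1
      · exact (hmem i).2.2.1
  refine ⟨F, ?_, ?_⟩
  · intro u hu v hv a
    by_cases hu' : u ∈ R
    · obtain ⟨i, rfl⟩ := hu'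
      by_cases hv' : v ∈ R
      · rcases adjR i v hv' a with rfl | rfl
        · rw [hF1, hF1]; exact hm.d i
        · rw [hF1, hF1]
          have := hm.d (i + (n - 1))
          rw [mprev] at this
          exact dj_symm this
      · exact A1 i v hv' a
    · by_cases hv' : v ∈ R
      · obtain ⟨i, rfl⟩ := hv'
        exact dj_symm (A1 i u hu' a.symm)
      · rw [hF2 _ hu', hF2 _ hv']
        exact hf.1 u (hin u hu hu') v (hin v hv hv') a
  · intro u hu v hv hne w a b
    by_cases hu' : u ∈ R
    · obtain ⟨i, rfl⟩ := hu'
      by_cases hv' : v ∈ R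
      · by_cases hw : w ∈ R
        · obtain ⟨k, rfl⟩ := hw
          have hk := hm.e (k + (n - 1))
          rw [show k + (n - 1) + 2 = k + 1 + n by omega, hm.per] at hk
          rcases adjR k _ (cR i) a with e | e <;> rcases adjR k v hv' b with e' | e'
          · exact absurd (e.trans e'.symm) hne
          · rw [e, e', hF1, hF1]; exact hk.symm
          · rw [e, e', hF1, hF1]; exact hk
          · exact absurd (e.trans e'.symm) hne
        · obtain ⟨d, hdn, rfl⟩ := off i v hv'
          by_cases h0 : d = 0
          · subst h0; exact absurd rfl hne
          by_cases h1 : d = 1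
          · subst h1; rw [hF1, hF1]; exact dj_ne (hm.d i)
          by_cases h2 : d = 2
          · subst h2; rw [hF1, hF1]; exact hm.e i
          exact absurd b.symm (oo i d w (by omega) hdn (fun k hk => hw ⟨k, hk.symm⟩) a.symm)
      · exact A2 i v hv' w a b
    · by_cases hv' : v ∈ R
      · obtain ⟨i, rfl⟩ := hv'
        exact (A2 i u hu' w b a).symm
      · rw [hF2 _ hu', hF2 _ hv']
        exact hf.2 u (hin u hu hu') v (hin v hv hv') hne w a b

end Cu
end TT

theorem twoTone_le_eight_of_maxDegree_le_three
    {V : Type*} [Fintype V] (G : SimpleGraph V) [DecidableRel G.Adj]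
    (hΔ : G.maxDegree ≤ 3) :
    toneNumber G 2 ≤ 8 := by
  classical
  have hd : ∀ v, G.degree v ≤ 3 := fun v => (G.degree_le_maxDegree v).trans hΔ
  obtain ⟨f, hf⟩ := TT.comp_glue G (by
    intro r
    by_cases h : ∃ v, G.Reachable r v ∧ G.degree v ≤ 2
    · obtain ⟨v, hv, h2⟩ := h
      obtain ⟨f, hf⟩ := TT.case_deg2 G hd v h2
      refine ⟨f, ?_⟩
      convert hf using 2
      ext w
      exact ⟨fun h => hv.symm.trans h, fun h => hv.trans h⟩
    · push Not at h
      exact TT.case_cubic G hd r (fun v hv => h v hv))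
  exact Nat.sInf_le ⟨_, TT.tone_of_valid G f hf⟩
end

section
/- For every positive integer t and every finite simple graph G with at least one edge, τ_t(G) ≤ (t² + t)·Δ(G). -/
lemma ttone_choose_step (n t d : ℕ) (hd : d < t) (htn : t ≤ n) :
    (n - (d+1)).choose (t - (d+1)) * n ≤ t * (n - d).choose (t - d) := by
  obtain ⟨a, rfl⟩ : ∃ a, t = d + 1 + a := ⟨t - (d+1), by omega⟩
  obtain ⟨b, rfl⟩ : ∃ b, n = d + 1 + a + b := ⟨n - (d+1+a), by omega⟩
  have e1 : d + 1 + a + b - (d+1) = a + b := by omega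
  have e2 : d + 1 + a - (d+1) = a := by omega
  have e3 : d + 1 + a + b - d = a + b + 1 := by omega
  have e4 : d + 1 + a - d = a + 1 := by omega
  rw [e1, e2, e3, e4]
  have h := Nat.add_one_mul_choose_eq (a+b) a
  have hpos : 0 < a + b + 1 := by omega
  refine Nat.le_of_mul_le_mul_left ?_ hpos
  calc (a+b+1) * ((a+b).choose a * (d+1+a+b))
      = ((a+b+1) * (a+b).choose a) * (d+1+a+b) := by ring
    _ = (a+b+1).choose (a+1) * ((a+1) * (d+1+a+b)) := by rw [h]; ring
    _ ≤ (a+b+1).choose (a+1) * ((a+b+1) * (d+1+a)) := by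
        apply Nat.mul_le_mul_left
        nlinarith [Nat.zero_le (d*b)]
    _ = _ := by ring

lemma ttone_choose_bound (t D d : ℕ) (ht : 0 < t) (hD : 0 < D) (hd : d ≤ t) :
    (t ^ 2 * D - d).choose (t - d) * (t * D) ^ d ≤ (t ^ 2 * D).choose t := by
  induction d with
  | zero => simp
  | succ d ih =>
    have htn : t ≤ t ^ 2 * D := by nlinarith [Nat.mul_pos ht hD]
    have h := ttone_choose_step (t^2*D) t d hd htn
    have h2 : (t^2*D - (d+1)).choose (t - (d+1)) * (t * D) ≤ (t^2*D - d).choose (t - d) := by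
      refine Nat.le_of_mul_le_mul_left ?_ ht
      calc _ = (t^2*D - (d+1)).choose (t - (d+1)) * (t^2*D) := by ring
        _ ≤ _ := h
    calc _ = ((t^2*D - (d+1)).choose (t - (d+1)) * (t * D)) * (t*D)^d := by ring
      _ ≤ (t^2*D - d).choose (t - d) * (t*D)^d := Nat.mul_le_mul_right _ h2
      _ ≤ _ := ih (by omega)

lemma ttone_term_bound (t D d : ℕ) (ht : 0 < t) (hD : 0 < D) (hd : d ≤ t) :
    2 ^ (d - 1) * (D ^ d * (t.choose d * (t ^ 2 * D - d).choose (t - d)))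
      ≤ (t ^ 2 * D).choose t := by
  refine le_trans ?_ (ttone_choose_bound t D d ht hD hd)
  have h1 : 2 ^ (d-1) ≤ d.factorial := by
    rcases d with _ | d
    · simp
    · simpa [add_comm] using Nat.factorial_mul_pow_le_factorial (m := 1) (n := d)
  have h2 : d.factorial * t.choose d ≤ t ^ d := by
    rw [← Nat.descFactorial_eq_factorial_mul_choose]
    exact Nat.descFactorial_le_pow t d
  calc _ = (2 ^ (d-1) * t.choose d) * (D ^ d * (t ^ 2 * D - d).choose (t - d)) := by ring
    _ ≤ t ^ d * (D ^ d * (t ^ 2 * D - d).choose (t - d)) :=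
        Nat.mul_le_mul_right _ ((Nat.mul_le_mul_right _ h1).trans h2)
    _ = _ := by ring

lemma ttone_sum_bound (x : ℕ → ℕ) (N m : ℕ)
    (h : ∀ d ∈ Finset.range m, 2 ^ (d + 1) * x (d + 2) ≤ N) :
    2 ^ m * (∑ d ∈ Finset.range m, x (d + 2)) + N ≤ 2 ^ m * N := by
  induction m with
  | zero => simp
  | succ m ih =>
    have h1 := ih (fun d hd => h d (by simp at hd ⊢; omega))
    have h2 := h m (by simp)
    rw [Finset.sum_range_succ]
    have : 2 ^ (m+1) * (∑ d ∈ Finset.range m, x (d + 2))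
      = 2 * (2 ^ m * (∑ d ∈ Finset.range m, x (d + 2))) := by ring
    have h3 : 2 ^ (m+1) * N = 2 * (2 ^ m * N) := by ring
    rw [mul_add, this, h3]
    omega

lemma ttone_reach {V : Type*} [Fintype V] (G : SimpleGraph V) [DecidableRel G.Adj]
    (u : V) (d : ℕ) :
    ∃ R : Finset V, R.card ≤ G.maxDegree ^ d ∧ ∀ v, G.edist u v = d → v ∈ R := by
  classical
  suffices h : ∃ R : Finset V, R.card ≤ G.maxDegree ^ d ∧
      ∀ v, ∀ p : G.Walk v u, p.length = d → v ∈ R by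
    obtain ⟨R, h1, h2⟩ := h
    refine ⟨R, h1, fun v hv => ?_⟩
    have hne : G.edist v u ≠ ⊤ := by
      rw [SimpleGraph.edist_comm, hv]; simp
    obtain ⟨p, hp⟩ := SimpleGraph.exists_walk_of_edist_ne_top hne
    rw [SimpleGraph.edist_comm, hv] at hp
    exact h2 v p (by exact_mod_cast hp)
  induction d with
  | zero =>
    refine ⟨{u}, by simp, fun v p hp => ?_⟩
    simp [SimpleGraph.Walk.eq_of_length_eq_zero hp]
  | succ d ih =>
    obtain ⟨R, h1, h2⟩ := ih
    refine ⟨R.biUnion (fun w => G.neighborFinset w), ?_, ?_⟩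
    · calc _ ≤ R.card * G.maxDegree := Finset.card_biUnion_le_card_mul _ _ _
            (fun w _ => by simpa using G.degree_le_maxDegree w)
        _ ≤ _ := by rw [pow_succ]; exact Nat.mul_le_mul_right _ h1
    · intro v p hp
      cases p with
      | nil => simp at hp
      | cons hadj q =>
        rename_i w
        simp only [Finset.mem_biUnion, SimpleGraph.mem_neighborFinset]
        exact ⟨w, h2 w q (by simpa using hp), hadj.symm⟩

lemma ttone_bad (A F : Finset ℕ) (t d : ℕ) (hd : d ≤ t) (hF : F.card = t) :
    ((A.powersetCard t).filter (fun L => d ≤ (L ∩ F).card)).card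
      ≤ t.choose d * (A.card - d).choose (t - d) := by
  classical
  have hsub : (A.powersetCard t).filter (fun L => d ≤ (L ∩ F).card) ⊆
      (F.powersetCard d).biUnion
        (fun D => (A.powersetCard t).filter (fun L => D ⊆ L)) := by
    intro L hL
    simp only [Finset.mem_filter, Finset.mem_biUnion, Finset.mem_powersetCard] at hL ⊢
    obtain ⟨D, hD, hc⟩ := Finset.exists_subset_card_eq hL.2
    exact ⟨D, ⟨hD.trans Finset.inter_subset_right, hc⟩, hL.1, hD.trans Finset.inter_subset_left⟩
  refine (Finset.card_le_card hsub).trans ?_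
  rw [← hF, ← Finset.card_powersetCard d F, hF]
  refine Finset.card_biUnion_le_card_mul _ _ _ ?_
  intro D hD
  rw [Finset.mem_powersetCard] at hD
  by_cases hDA : D ⊆ A
  · have : (A.card - d).choose (t - d) = ((A \ D).powersetCard (t-d)).card := by
      rw [Finset.card_powersetCard, Finset.card_sdiff_of_subset hDA, hD.2]
    rw [this]
    refine Finset.card_le_card_of_injOn (fun L => L \ D) ?_ ?_
    · intro L hL
      simp only [Finset.coe_filter, Set.mem_setOf_eq, Finset.mem_powersetCard, Finset.mem_coe] at hL ⊢
      exact ⟨Finset.sdiff_subset_sdiff hL.1.1 le_rfl, by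
        rw [Finset.card_sdiff_of_subset hL.2, hL.1.2, hD.2]⟩
    · intro L hL M hM h
      simp only [Finset.coe_filter, Set.mem_setOf_eq] at hL hM
      simp only at h
      rw [← Finset.sdiff_union_of_subset hL.2, h, Finset.sdiff_union_of_subset hM.2]
  · rw [Finset.filter_eq_empty_iff.2]
    · simp
    · intro L hL h
      exact hDA (h.trans (Finset.mem_powersetCard.1 hL).1)

lemma ttone_extend {V : Type*} [Fintype V] (G : SimpleGraph V) [DecidableRel G.Adj]
    (t : ℕ) (ht : 0 < t) (hD : 0 < G.maxDegree) (f : V → Finset ℕ) (S : Finset V)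
    (hf : ∀ v ∈ S, (f v).card = t) (u : V) :
    ∃ L : Finset ℕ, L.card = t ∧ L ⊆ Finset.Icc 1 ((t ^ 2 + t) * G.maxDegree) ∧
      ∀ v ∈ S, u ≠ v → ((L ∩ f v).card : ℕ∞) < G.edist u v := by
  classical
  set N : Finset ℕ := (G.neighborFinset u ∩ S).biUnion f with hN
  have hNc : N.card ≤ t * G.maxDegree := by
    calc N.card ≤ (G.neighborFinset u ∩ S).card * t :=
          Finset.card_biUnion_le_card_mul _ _ _
            (fun v hv => (hf v (Finset.mem_inter.1 hv).2).le)
      _ ≤ G.maxDegree * t := by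
          apply Nat.mul_le_mul_right
          refine (Finset.card_le_card Finset.inter_subset_left).trans ?_
          simpa using G.degree_le_maxDegree u
      _ = _ := mul_comm _ _
  have hA : t ^ 2 * G.maxDegree ≤ (Finset.Icc 1 ((t ^ 2 + t) * G.maxDegree) \ N).card := by
    have := Finset.le_card_sdiff N (Finset.Icc 1 ((t ^ 2 + t) * G.maxDegree))
    rw [Nat.card_Icc, add_mul] at this
    rw [add_mul]
    omega
  obtain ⟨A, hAsub, hAc⟩ := Finset.exists_subset_card_eq hA
  choose R hRc hR using ttone_reach G u
  set Bad : Finset (Finset ℕ) := (Finset.range (t - 1)).biUnion (fun d =>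
    (R (d+2) ∩ S).biUnion (fun v =>
      (A.powersetCard t).filter (fun L => d + 2 ≤ (L ∩ f v).card))) with hBad
  let x : ℕ → ℕ := fun d => G.maxDegree ^ d *
    (t.choose d * (t ^ 2 * G.maxDegree - d).choose (t - d))
  have hBc : Bad.card ≤ ∑ d ∈ Finset.range (t - 1), x (d + 2) := by
    refine Finset.card_biUnion_le.trans (Finset.sum_le_sum ?_)
    intro d hd
    rw [Finset.mem_range] at hd
    refine (Finset.card_biUnion_le_card_mul _ _
      (t.choose (d+2) * (t ^ 2 * G.maxDegree - (d+2)).choose (t - (d+2))) ?_).trans ?_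
    · intro v hv
      rw [← hAc]
      exact ttone_bad A (f v) t (d+2) (by omega) (hf v (Finset.mem_inter.1 hv).2)
    · exact Nat.mul_le_mul_right _
        ((Finset.card_le_card Finset.inter_subset_left).trans (hRc _))
  have hsum := ttone_sum_bound x ((t ^ 2 * G.maxDegree).choose t) (t-1) (by
    intro d hd
    rw [Finset.mem_range] at hd
    exact ttone_term_bound t G.maxDegree (d+2) ht hD (by omega))
  have hpos : 0 < (t ^ 2 * G.maxDegree).choose t :=
    Nat.choose_pos (by nlinarith [Nat.mul_pos ht hD])
  have hlt : Bad.card < (A.powersetCard t).card := by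
    rw [Finset.card_powersetCard, hAc]
    refine hBc.trans_lt ?_
    refine Nat.lt_of_mul_lt_mul_left (a := 2 ^ (t-1)) ?_
    omega
  obtain ⟨L, hL, hLB⟩ := Finset.exists_mem_notMem_of_card_lt_card hlt
  have hL' := Finset.mem_powersetCard.1 hL
  refine ⟨L, hL'.2, hL'.1.trans (hAsub.trans Finset.sdiff_subset), ?_⟩
  intro v hv huv
  have hLle : (L ∩ f v).card ≤ t := hL'.2 ▸ Finset.card_le_card Finset.inter_subset_left
  by_contra hcon
  rw [not_lt] at hcon
  obtain ⟨d, hd⟩ := ENat.ne_top_iff_exists.1 (ne_top_of_le_ne_top (ENat.coe_ne_top _) hcon)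
  rw [← hd] at hcon
  have hcon' : d ≤ (L ∩ f v).card := by exact_mod_cast hcon
  match d, hd, hcon' with
  | 0, hd, _ => exact huv (SimpleGraph.edist_eq_zero_iff.1 hd.symm)
  | 1, hd, h1 =>
    have hadj : G.Adj u v := SimpleGraph.edist_eq_one_iff_adj.1 hd.symm
    obtain ⟨c, hc⟩ := Finset.card_pos.1 (show 0 < (L ∩ f v).card by omega)
    rw [Finset.mem_inter] at hc
    have := (Finset.mem_sdiff.1 (hAsub (hL'.1 hc.1))).2
    exact this (Finset.mem_biUnion.2 ⟨v, by simp [hadj, hv], hc.2⟩)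
  | d+2, hd, h2 =>
    apply hLB
    simp only [hBad, Finset.mem_biUnion, Finset.mem_filter, Finset.mem_range, Finset.mem_inter]
    exact ⟨d, by omega, v, ⟨hR _ v hd.symm, hv⟩, hL, h2⟩

theorem toneNumber_le_t_sq_add_t_mul_maxDegree
    {V : Type*} [Fintype V] (G : SimpleGraph V) [DecidableRel G.Adj]
    (t : ℕ) (ht : 0 < t) (hedge : ∃ u v : V, G.Adj u v) :
    toneNumber G t ≤ (t ^ 2 + t) * G.maxDegree := by
  classical
  obtain ⟨a, b, hab⟩ := hedge
  have hD : 0 < G.maxDegree :=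
    lt_of_lt_of_le ((G.degree_pos_iff_exists_adj a).2 ⟨b, hab⟩) (G.degree_le_maxDegree a)
  apply Nat.sInf_le
  suffices h : ∀ S : Finset V, ∃ f : V → Finset ℕ,
      (∀ v ∈ S, (f v).card = t ∧ f v ⊆ Finset.Icc 1 ((t ^ 2 + t) * G.maxDegree)) ∧
      ∀ u ∈ S, ∀ v ∈ S, u ≠ v → ((f u ∩ f v).card : ℕ∞) < G.edist u v by
    obtain ⟨f, h1, h2⟩ := h Finset.univ
    exact ⟨f, fun v => h1 v (Finset.mem_univ _),
      fun u v => h2 u (Finset.mem_univ _) v (Finset.mem_univ _)⟩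
  intro S
  induction S using Finset.induction_on with
  | empty => exact ⟨fun _ => ∅, by simp, by simp⟩
  | insert w S hw ih =>
    obtain ⟨f, h1, h2⟩ := ih
    obtain ⟨L, hLc, hLs, hL⟩ := ttone_extend G t ht hD f S (fun v hv => (h1 v hv).1) w
    have hg : ∀ v ∈ S, Function.update f w L v = f v := by
      intro v hv
      have hne : v ≠ w := by
        rintro rfl
        exact hw hv
      exact Function.update_of_ne hne _ _
    have hgw : Function.update f w L w = L := Function.update_self _ _ _
    refine ⟨Function.update f w L, ?_, ?_⟩
    · intro v hv
      rcases Finset.mem_insert.1 hv with rfl | hv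
      · rw [hgw]; exact ⟨hLc, hLs⟩
      · rw [hg v hv]; exact h1 v hv
    · intro u hu v hv huv
      rcases Finset.mem_insert.1 hu with rfl | hu2
      · rcases Finset.mem_insert.1 hv with rfl | hv
        · exact absurd rfl huv
        · rw [hgw, hg v hv]; exact hL v hv huv
      · rcases Finset.mem_insert.1 hv with rfl | hv
        · rw [hgw, hg u hu2, Finset.inter_comm, SimpleGraph.edist_comm]
          exact hL u hu2 huv.symm
        · rw [hg u hu2, hg v hv]; exact h2 u hu2 v hv huv
end

section
/- For every positive integer t there exists a constant c = c(t) > 0 such that every finite tree T with at least one edge satisfies τ_t(T) ≤ c·√(Δ(T)). -/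
open Finset

lemma tree_parent {V : Type} (T : SimpleGraph V) (hT : T.IsTree) (r : V) :
    ∃ (l : V → ℕ) (p : V → V),
      (∀ v, l v ≠ 0 → T.Adj v (p v) ∧ l v = l (p v) + 1) ∧
      (∀ u v, T.Adj u v → (p u = v ∧ l u = l v + 1) ∨ (p v = u ∧ l v = l u + 1)) := by
  classical
  have hc := hT.connected
  have ex : ∀ v, ∃ y, T.dist r v ≠ 0 → T.Adj v y ∧ T.dist r v = T.dist r y + 1 := by
    intro v
    by_cases h : T.dist r v = 0
    · exact ⟨v, fun h' => absurd h h'⟩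
    · obtain ⟨w, hw⟩ := hc.exists_walk_length_eq_dist v r
      cases w with
      | nil => simp at h
      | cons hadj w' =>
        rename_i y
        refine ⟨y, fun _ => ⟨hadj, ?_⟩⟩
        have h1 : T.dist y r ≤ w'.length := SimpleGraph.dist_le w'
        have h2 : T.dist v r ≤ T.dist v y + T.dist y r := hc.dist_triangle
        have h3 : T.dist v y = 1 := SimpleGraph.dist_eq_one_iff_adj.2 hadj
        simp only [SimpleGraph.Walk.length_cons] at hw
        rw [SimpleGraph.dist_comm (u := r) (v := v), SimpleGraph.dist_comm (u := r) (v := y)]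
        omega
  choose p hp using ex
  have uniq : ∀ v y z, T.Adj v y → T.dist r v = T.dist r y + 1 → T.Adj v z →
      T.dist r v = T.dist r z + 1 → y = z := by
    intro v y z hy hy' hz hz'
    obtain ⟨w1, hw1⟩ := hc.exists_walk_length_eq_dist y r
    obtain ⟨w2, hw2⟩ := hc.exists_walk_length_eq_dist z r
    have p1 : (SimpleGraph.Walk.cons hy w1).IsPath := by
      apply SimpleGraph.Walk.isPath_of_length_eq_dist
      rw [SimpleGraph.Walk.length_cons, hw1, SimpleGraph.dist_comm, ← hy', SimpleGraph.dist_comm]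
    have p2 : (SimpleGraph.Walk.cons hz w2).IsPath := by
      apply SimpleGraph.Walk.isPath_of_length_eq_dist
      rw [SimpleGraph.Walk.length_cons, hw2, SimpleGraph.dist_comm, ← hz', SimpleGraph.dist_comm]
    have := (hT.isAcyclic.subsingleton_path v r).elim ⟨_, p1⟩ ⟨_, p2⟩
    have := congrArg (fun q : T.Path v r => (q : T.Walk v r).snd) this
    simpa using this
  refine ⟨T.dist r, p, hp, ?_⟩
  intro u v huv
  have hne := hT.dist_ne_of_adj r huv
  have h3 : T.dist u v = 1 := SimpleGraph.dist_eq_one_iff_adj.2 huv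
  have h4 : T.dist v u = 1 := SimpleGraph.dist_eq_one_iff_adj.2 huv.symm
  have h1 : T.dist r v ≤ T.dist r u + T.dist u v := hc.dist_triangle
  have h2 : T.dist r u ≤ T.dist r v + T.dist v u := hc.dist_triangle
  rcases lt_or_gt_of_ne hne with h | h
  · have e : T.dist r v = T.dist r u + 1 := by omega
    obtain ⟨q1, q2⟩ := hp v (by omega)
    exact Or.inr ⟨uniq v _ _ q1 q2 huv.symm e, e⟩
  · have e : T.dist r u = T.dist r v + 1 := by omega
    obtain ⟨q1, q2⟩ := hp u (by omega)
    exact Or.inl ⟨uniq u _ _ q1 q2 huv e, e⟩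

lemma level_iter {V : Type} (l : V → ℕ) (p : V → V) (hp : ∀ v, l v ≠ 0 → l v = l (p v) + 1) :
    ∀ (a : ℕ) (v : V), a ≤ l v → l v = l (p^[a] v) + a := by
  intro a
  induction a with
  | zero => intro v _; simp
  | succ a ih =>
    intro v h
    have h1 := hp v (by omega)
    have h2 := ih (p v) (by omega)
    rw [Function.iterate_succ_apply]; omega

lemma walk_meet {V : Type} (T : SimpleGraph V) (l : V → ℕ) (p : V → V)
    (hp : ∀ v, l v ≠ 0 → T.Adj v (p v) ∧ l v = l (p v) + 1)
    (ha : ∀ u v, T.Adj u v → (p u = v ∧ l u = l v + 1) ∨ (p v = u ∧ l v = l u + 1))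
    {v w : V} (q : T.Walk v w) :
    ∃ a b, a + b ≤ q.length ∧ a ≤ l v ∧ b ≤ l w ∧ p^[a] v = p^[b] w := by
  induction q with
  | nil => exact ⟨0, 0, by simp⟩
  | @cons v v' w hadj q ih =>
    obtain ⟨a, b, hab, hav, hbw, he⟩ := ih
    simp only [SimpleGraph.Walk.length_cons]
    rcases ha v v' hadj with ⟨h1, h2⟩ | ⟨h1, h2⟩
    · exact ⟨a + 1, b, by omega, by omega, hbw, by rw [Function.iterate_succ_apply, h1, he]⟩
    · cases a with
      | zero =>
        have := level_iter l p (fun v hv => (hp v hv).2) b w hbw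
        simp only [Function.iterate_zero, id] at he
        rw [← he] at this
        refine ⟨0, b + 1, by omega, by omega, by omega, ?_⟩
        rw [Function.iterate_succ_apply', ← he, h1]; rfl
      | succ a =>
        refine ⟨a, b, by omega, by omega, hbw, ?_⟩
        rw [← he, Function.iterate_succ_apply, h1]

lemma desc_card {V : Type} [Fintype V] [DecidableEq V] (T : SimpleGraph V) [DecidableRel T.Adj]
    (l : V → ℕ) (p : V → V)
    (hp : ∀ v, l v ≠ 0 → T.Adj v (p v) ∧ l v = l (p v) + 1) :
    ∀ (b : ℕ) (x : V), #{w : V | b ≤ l w ∧ p^[b] w = x} ≤ T.maxDegree ^ b := by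
  intro b
  induction b with
  | zero => intro x; simp [Finset.filter_eq']
  | succ b ih =>
    intro x
    have hsub : ({w : V | b + 1 ≤ l w ∧ p^[b+1] w = x} : Finset V) ⊆
        (T.neighborFinset x).biUnion (fun y => {w : V | b ≤ l w ∧ p^[b] w = y}) := by
      intro w hw
      simp only [mem_filter, mem_univ, true_and] at hw
      simp only [mem_biUnion, mem_filter, mem_univ, true_and, SimpleGraph.mem_neighborFinset]
      refine ⟨p^[b] w, ?_, by omega, rfl⟩
      have := level_iter l p (fun v hv => (hp v hv).2) b w (by omega)
      have := (hp (p^[b] w) (by omega)).1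
      rw [← Function.iterate_succ_apply' p, hw.2] at this
      exact this.symm
    refine (card_le_card hsub).trans ((card_biUnion_le_card_mul _ _ _ (fun y _ => ih y)).trans ?_)
    rw [pow_succ', SimpleGraph.card_neighborFinset_eq_degree]
    exact Nat.mul_le_mul_right _ (T.degree_le_maxDegree x)

lemma sphere_card {V : Type} [Fintype V] [DecidableEq V] (T : SimpleGraph V) [DecidableRel T.Adj]
    (hT : T.Connected) (hD : 1 ≤ T.maxDegree)
    (l : V → ℕ) (p : V → V)
    (hp : ∀ v, l v ≠ 0 → T.Adj v (p v) ∧ l v = l (p v) + 1)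
    (ha : ∀ u v, T.Adj u v → (p u = v ∧ l u = l v + 1) ∨ (p v = u ∧ l v = l u + 1))
    (v : V) (d : ℕ) :
    #{w : V | l w ≤ l v ∧ T.dist v w = d} ≤ (d + 1) * T.maxDegree ^ (d / 2) := by
  have hsub : ({w : V | l w ≤ l v ∧ T.dist v w = d} : Finset V) ⊆
      (range (d+1)).biUnion (fun a =>
        ({w : V | min (d - a) (d/2) ≤ l w ∧ p^[min (d - a) (d/2)] w = p^[a] v} : Finset V)) := by
    intro w hw
    simp only [mem_filter, mem_univ, true_and] at hw
    obtain ⟨hl, hd⟩ := hw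
    obtain ⟨q, hq⟩ := hT.exists_walk_length_eq_dist v w
    obtain ⟨a, b, hab, hav, hbw, he⟩ := walk_meet T l p hp ha q
    have hp' := fun v hv => (hp v hv).2
    have h1 := level_iter l p hp' a v hav
    have h2 := level_iter l p hp' b w hbw
    rw [he] at h1
    have key : ∀ (b : ℕ) (w : V), b ≤ l w → T.dist w (p^[b] w) ≤ b := by
      intro b
      induction b with
      | zero => intro w _; simp
      | succ b ih =>
        intro w hw
        obtain ⟨g1, g2⟩ := hp w (by omega)
        have g3 := ih (p w) (by omega)
        have g4 : T.dist w (p w) = 1 := SimpleGraph.dist_eq_one_iff_adj.2 g1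
        rw [Function.iterate_succ_apply]
        have := hT.dist_triangle (u := w) (v := p w) (w := p^[b] (p w))
        omega
    have k1 := key a v hav
    have k2 := key b w hbw
    have k3 := hT.dist_triangle (u := v) (v := p^[a] v) (w := w)
    rw [he] at k1 k3
    rw [SimpleGraph.dist_comm (u := w)] at k2
    simp only [mem_biUnion, mem_filter, mem_univ, true_and, mem_range]
    refine ⟨a, by omega, ?_⟩
    have : min (d - a) (d / 2) = b := by omega
    rw [this]
    exact ⟨hbw, he.symm⟩
  refine (card_le_card hsub).trans ((card_biUnion_le_card_mul _ _ (T.maxDegree ^ (d/2))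
    (fun a _ => (desc_card T l p hp _ _).trans (Nat.pow_le_pow_right hD (min_le_right _ _)))).trans ?_)
  simp

lemma bad_card (t m d : ℕ) (hm : 1 ≤ m) (g : Fin t → Fin m) :
    #{h : Fin t → Fin m | d ≤ #{i | h i = g i}} ≤ 2 ^ t * m ^ (t - d) := by
  have hsub : ({h : Fin t → Fin m | d ≤ #{i | h i = g i}} : Finset _) ⊆
      ({S : Finset (Fin t) | d ≤ #S} : Finset _).biUnion
        (fun S => Fintype.piFinset (fun i => if i ∈ S then {g i} else univ)) := by
    intro h hh
    simp only [mem_filter, mem_univ, true_and] at hh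
    simp only [mem_biUnion, mem_filter, mem_univ, true_and, Fintype.mem_piFinset]
    refine ⟨_, hh, fun i => ?_⟩
    by_cases hi : h i = g i <;> simp [hi]
  refine (card_le_card hsub).trans ((card_biUnion_le_card_mul _ _ (m ^ (t - d)) ?_).trans ?_)
  · intro S hS
    simp only [mem_filter, mem_univ, true_and] at hS
    rw [Fintype.card_piFinset]
    have : ∀ i, #(if i ∈ S then {g i} else (univ : Finset (Fin m))) = if i ∈ S then 1 else m := by
      intro i; split_ifs <;> simp
    simp only [this]
    rw [Finset.prod_ite]
    simp only [prod_const_one, one_mul, prod_const]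
    apply Nat.pow_le_pow_right hm
    have : (univ.filter (fun i => i ∉ S)) = Sᶜ := by ext; simp
    rw [this, card_compl, Fintype.card_fin]
    omega
  · apply Nat.mul_le_mul_right
    refine (card_le_univ _).trans ?_
    simp

lemma exists_label {V : Type} [Fintype V] [DecidableEq V] (T : SimpleGraph V)
    [DecidableRel T.Adj] (hT : T.IsTree) (hD : 1 ≤ T.maxDegree) (t s q : ℕ)
    (hs : t * ((t + 1) * 2 ^ t) < s) (hq : T.maxDegree ≤ q ^ 2) (hq1 : 1 ≤ q) :
    ∃ g : V → Fin t → Fin (s * q), ∀ u v, u ≠ v → #{i | g u i = g v i} < T.dist u v := by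
  obtain ⟨r⟩ := hT.connected.nonempty
  obtain ⟨l, p, hp, ha⟩ := tree_parent T hT r
  set m := s * q with hm
  have hs1 : 1 ≤ s := by omega
  have hm1 : 1 ≤ m := Nat.mul_pos hs1 hq1
  suffices H : ∀ S : Finset V, ∃ g : V → Fin t → Fin m, ∀ u ∈ S, ∀ v ∈ S, u ≠ v →
      #{i | g u i = g v i} < T.dist u v by
    obtain ⟨g, hg⟩ := H univ
    exact ⟨g, fun u v h => hg u (mem_univ _) v (mem_univ _) h⟩
  intro S
  induction S using Finset.induction_on_max_value l with
  | empty => exact ⟨fun _ _ => ⟨0, hm1⟩, by simp⟩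
  | insert v S hv hmax ih =>
    obtain ⟨g, hg⟩ := ih
    let B : Finset (Fin t → Fin m) := (Icc 1 t).biUnion (fun d =>
      ({w : V | l w ≤ l v ∧ T.dist v w = d} : Finset V).biUnion (fun w =>
        ({h : Fin t → Fin m | d ≤ #{i | h i = g w i}} : Finset _)))
    have hterm : ∀ d ∈ Icc 1 t, s * #(({w : V | l w ≤ l v ∧ T.dist v w = d} : Finset V).biUnion
        (fun w => ({h : Fin t → Fin m | d ≤ #{i | h i = g w i}} : Finset _))) ≤
        (t + 1) * 2 ^ t * m ^ t := by
      intro d hd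
      rw [mem_Icc] at hd
      have h1 := card_biUnion_le_card_mul ({w : V | l w ≤ l v ∧ T.dist v w = d} : Finset V)
        (fun w => ({h : Fin t → Fin m | d ≤ #{i | h i = g w i}} : Finset _))
        _ (fun w _ => bad_card t m d hm1 (g w))
      have h2 := sphere_card T hT.connected hD l p hp ha v d
      have h3 : s * T.maxDegree ^ (d / 2) ≤ m ^ d := by
        rw [hm, mul_pow]
        apply Nat.mul_le_mul
        · exact Nat.le_self_pow (by omega) s
        · calc T.maxDegree ^ (d / 2) ≤ (q ^ 2) ^ (d / 2) := Nat.pow_le_pow_left hq _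
            _ = q ^ (2 * (d / 2)) := (pow_mul _ _ _).symm
            _ ≤ q ^ d := Nat.pow_le_pow_right hq1 (by omega)
      calc s * _ ≤ s * (((d + 1) * T.maxDegree ^ (d / 2)) * (2 ^ t * m ^ (t - d))) :=
            Nat.mul_le_mul_left _ (h1.trans (Nat.mul_le_mul_right _ h2))
        _ = (d + 1) * 2 ^ t * ((s * T.maxDegree ^ (d / 2)) * m ^ (t - d)) := by ring
        _ ≤ (t + 1) * 2 ^ t * (m ^ d * m ^ (t - d)) := by gcongr; omega
        _ = _ := by rw [← pow_add, Nat.add_sub_cancel' hd.2]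
    have hB : s * #B < s * m ^ t := by
      calc s * #B ≤ s * ∑ d ∈ Icc 1 t, #(({w : V | l w ≤ l v ∧ T.dist v w = d} : Finset V).biUnion
            (fun w => ({h : Fin t → Fin m | d ≤ #{i | h i = g w i}} : Finset _))) :=
            Nat.mul_le_mul_left _ card_biUnion_le
        _ ≤ ∑ d ∈ Icc 1 t, (t + 1) * 2 ^ t * m ^ t := by
            rw [mul_sum]; exact sum_le_sum hterm
        _ = t * ((t + 1) * 2 ^ t) * m ^ t := by simp; ring
        _ < s * m ^ t := Nat.mul_lt_mul_of_pos_right hs (by positivity)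
    have hB' : #B < #(univ : Finset (Fin t → Fin m)) := by
      have := lt_of_mul_lt_mul_left hB (Nat.zero_le _)
      simpa using this
    obtain ⟨h, -, hh⟩ := exists_mem_notMem_of_card_lt_card hB'
    have good : ∀ w ∈ S, #{i | h i = g w i} < T.dist v w := by
      intro w hw
      by_contra hcon
      push Not at hcon
      apply hh
      have hne : v ≠ w := fun e => hv (e ▸ hw)
      have hpos := hT.connected.pos_dist_of_ne hne
      have hle : #{i | h i = g w i} ≤ t := (card_le_univ _).trans (by simp)
      simp only [B, mem_biUnion, mem_filter, mem_univ, true_and, mem_Icc]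
      exact ⟨T.dist v w, ⟨hpos, hcon.trans hle⟩, w, ⟨hmax w hw, rfl⟩, hcon⟩
    refine ⟨Function.update g v h, ?_⟩
    intro a haS b hbS hab
    rw [mem_insert] at haS hbS
    by_cases hav : a = v
    · subst hav
      have hbS' : b ∈ S := hbS.resolve_left (Ne.symm hab)
      rw [Function.update_self, Function.update_of_ne (Ne.symm hab)]
      exact good b hbS'
    · have haS' : a ∈ S := haS.resolve_left hav
      rw [Function.update_of_ne hav]
      by_cases hbv : b = v
      · subst hbv
        rw [Function.update_self, SimpleGraph.dist_comm]
        simpa only [eq_comm] using good a haS'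
      · rw [Function.update_of_ne hbv]
        exact hg a haS' b (hbS.resolve_left hbv) hab

lemma enc_inj {m : ℕ} {a b x y : ℕ} (hx : x < m) (hy : y < m)
    (h : a * m + x + 1 = b * m + y + 1) : a = b ∧ x = y := by
  have h' : x + m * a = y + m * b := by rw [mul_comm m a, mul_comm m b]; omega
  have h1 := congrArg (· / m) h'
  have h2 := congrArg (· % m) h'
  simp only [Nat.add_mul_div_left _ _ (by omega : 0 < m), Nat.div_eq_of_lt hx,
    Nat.div_eq_of_lt hy, Nat.add_mul_mod_self_left, Nat.mod_eq_of_lt hx, Nat.mod_eq_of_lt hy] at h1 h2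
  exact ⟨by omega, h2⟩

theorem toneNumber_tree_le_const_mul_sqrt_maxDegree (t : ℕ) (ht : 0 < t) :
    ∃ c : ℝ, 0 < c ∧
      ∀ (V : Type) [Fintype V] (T : SimpleGraph V) [DecidableRel T.Adj],
        T.IsTree → (∃ u v : V, T.Adj u v) →
          (toneNumber T t : ℝ) ≤ c * Real.sqrt (T.maxDegree : ℝ) := by
  obtain ⟨s, hs⟩ : ∃ s, t * ((t + 1) * 2 ^ t) < s := exists_gt _
  have hs0 : 0 < s := by omega
  refine ⟨2 * t * s, by positivity, ?_⟩
  intro V _ T _ hT ⟨u, v, huv⟩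
  classical
  have hD : 1 ≤ T.maxDegree := by
    have h1 : 0 < T.degree u := (T.degree_pos_iff_exists_adj u).2 ⟨v, huv⟩
    exact h1.trans_le (T.degree_le_maxDegree u)
  set q := Nat.sqrt T.maxDegree + 1 with hqdef
  have hq : T.maxDegree ≤ q ^ 2 := by
    rw [pow_two]; exact (Nat.lt_succ_sqrt _).le
  obtain ⟨g, hg⟩ := exists_label T hT hD t s q hs hq (by omega)
  have hk : toneNumber T t ≤ t * (s * q) := by
    apply Nat.sInf_le
    refine ⟨fun v => univ.image (fun i : Fin t => (i : ℕ) * (s * q) + (g v i : ℕ) + 1), ?_, ?_⟩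
    · intro v
      constructor
      · rw [card_image_of_injective]
        · simp
        · intro i j hij
          exact Fin.ext (enc_inj (g v i).2 (g v j).2 hij).1
      · intro x hx
        simp only [mem_image, mem_univ, true_and] at hx
        obtain ⟨i, rfl⟩ := hx
        rw [mem_Icc]
        have h1 := (g v i).2
        have h2 : ((i : ℕ) + 1) * (s * q) ≤ t * (s * q) := Nat.mul_le_mul_right _ i.2
        rw [add_mul, one_mul] at h2
        constructor <;> omega
    · intro a b hab
      rw [← (hT.connected a b).coe_dist_eq_edist]
      norm_cast
      refine lt_of_le_of_lt ?_ (hg a b hab)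
      refine (card_le_card (t := ({i | g a i = g b i} : Finset (Fin t)).image
        (fun i : Fin t => (i : ℕ) * (s * q) + (g a i : ℕ) + 1)) ?_).trans card_image_le
      intro x hx
      simp only [mem_inter, mem_image, mem_univ, true_and] at hx
      obtain ⟨⟨i, rfl⟩, j, hj⟩ := hx
      obtain ⟨e1, e2⟩ := enc_inj (g b j).2 (g a i).2 hj
      have e1' := Fin.ext e1
      subst e1'
      simp only [mem_image, mem_filter, mem_univ, true_and]
      exact ⟨j, Fin.ext e2.symm, rfl⟩
  have h1 : (toneNumber T t : ℝ) ≤ t * (s * q) := by exact_mod_cast hk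
  have h2 : (q : ℝ) ≤ 2 * Real.sqrt T.maxDegree := by
    have h3 : (Nat.sqrt T.maxDegree : ℝ) ≤ Real.sqrt T.maxDegree := Real.nat_sqrt_le_real_sqrt
    have h4 : (1 : ℝ) ≤ Real.sqrt T.maxDegree := by
      rw [Real.one_le_sqrt]; exact_mod_cast hD
    rw [hqdef]; push_cast; linarith
  calc (toneNumber T t : ℝ) ≤ t * (s * q) := h1
    _ ≤ t * (s * (2 * Real.sqrt T.maxDegree)) := by gcongr
    _ = _ := by ring
end

section
/- Let G be a finite simple k-degenerate graph. Then G has a linear ordering of its vertices such that: (i) each vertex has at most k neighbors preceding it in the ordering, and (ii) for each vertex v and each integer d ≥ 2, at most d·k·Δ(G)·(Δ(G) − 1)^{d−2} vertices preceding v in the ordering lie at distance exactly d from v. -/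
/-- A finite simple graph is `k`-degenerate if every (nonempty induced) subgraph has a
vertex of degree at most `k`. -/
def Degenerate {V : Type*} [Fintype V] (G : SimpleGraph V) [DecidableRel G.Adj]
    (k : ℕ) : Prop :=
  ∀ s : Finset V, s.Nonempty → ∃ v ∈ s, (s.filter (G.Adj v)).card ≤ k

open Classical in
theorem exists_order_aux {V : Type*} [Fintype V] (G : SimpleGraph V) [DecidableRel G.Adj]
    (k : ℕ) (hdeg : Degenerate G k) (n : ℕ) : ∀ s : Finset V, s.card = n →
    ∃ σ : V → ℕ, (∀ v ∈ s, σ v < n) ∧ Set.InjOn σ s ∧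
      ∀ v ∈ s, (s.filter (fun u => G.Adj v u ∧ σ u < σ v)).card ≤ k := by
  induction n with
  | zero =>
    intro s hs
    rw [Finset.card_eq_zero] at hs
    subst hs
    exact ⟨fun _ => 0, by simp, by simp, by simp⟩
  | succ n ih =>
    intro s hs
    obtain ⟨v, hv, hk⟩ := hdeg s (Finset.card_pos.mp (by omega))
    obtain ⟨σ, h1, h2, h3⟩ := ih (s.erase v) (by rw [Finset.card_erase_of_mem hv]; omega)
    have hlt : ∀ w ∈ s, w ≠ v → σ w < n := fun w hw hne => h1 w (Finset.mem_erase.mpr ⟨hne, hw⟩)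
    refine ⟨fun w => if w = v then n else σ w, ?_, ?_, ?_⟩
    · intro w hw
      by_cases hwv : w = v
      · simp [hwv]
      · have := hlt w hw hwv
        simp only [hwv, if_false]; omega
    · intro a ha b hb hab
      by_cases hav : a = v <;> by_cases hbv : b = v
      · rw [hav, hbv]
      · have := hlt b hb hbv
        simp only [hav, hbv, if_true, if_false] at hab; omega
      · have := hlt a ha hav
        simp only [hav, hbv, if_true, if_false] at hab; omega
      · simp only [hav, hbv, if_false] at hab
        exact h2 (by simpa using ⟨ha, hav⟩) (by simpa using ⟨hb, hbv⟩) hab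
    · intro w hw
      by_cases hwv : w = v
      · subst hwv
        refine le_trans (Finset.card_le_card ?_) hk
        intro u hu
        rw [Finset.mem_filter] at hu ⊢
        exact ⟨hu.1, hu.2.1⟩
      · refine le_trans (Finset.card_le_card ?_) (h3 w (Finset.mem_erase.mpr ⟨hwv, hw⟩))
        intro u hu
        rw [Finset.mem_filter] at hu
        obtain ⟨hu1, hu2, hu3⟩ := hu
        have hwn := hlt w hw hwv
        simp only [hwv, if_false] at hu3
        by_cases huv : u = v
        · simp only [huv, if_true] at hu3; omega
        · simp only [huv, if_false] at hu3
          exact Finset.mem_filter.mpr ⟨Finset.mem_erase.mpr ⟨huv, hu1⟩, hu2, hu3⟩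

theorem exists_pred_aux {V : Type*} (G : SimpleGraph V) (v u : V) (j : ℕ)
    (h : G.edist v u = ((j + 1 : ℕ) : ℕ∞)) : ∃ w, G.Adj w u ∧ G.edist v w = (j : ℕ∞) := by
  rw [SimpleGraph.edist_comm] at h
  have hne : G.edist u v ≠ ⊤ := by rw [h]; exact ENat.coe_ne_top _
  obtain ⟨p, hp⟩ := SimpleGraph.exists_walk_of_edist_ne_top hne
  rw [h] at hp
  have hp' : p.length = j + 1 := by exact_mod_cast hp
  cases p with
  | nil => simp at hp'
  | @cons _ w _ ha q =>
    refine ⟨w, ha.symm, ?_⟩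
    rw [SimpleGraph.edist_comm]
    have hq : q.length = j := by simpa using hp'
    have h1 : G.edist w v ≤ (j : ℕ∞) := by
      rw [← hq]; exact SimpleGraph.edist_le q
    obtain ⟨m, hm⟩ := ENat.ne_top_iff_exists.mp (ne_top_of_le_ne_top (ENat.coe_ne_top j) h1)
    have h2 := SimpleGraph.edist_triangle (G := G) (u := u) (v := w) (w := v)
    rw [h, SimpleGraph.edist_eq_one_iff_adj.mpr ha, ← hm] at h2
    rw [← hm] at h1 ⊢
    norm_cast at h1 h2 ⊢
    omega

open Classical in
theorem step_aux {V : Type*} [Fintype V] (G : SimpleGraph V) [DecidableRel G.Adj]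
    (v w : V) (j : ℕ) (h : G.edist v w = ((j + 1 : ℕ) : ℕ∞)) :
    (Finset.univ.filter (fun u => G.Adj w u ∧ G.edist v u = ((j + 2 : ℕ) : ℕ∞))).card
      ≤ G.maxDegree - 1 := by
  obtain ⟨x, hx, hxd⟩ := exists_pred_aux G v w j h
  have hs : (Finset.univ.filter (fun u => G.Adj w u ∧ G.edist v u = ((j + 2 : ℕ) : ℕ∞)))
      ⊆ (G.neighborFinset w).erase x := by
    intro u hu
    simp only [Finset.mem_filter, Finset.mem_univ, true_and] at hu
    rw [Finset.mem_erase, SimpleGraph.mem_neighborFinset]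
    refine ⟨?_, hu.1⟩
    rintro rfl
    have := hxd.symm.trans hu.2
    norm_cast at this
    omega
  have := Finset.card_le_card hs
  rw [Finset.card_erase_of_mem (by simpa using hx.symm), SimpleGraph.card_neighborFinset_eq_degree]
    at this
  have := G.degree_le_maxDegree w
  omega

open Classical in
theorem sphere_aux {V : Type*} [Fintype V] (G : SimpleGraph V) [DecidableRel G.Adj]
    (v : V) (j : ℕ) :
    (Finset.univ.filter (fun u => G.edist v u = ((j + 1 : ℕ) : ℕ∞))).card
      ≤ G.maxDegree * (G.maxDegree - 1) ^ j := by
  induction j with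
  | zero =>
    have : (Finset.univ.filter (fun u => G.edist v u = ((0 + 1 : ℕ) : ℕ∞)))
        = G.neighborFinset v := by
      ext u
      simp
    rw [this, SimpleGraph.card_neighborFinset_eq_degree]
    simpa using G.degree_le_maxDegree v
  | succ j ih =>
    have hs : (Finset.univ.filter (fun u => G.edist v u = ((j + 1 + 1 : ℕ) : ℕ∞))) ⊆
        (Finset.univ.filter (fun u => G.edist v u = ((j + 1 : ℕ) : ℕ∞))).biUnion
          (fun w => Finset.univ.filter
            (fun u => G.Adj w u ∧ G.edist v u = ((j + 2 : ℕ) : ℕ∞))) := by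
      intro u hu
      simp only [Finset.mem_filter, Finset.mem_univ, true_and] at hu
      obtain ⟨w, hw, hd⟩ := exists_pred_aux G v u (j + 1) hu
      rw [Finset.mem_biUnion]
      exact ⟨w, by simpa using hd, Finset.mem_filter.mpr ⟨Finset.mem_univ _, hw, hu⟩⟩
    refine (Finset.card_le_card hs).trans ?_
    refine (Finset.card_biUnion_le_card_mul _ _ (G.maxDegree - 1) ?_).trans ?_
    · intro w hw
      exact step_aux G v w j (by simpa using hw)
    · rw [pow_succ, ← mul_assoc]
      exact Nat.mul_le_mul_right _ ih

open Classical in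
theorem down_step_aux {V : Type*} [Fintype V] (G : SimpleGraph V) [DecidableRel G.Adj]
    (k : ℕ) (σ : V → ℕ)
    (hσ : ∀ v : V, (Finset.univ.filter (fun u => G.Adj v u ∧ σ u < σ v)).card ≤ k)
    (v : V) (j : ℕ) :
    (Finset.univ.filter (fun u => G.edist v u = ((j + 2 : ℕ) : ℕ∞) ∧ σ u < σ v)).card ≤
      (Finset.univ.filter (fun u => G.edist v u = ((j + 1 : ℕ) : ℕ∞) ∧ σ u < σ v)).card
        * (G.maxDegree - 1) + G.maxDegree * (G.maxDegree - 1) ^ j * k := by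
  have hs : (Finset.univ.filter (fun u => G.edist v u = ((j + 2 : ℕ) : ℕ∞) ∧ σ u < σ v)) ⊆
      ((Finset.univ.filter (fun u => G.edist v u = ((j + 1 : ℕ) : ℕ∞) ∧ σ u < σ v)).biUnion
        (fun w => Finset.univ.filter
          (fun u => G.Adj w u ∧ G.edist v u = ((j + 2 : ℕ) : ℕ∞)))) ∪
      ((Finset.univ.filter (fun u => G.edist v u = ((j + 1 : ℕ) : ℕ∞))).biUnion
        (fun w => Finset.univ.filter (fun u => G.Adj w u ∧ σ u < σ w))) := by
    intro u hu
    obtain ⟨hu1, hu2⟩ := (Finset.mem_filter.mp hu).2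
    obtain ⟨w, hw, hd⟩ := exists_pred_aux G v u (j + 1) hu1
    rw [Finset.mem_union, Finset.mem_biUnion, Finset.mem_biUnion]
    by_cases hwv : σ w < σ v
    · left
      exact ⟨w, Finset.mem_filter.mpr ⟨Finset.mem_univ _, hd, hwv⟩,
        Finset.mem_filter.mpr ⟨Finset.mem_univ _, hw, hu1⟩⟩
    · right
      exact ⟨w, Finset.mem_filter.mpr ⟨Finset.mem_univ _, hd⟩,
        Finset.mem_filter.mpr ⟨Finset.mem_univ _, hw, by omega⟩⟩
  refine (Finset.card_le_card hs).trans ((Finset.card_union_le _ _).trans (add_le_add ?_ ?_))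
  · refine Finset.card_biUnion_le_card_mul _ _ _ ?_
    intro w hw
    exact step_aux G v w j (Finset.mem_filter.mp hw).2.1
  · refine (Finset.card_biUnion_le_card_mul _ _ k fun w _ => hσ w).trans ?_
    exact Nat.mul_le_mul_right _ (sphere_aux G v j)

open Classical in
theorem down_aux {V : Type*} [Fintype V] (G : SimpleGraph V) [DecidableRel G.Adj]
    (k : ℕ) (σ : V → ℕ)
    (hσ : ∀ v : V, (Finset.univ.filter (fun u => G.Adj v u ∧ σ u < σ v)).card ≤ k)
    (v : V) (j : ℕ) :
    (Finset.univ.filter (fun u => G.edist v u = ((j + 2 : ℕ) : ℕ∞) ∧ σ u < σ v)).card ≤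
      (j + 2) * k * G.maxDegree * (G.maxDegree - 1) ^ j := by
  induction j with
  | zero =>
    refine (down_step_aux G k σ hσ v 0).trans ?_
    have h1 : (Finset.univ.filter
        (fun u => G.edist v u = ((0 + 1 : ℕ) : ℕ∞) ∧ σ u < σ v)).card ≤ k := by
      refine le_trans (Finset.card_le_card ?_) (hσ v)
      intro u hu
      simpa using hu
    have h2 := Nat.mul_le_mul h1 (Nat.sub_le G.maxDegree 1)
    refine (Nat.add_le_add_right h2 _).trans (le_of_eq ?_)
    ring
  | succ j ih =>
    refine (down_step_aux G k σ hσ v (j + 1)).trans ?_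
    refine (Nat.add_le_add_right (Nat.mul_le_mul_right _ ih) _).trans (le_of_eq ?_)
    ring

theorem degenerate_ordering_few_earlier_vertices_at_distance
    {V : Type*} [Fintype V] (G : SimpleGraph V) [DecidableRel G.Adj]
    (k : ℕ) (hdeg : Degenerate G k) :
    ∃ σ : V → ℕ, Function.Injective σ ∧
      (∀ v : V, {u : V | G.Adj v u ∧ σ u < σ v}.ncard ≤ k) ∧
      ∀ (v : V) (d : ℕ), 2 ≤ d →
        {u : V | G.edist v u = d ∧ σ u < σ v}.ncard ≤
          d * k * G.maxDegree * (G.maxDegree - 1) ^ (d - 2) := by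
  classical
  obtain ⟨σ, -, h2, h3⟩ := exists_order_aux G k hdeg _ Finset.univ rfl
  have hσ : ∀ v : V, (Finset.univ.filter (fun u => G.Adj v u ∧ σ u < σ v)).card ≤ k := by
    intro v
    convert h3 v (Finset.mem_univ v)
  refine ⟨σ, fun a b hab => h2 (by simp) (by simp) hab, ?_, ?_⟩
  · intro v
    rw [Set.ncard_eq_toFinset_card']
    refine le_trans (Finset.card_le_card ?_) (hσ v)
    intro u hu
    simpa using hu
  · intro v d hd
    obtain ⟨j, rfl⟩ := Nat.exists_eq_add_of_le' hd
    have hh := down_aux G k σ (by intro v; convert hσ v) v j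
    rw [Set.ncard_eq_toFinset_card']
    refine le_trans (Finset.card_le_card ?_) hh
    intro u hu
    simpa using hu
end

section
/- Let k ≥ 2 and t be positive integers and let G be a finite simple k-degenerate graph with maximum degree Δ(G) ≤ r. Then τ_t(G) ≤ k·t + k·t²·r^{1 − 1/t} (an inequality of real numbers, with the real power r^{1−1/t}). -/
lemma aux_order {V : Type*} [Fintype V] [DecidableEq V] (G : SimpleGraph V) [DecidableRel G.Adj]
    (k : ℕ) (hdeg : Degenerate G k) (n : ℕ) : ∀ s : Finset V, s.card = n →
    ∃ ρ : V → ℕ, Set.InjOn ρ s ∧ (∀ v ∈ s, ρ v < n) ∧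
      ∀ v ∈ s, (s.filter (fun u => G.Adj v u ∧ ρ u < ρ v)).card ≤ k := by
  induction n with
  | zero =>
    intro s hs
    rw [Finset.card_eq_zero] at hs
    subst hs
    exact ⟨fun _ => 0, by simp, by simp, by simp⟩
  | succ n ih =>
    intro s hs
    have hne : s.Nonempty := by rw [← Finset.card_pos]; omega
    obtain ⟨v, hv, hvk⟩ := hdeg s hne
    obtain ⟨ρ, h1, h2, h3⟩ := ih (s.erase v) (by rw [Finset.card_erase_of_mem hv]; omega)
    have hval : ∀ x ∈ s, x ≠ v → ρ x < n := fun x hx hxv => h2 x (by simp [hx, hxv])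
    refine ⟨fun x => if x = v then n else ρ x, ?_, ?_, ?_⟩
    · intro x hx y hy hxy
      simp only at hxy
      by_cases hxv : x = v <;> by_cases hyv : y = v
      · rw [hxv, hyv]
      · have := hval y hy hyv
        simp [hxv, hyv] at hxy; omega
      · have := hval x hx hxv
        simp [hxv, hyv] at hxy; omega
      · simp only [hxv, hyv, if_false] at hxy
        exact h1 (by simpa [hxv] using hx) (by simpa [hyv] using hy) hxy
    · intro x hx
      by_cases hxv : x = v
      · simp [hxv]
      · have := hval x hx hxv
        simp [hxv]; omega
    · intro x hx
      by_cases hxv : x = v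
      · subst hxv
        refine le_trans (Finset.card_le_card ?_) hvk
        intro u hu
        simp only [Finset.mem_filter] at hu ⊢
        exact ⟨hu.1, hu.2.1⟩
      · refine le_trans (Finset.card_le_card ?_) (h3 x (by simp [hx, hxv]))
        intro u hu
        simp only [Finset.mem_filter, Finset.mem_erase, hxv, if_false] at hu ⊢
        have hn := hval x hx hxv
        by_cases huv : u = v
        · simp [huv] at hu; omega
        · simp only [huv, if_false] at hu
          exact ⟨⟨huv, hu.1⟩, hu.2⟩

section walks
variable {V : Type*} [Fintype V] [DecidableEq V] (G : SimpleGraph V) [DecidableRel G.Adj]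

def reachS : ℕ → V → Finset V
  | 0, x => {x}
  | n+1, x => (Finset.univ.filter (G.Adj x)).biUnion (reachS n)

def backS (ρ : V → ℕ) : ℕ → V → Finset V
  | 0, _ => ∅
  | n+1, x => (Finset.univ.filter (fun u => G.Adj x u ∧ ρ u < ρ x)).biUnion (reachS G n) ∪
      (Finset.univ.filter (G.Adj x)).biUnion (backS ρ n)

lemma reachS_card (r : ℕ) (hr : ∀ x, (Finset.univ.filter (G.Adj x)).card ≤ r) (n : ℕ) :
    ∀ x, (reachS G n x).card ≤ r ^ n := by
  induction n with
  | zero => intro x; simp [reachS]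
  | succ n ih =>
    intro x
    rw [reachS, pow_succ']
    exact (Finset.card_biUnion_le_card_mul _ _ _ (fun y _ => ih y)).trans
      (Nat.mul_le_mul_right _ (hr x))

lemma backS_card (ρ : V → ℕ) (k r : ℕ) (hr : ∀ x, (Finset.univ.filter (G.Adj x)).card ≤ r)
    (hk : ∀ x, (Finset.univ.filter (fun u => G.Adj x u ∧ ρ u < ρ x)).card ≤ k) (n : ℕ) :
    ∀ x, (backS G ρ n x).card ≤ n * k * r ^ (n - 1) := by
  induction n with
  | zero => intro x; simp [backS]
  | succ n ih =>
    intro x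
    rw [backS]
    refine (Finset.card_union_le _ _).trans ?_
    have h1 := (Finset.card_biUnion_le_card_mul _ _ _
      (fun y (_ : y ∈ (Finset.univ.filter (fun u => G.Adj x u ∧ ρ u < ρ x))) =>
        reachS_card G r hr n y)).trans (Nat.mul_le_mul_right _ (hk x))
    have h2 := (Finset.card_biUnion_le_card_mul _ _ _
      (fun y (_ : y ∈ (Finset.univ.filter (G.Adj x))) =>
        ih y)).trans (Nat.mul_le_mul_right _ (hr x))
    refine (add_le_add h1 h2).trans (le_of_eq ?_)
    rcases n with _ | n
    · simp
    · simp only [Nat.add_sub_cancel]; ring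

lemma mem_reachS {x w : V} (p : G.Walk x w) : w ∈ reachS G p.length x := by
  induction p with
  | nil => simp [reachS]
  | cons h p ih =>
    simp only [SimpleGraph.Walk.length_cons, reachS, Finset.mem_biUnion, Finset.mem_filter]
    exact ⟨_, ⟨Finset.mem_univ _, h⟩, ih⟩

lemma mem_backS (ρ : V → ℕ) {x w : V} (p : G.Walk x w) :
    w ∈ backS G ρ p.length x ∨ ρ x ≤ ρ w := by
  induction p with
  | nil => simp
  | @cons u v w h p ih =>
    simp only [SimpleGraph.Walk.length_cons, backS, Finset.mem_union, Finset.mem_biUnion,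
      Finset.mem_filter]
    by_cases hb : ρ v < ρ u
    · exact Or.inl (Or.inl ⟨v, ⟨Finset.mem_univ _, h, hb⟩, mem_reachS G p⟩)
    · rcases ih with ih | ih
      · exact Or.inl (Or.inr ⟨v, ⟨Finset.mem_univ _, h⟩, ih⟩)
      · right; omega
end walks

lemma aux_sub {α : Type*} [DecidableEq α] (C S : Finset α) (t d : ℕ) (hS : S.card = d) :
    ((C.powersetCard t).filter (fun T => S ⊆ T)).card ≤ (C.card - d).choose (t - d) := by
  by_cases hSC : S ⊆ C
  · rw [← hS, ← Finset.card_sdiff_of_subset hSC, ← Finset.card_powersetCard]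
    apply Finset.card_le_card_of_injOn (fun T => T \ S)
    · intro T hT
      simp only [Finset.coe_filter, Finset.mem_powersetCard, Set.mem_ofPred_eq] at hT
      simp only [Finset.mem_coe, Finset.mem_powersetCard]
      have : T \ S ⊆ C \ S ∧ (T \ S).card = t - S.card :=
        ⟨Finset.sdiff_subset_sdiff hT.1.1 le_rfl, by
          rw [Finset.card_sdiff_of_subset hT.2, hT.1.2]⟩
      simpa using this
    · intro T hT T' hT' h
      simp only [Finset.coe_filter, Finset.mem_powersetCard, Set.mem_ofPred_eq] at hT hT'
      simp only at h
      rw [← Finset.sdiff_union_of_subset hT.2, h, Finset.sdiff_union_of_subset hT'.2]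
  · rw [Finset.filter_false_of_mem]
    · simp
    · intro T hT h
      exact hSC (h.trans (Finset.mem_powersetCard.1 hT).1)

lemma aux_bad {α : Type*} [DecidableEq α] (C F : Finset α) (t d : ℕ) :
    ((C.powersetCard t).filter (fun T => d ≤ (T ∩ F).card)).card ≤
      F.card.choose d * (C.card - d).choose (t - d) := by
  rw [← Finset.card_powersetCard]
  refine le_trans (Finset.card_le_card ?_) (Finset.card_biUnion_le_card_mul (F.powersetCard d)
    (fun S => (C.powersetCard t).filter (fun T => S ⊆ T)) _
    (fun S hS => aux_sub C S t d (Finset.mem_powersetCard.1 hS).2))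
  intro T hT
  rw [Finset.mem_filter] at hT
  obtain ⟨S, hS, hSd⟩ := Finset.exists_subset_card_eq hT.2
  rw [Finset.mem_biUnion]
  exact ⟨S, Finset.mem_powersetCard.2 ⟨hS.trans Finset.inter_subset_right, hSd⟩,
    Finset.mem_filter.2 ⟨hT.1, hS.trans Finset.inter_subset_left⟩⟩

lemma aux_desc (t a : ℕ) (A : ℝ) (hA8 : 8 ≤ A) (hAt : 2 * t ≤ A) (ha : A - 1 ≤ a)
    (d : ℕ) (hd : d + 1 ≤ t) :
    (t.descFactorial (d+1) : ℝ) * A ^ (d+1) ≤ 8 / 7 * t ^ (d+1) * a.descFactorial (d+1) := by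
  induction d with
  | zero =>
    simp only [zero_add, Nat.descFactorial_one, pow_one]
    have : (0:ℝ) ≤ t := by positivity
    nlinarith
  | succ d ih =>
    have ih := ih (by omega)
    have hdt : ((d+1 : ℕ):ℝ) + 1 ≤ t := by exact_mod_cast hd
    have hda : d + 1 ≤ a := by
      have : ((d+1 : ℕ):ℝ) ≤ a := by
        have : (0:ℝ) ≤ (d+1:ℕ) := by positivity
        linarith
      exact_mod_cast this
    rw [Nat.descFactorial_succ t, Nat.descFactorial_succ a, pow_succ A, pow_succ (t:ℝ)]
    push_cast [Nat.cast_sub (show d+1 ≤ t by omega), Nat.cast_sub hda]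
    push_cast at hdt
    have hd0 : (0:ℝ) ≤ d := by positivity
    have key : ((t:ℝ) - (d+1)) * A ≤ t * (a - (d+1)) := by
      have h1 : (t:ℝ) * (A - 1) ≤ t * a := by gcongr
      have h2 : ((d:ℝ)+1) * (2 * t) ≤ (d+1) * A := by gcongr
      nlinarith
    have k0 : 0 ≤ ((t:ℝ) - (d+1)) * A := mul_nonneg (by linarith) (by linarith)
    calc _ = ((t.descFactorial (d+1) : ℝ) * A ^ (d+1)) * (((t:ℝ) - (d+1)) * A) := by ring
      _ ≤ (8 / 7 * t ^ (d+1) * a.descFactorial (d+1)) * (t * (a - (d+1))) := by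
        apply mul_le_mul ih key k0 (by positivity)
      _ = _ := by ring

lemma aux_term (k t r a : ℕ) (hk : 2 ≤ k) (ht : 2 ≤ t) (hr : 1 ≤ r)
    (ha : (k * t ^ 2 * (r : ℝ) ^ ((1 : ℝ) - 1 / (t : ℝ))) - 1 ≤ a) (e : ℕ) (he : e + 2 ≤ t) :
    (((e+2) * k * r ^ (e+1) * (t.choose (e+2) * (a - (e+2)).choose (t - (e+2))) : ℕ) : ℝ)
      ≤ 4 / 7 * (1/4) ^ e * a.choose t := by
  set R := (r : ℝ) ^ ((1 : ℝ) - 1 / (t : ℝ)) with hR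
  set A := (k * t ^ 2 * R : ℝ) with hA
  have hr' : (1:ℝ) ≤ r := by exact_mod_cast hr
  have hk' : (2:ℝ) ≤ k := by exact_mod_cast hk
  have ht' : (2:ℝ) ≤ t := by exact_mod_cast ht
  have hti : 1 / (t:ℝ) ≤ 1 := by rw [div_le_one (by linarith)]; linarith
  have hR1 : 1 ≤ R := Real.one_le_rpow hr' (by linarith)
  have hAt : 2 * t * t ≤ A := by
    have : (2:ℝ) * t^2 * 1 ≤ k * t^2 * R := by gcongr
    nlinarith
  have hA8 : 8 ≤ A := by nlinarith
  have hAt2 : 2 * t ≤ A := by nlinarith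
  have hdesc := aux_desc t a A hA8 hAt2 ha (e+1) he
  simp only [show e + 1 + 1 = e + 2 by ring] at hdesc
  have hta : t ≤ a := by
    have : (t:ℝ) ≤ a := by linarith
    exact_mod_cast this
  have hRd : (r:ℝ) ^ (e+1) ≤ R ^ (e+2) := by
    rw [hR, ← Real.rpow_natCast, ← Real.rpow_natCast, ← Real.rpow_mul (by linarith)]
    apply Real.rpow_le_rpow_of_exponent_le hr'
    have : ((e:ℝ)+2) * (1/t) ≤ 1 := by
      rw [mul_one_div, div_le_one (by linarith)]; exact_mod_cast he
    push_cast
    nlinarith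
  -- choose identity
  have hch : a.choose t * t.choose (e+2) = a.choose (e+2) * (a - (e+2)).choose (t - (e+2)) :=
    Nat.choose_mul he
  have hid : (a - (e+2)).choose (t - (e+2)) * a.descFactorial (e+2)
      = a.choose t * t.descFactorial (e+2) := by
    rw [Nat.descFactorial_eq_factorial_mul_choose, Nat.descFactorial_eq_factorial_mul_choose]
    calc _ = (e+2).factorial * (a.choose (e+2) * (a - (e+2)).choose (t - (e+2))) := by ring
      _ = _ := by rw [← hch]; ring
  have hidR : ((a - (e+2)).choose (t - (e+2)) : ℝ) * a.descFactorial (e+2)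
      = a.choose t * t.descFactorial (e+2) := by exact_mod_cast hid
  set X := ((a - (e+2)).choose (t - (e+2)) : ℝ) with hX
  set Y := (a.choose t : ℝ) with hY
  have hDpos : (0:ℝ) < a.descFactorial (e+2) := by
    exact_mod_cast Nat.descFactorial_pos.2 (by omega)
  have hX0 : 0 ≤ X := by positivity
  have hY0 : 0 ≤ Y := by positivity
  have h1 : X * A ^ (e+2) ≤ 8 / 7 * t ^ (e+2) * Y := by
    refine le_of_mul_le_mul_right ?_ hDpos
    calc X * A ^ (e+2) * a.descFactorial (e+2)
        = (X * a.descFactorial (e+2)) * A ^ (e+2) := by ring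
      _ = Y * (t.descFactorial (e+2) * A ^ (e+2)) := by rw [hidR]; ring
      _ ≤ Y * (8 / 7 * t ^ (e+2) * a.descFactorial (e+2)) := by gcongr
      _ = _ := by ring
  -- factorial bound
  have hf : (e+2) * 2 ^ e ≤ (e+2).factorial := by
    rw [Nat.factorial_succ (e+1)]
    have := Nat.pow_sub_le_descFactorial
    have h : 2 ^ e ≤ (e+1).factorial := by
      clear * -
      induction e with
      | zero => simp
      | succ n ih => rw [Nat.factorial_succ, pow_succ']; exact Nat.mul_le_mul (by omega) ih
    exact Nat.mul_le_mul_left _ h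
  have hc : (e+2) * 2 ^ e * t.choose (e+2) ≤ t ^ (e+2) := by
    refine (Nat.mul_le_mul_right _ hf).trans ?_
    rw [← Nat.descFactorial_eq_factorial_mul_choose]
    exact Nat.descFactorial_le_pow _ _
  have hcR : ((e:ℝ)+2) * 2 ^ e * t.choose (e+2) ≤ t ^ (e+2) := by exact_mod_cast hc
  have hk2 : (2:ℝ) ^ (e+1) ≤ k ^ (e+1) := by gcongr
  have hTpos : (0:ℝ) < (t:ℝ) ^ (e+2) := by positivity
  set c := (t.choose (e+2) : ℝ) with hcdef
  have hfin : ((e:ℝ)+2) * k * r ^ (e+1) * (c * X) * (2 * 4 ^ e) ≤ 8 / 7 * Y := by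
    refine le_of_mul_le_mul_right ?_ hTpos
    calc ((e:ℝ)+2) * k * r ^ (e+1) * (c * X) * (2 * 4 ^ e) * t ^ (e+2)
        = (((e:ℝ)+2) * 2 ^ e * c) * (k * 2 ^ (e+1)) * r ^ (e+1) * X * t ^ (e+2) := by
          rw [show (4:ℝ) = 2 * 2 by norm_num, mul_pow]; ring
      _ ≤ (t ^ (e+2)) * (k * k ^ (e+1)) * R ^ (e+2) * X * t ^ (e+2) := by gcongr
      _ = X * A ^ (e+2) := by rw [hA]; ring
      _ ≤ 8 / 7 * t ^ (e+2) * Y := h1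
      _ = _ := by ring
  push_cast
  have h4 : (0:ℝ) < 2 * 4 ^ e := by positivity
  refine le_of_mul_le_mul_right (hfin.trans (le_of_eq ?_)) h4
  have : ((1:ℝ)/4) ^ e * 4 ^ e = 1 := by rw [← mul_pow]; norm_num
  calc 8 / 7 * Y = 8 / 7 * Y * (((1:ℝ)/4) ^ e * 4 ^ e) := by rw [this, mul_one]
    _ = _ := by ring

lemma aux_sum (k t r a : ℕ) (hk : 2 ≤ k) (ht : 0 < t) (hr : 1 ≤ r)
    (ha : (k * t ^ 2 * (r : ℝ) ^ ((1 : ℝ) - 1 / (t : ℝ))) - 1 ≤ a) :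
    ∑ e ∈ Finset.range (t - 1),
      ((e+2) * k * r ^ (e+1) * (t.choose (e+2) * (a - (e+2)).choose (t - (e+2)))) < a.choose t := by
  have hr' : (1:ℝ) ≤ r := by exact_mod_cast hr
  have hk' : (2:ℝ) ≤ k := by exact_mod_cast hk
  have ht' : (1:ℝ) ≤ t := by exact_mod_cast ht
  have hti : 1 / (t:ℝ) ≤ 1 := by rw [div_le_one (by linarith)]; linarith
  have hR1 : 1 ≤ (r : ℝ) ^ ((1 : ℝ) - 1 / (t : ℝ)) := Real.one_le_rpow hr' (by linarith)
  have hta : t ≤ a := by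
    have : (2:ℝ) * t^2 * 1 ≤ k * t^2 * (r : ℝ) ^ ((1 : ℝ) - 1 / (t : ℝ)) := by gcongr
    have : (t:ℝ) ≤ a := by nlinarith
    exact_mod_cast this
  have hpos : (0:ℝ) < a.choose t := by exact_mod_cast Nat.choose_pos hta
  rw [← Nat.cast_lt (α := ℝ), Nat.cast_sum]
  refine lt_of_le_of_lt (Finset.sum_le_sum (fun e he => aux_term k t r a hk
    (by have := Finset.mem_range.1 he; omega) hr ha e
    (by have := Finset.mem_range.1 he; omega))) ?_
  rw [← Finset.sum_mul, ← Finset.mul_sum]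
  have hg : ∑ e ∈ Finset.range (t-1), ((1:ℝ)/4)^e ≤ 4/3 := by
    rw [geom_sum_eq (by norm_num)]
    have : (0:ℝ) < (1/4)^(t-1) := by positivity
    rw [div_le_iff_of_neg (by norm_num)]
    linarith
  nlinarith

lemma aux_extend {V : Type*} [Fintype V] [DecidableEq V] (G : SimpleGraph V) [DecidableRel G.Adj]
    (ρ : V → ℕ) (k t r m : ℕ) (hk2 : 2 ≤ k) (ht : 0 < t) (hr1 : 1 ≤ r)
    (hr : ∀ x, (Finset.univ.filter (G.Adj x)).card ≤ r)
    (hk : ∀ x, (Finset.univ.filter (fun u => G.Adj x u ∧ ρ u < ρ x)).card ≤ k)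
    (hm : (k * t ^ 2 * (r : ℝ) ^ ((1 : ℝ) - 1 / (t : ℝ))) - 1 ≤ m)
    (v : V) (f : V → Finset ℕ) (hf : ∀ w, ρ w < ρ v → (f w).card = t) :
    ∃ T : Finset ℕ, T.card = t ∧ T ⊆ Finset.Icc 1 (k * t + m) ∧
      ∀ w, ρ w < ρ v → ((T ∩ f w).card : ℕ∞) < G.edist v w := by
  set N := Finset.univ.filter (fun u => G.Adj v u ∧ ρ u < ρ v) with hN
  set C := Finset.Icc 1 (k * t + m) \ N.biUnion f with hC
  have hNc : (N.biUnion f).card ≤ k * t :=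
    (Finset.card_biUnion_le_card_mul _ _ t (fun w hw => (hf w (by
      simp only [hN, Finset.mem_filter] at hw; exact hw.2.2)).le)).trans
      (Nat.mul_le_mul_right _ (hk v))
  have hCm : m ≤ C.card := by
    have := Finset.le_card_sdiff (N.biUnion f) (Finset.Icc 1 (k * t + m))
    rw [Nat.card_Icc, ← hC] at this
    omega
  have hsum := aux_sum k t r C.card hk2 ht hr1 (hm.trans (by exact_mod_cast hCm))
  set Bad := (Finset.range (t-1)).biUnion (fun e =>
    (Finset.univ.filter (fun w => ρ w < ρ v ∧ G.edist v w = ((e+2 : ℕ) : ℕ∞))).biUnion (fun w =>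
      (C.powersetCard t).filter (fun T => e + 2 ≤ (T ∩ f w).card))) with hBad
  have hBc : Bad.card < (C.powersetCard t).card := by
    rw [Finset.card_powersetCard]
    refine lt_of_le_of_lt (Finset.card_biUnion_le.trans (Finset.sum_le_sum (fun e _ => ?_))) hsum
    refine (Finset.card_biUnion_le_card_mul _ _
      (t.choose (e+2) * (C.card - (e+2)).choose (t - (e+2))) (fun w hw => ?_)).trans
      (Nat.mul_le_mul_right _ ?_)
    · simp only [Finset.mem_filter] at hw
      have := aux_bad C (f w) t (e+2)
      rwa [hf w hw.2.1] at this
    · refine (Finset.card_le_card ?_).trans (backS_card G ρ k r hr hk (e+2) v)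
      intro w hw
      simp only [Finset.mem_filter] at hw
      obtain ⟨-, hw1, hw2⟩ := hw
      have hre : G.Reachable v w := by
        rw [← SimpleGraph.edist_ne_top_iff_reachable, hw2]
        exact ENat.natCast_ne_top _
      obtain ⟨p, hp⟩ := hre.exists_walk_length_eq_edist
      rw [hw2] at hp
      have hp' : p.length = e + 2 := by exact_mod_cast hp
      rcases mem_backS G ρ p with h | h
      · rwa [hp'] at h
      · omega
  obtain ⟨T, hT, hTB⟩ := Finset.exists_mem_notMem_of_card_lt_card hBc
  rw [Finset.mem_powersetCard] at hT
  refine ⟨T, hT.2, hT.1.trans Finset.sdiff_subset, fun w hw => ?_⟩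
  by_contra hcon
  rw [not_lt] at hcon
  obtain ⟨d, hd⟩ := ENat.ne_top_iff_exists.1 (ne_top_of_le_ne_top (ENat.natCast_ne_top _) hcon)
  rw [← hd] at hcon
  have hcon' : d ≤ (T ∩ f w).card := by exact_mod_cast hcon
  have hdt : d ≤ t := hcon'.trans ((Finset.card_le_card Finset.inter_subset_left).trans hT.2.le)
  rcases d with _ | _ | e
  · have : v = w := by
      rw [← SimpleGraph.edist_eq_zero_iff (G := G), ← hd]; rfl
    subst this; omega
  · have hadj : G.Adj v w := by
      rw [← SimpleGraph.edist_eq_one_iff_adj, ← hd]; rfl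
    have hpos : 0 < (T ∩ f w).card := by omega
    obtain ⟨c, hc⟩ := Finset.card_pos.1 hpos
    rw [Finset.mem_inter] at hc
    have := hT.1 hc.1
    rw [hC, Finset.mem_sdiff, Finset.mem_biUnion] at this
    exact this.2 ⟨w, by simp [hN, hadj, hw], hc.2⟩
  · apply hTB
    simp only [hBad, Finset.mem_biUnion, Finset.mem_filter, Finset.mem_range,
      Finset.mem_powersetCard]
    exact ⟨e, by omega, w, ⟨Finset.mem_univ _, hw, hd.symm⟩, hT, hcon'⟩

theorem toneNumber_le_of_degenerate
    {V : Type*} [Fintype V] (G : SimpleGraph V) [DecidableRel G.Adj]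
    (k t r : ℕ) (hk : 2 ≤ k) (ht : 0 < t)
    (hdeg : Degenerate G k) (hΔ : G.maxDegree ≤ r) :
    (toneNumber G t : ℝ) ≤
      k * t + k * t ^ 2 * (r : ℝ) ^ ((1 : ℝ) - 1 / (t : ℝ)) := by
  classical
  have hr : ∀ x, (Finset.univ.filter (G.Adj x)).card ≤ r := by
    intro x
    have := (G.degree_le_maxDegree x).trans hΔ
    rwa [← SimpleGraph.card_neighborFinset_eq_degree, SimpleGraph.neighborFinset_eq_filter] at this
  rcases Nat.eq_zero_or_pos r with hr0 | hr1
  · have h1 : toneNumber G t ≤ t := by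
      apply Nat.sInf_le
      refine ⟨fun _ => Finset.Icc 1 t, fun v => ⟨by simp, le_rfl⟩, fun u v huv => ?_⟩
      have : G.edist u v = ⊤ := by
        by_contra h
        rw [← ne_eq, SimpleGraph.edist_ne_top_iff_reachable] at h
        obtain ⟨p⟩ := h
        cases p with
        | nil => exact huv rfl
        | cons h p =>
          have := hr u
          rw [hr0, Nat.le_zero, Finset.card_eq_zero] at this
          exact absurd (Finset.mem_filter.2 ⟨Finset.mem_univ _, h⟩) (by rw [this]; simp)
      rw [this]
      exact ENat.coe_lt_top _
    have h2 : (toneNumber G t : ℝ) ≤ t := by exact_mod_cast h1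
    have hk' : (2:ℝ) ≤ k := by exact_mod_cast hk
    have h3 : (0:ℝ) ≤ k * t ^ 2 * (r : ℝ) ^ ((1 : ℝ) - 1 / (t : ℝ)) := by positivity
    have h4 : (0:ℝ) ≤ t := by positivity
    nlinarith
  · obtain ⟨ρ, hinj, -, hback⟩ := aux_order G k hdeg _ Finset.univ rfl
    have hinj' : Function.Injective ρ := fun x y h => hinj (by simp) (by simp) h
    set A := (k * t ^ 2 * (r : ℝ) ^ ((1 : ℝ) - 1 / (t : ℝ))) with hA
    have hA0 : 0 ≤ A := by positivity
    set m := ⌊A⌋₊ with hm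
    have hmA : A - 1 ≤ m := by
      have := Nat.lt_floor_add_one A
      linarith
    have key : ∀ n : ℕ, ∃ f : V → Finset ℕ,
        (∀ v, ρ v < n → (f v).card = t ∧ f v ⊆ Finset.Icc 1 (k * t + m)) ∧
        ∀ u v, ρ v < n → ρ u < ρ v → ((f v ∩ f u).card : ℕ∞) < G.edist v u := by
      intro n
      induction n with
      | zero => exact ⟨fun _ => ∅, by simp, by simp⟩
      | succ n ih =>
        obtain ⟨f, hf1, hf2⟩ := ih
        by_cases hv : ∃ v, ρ v = n
        · obtain ⟨v, hv⟩ := hv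
          obtain ⟨T, hT1, hT2, hT3⟩ := aux_extend G ρ k t r m hk ht hr1 hr
            (fun x => hback x (Finset.mem_univ _)) hmA v f (fun w hw => (hf1 w (by omega)).1)
          have hlt : ∀ w, w ≠ v → ρ w < n + 1 → ρ w < n := by
            intro w hw h
            have : ρ w ≠ ρ v := fun h => hw (hinj' h)
            omega
          refine ⟨Function.update f v T, ?_, ?_⟩
          · intro w hw
            by_cases hwv : w = v
            · subst hwv; simp only [Function.update_self]; exact ⟨hT1, hT2⟩
            · rw [Function.update_of_ne hwv]; exact hf1 w (hlt w hwv hw)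
          · intro u w hw huw
            have huv : u ≠ v := by rintro rfl; omega
            rw [Function.update_of_ne huv]
            by_cases hwv : w = v
            · subst hwv; simp only [Function.update_self]; exact hT3 u huw
            · rw [Function.update_of_ne hwv]; exact hf2 u w (hlt w hwv hw) huw
        · push Not at hv
          exact ⟨f, fun v h => hf1 v (by have := hv v; omega),
            fun u v h => hf2 u v (by have := hv v; omega)⟩
    obtain ⟨f, hf1, hf2⟩ := key (Finset.univ.sup ρ + 1)
    have hall : ∀ v, ρ v < Finset.univ.sup ρ + 1 := fun v =>
      Nat.lt_succ_of_le (Finset.le_sup (Finset.mem_univ v))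
    have h1 : toneNumber G t ≤ k * t + m := by
      apply Nat.sInf_le
      refine ⟨f, fun v => hf1 v (hall v), fun u v huv => ?_⟩
      rcases lt_or_gt_of_ne (fun h => huv (hinj' h)) with h | h
      · rw [Finset.inter_comm, SimpleGraph.edist_comm]; exact hf2 u v (hall v) h
      · exact hf2 v u (hall u) h
    have h2 : (toneNumber G t : ℝ) ≤ k * t + m := by exact_mod_cast h1
    have h3 : (m:ℝ) ≤ A := Nat.floor_le hA0
    linarith
end

section
/- For each integer r ≥ 3 there exists a constant c > 0 such that for every integer t ≥ 2 there is a finite simple graph G with maximum degree Δ(G) = r and τ_t(G) ≥ c·t² / log₂ t. -/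
def heapGraph (q n : ℕ) : SimpleGraph (Fin n) where
  Adj i j := i ≠ j ∧ (i.val = (j.val - 1) / q ∨ j.val = (i.val - 1) / q)
  symm := ⟨fun _ _ h => ⟨h.1.symm, h.2.symm⟩⟩
  loopless := ⟨fun _ h => h.1 rfl⟩

instance (q n : ℕ) : DecidableRel (heapGraph q n).Adj := fun i j =>
  inferInstanceAs (Decidable (i ≠ j ∧ (i.val = (j.val - 1) / q ∨ j.val = (i.val - 1) / q)))

theorem heap_parent (q a b : ℕ) (hq : 2 ≤ q) (h : a = (b - 1) / q) (hab : a ≠ b) :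
    q * a + 1 ≤ b ∧ b ≤ q * a + q := by
  have h1 := Nat.div_add_mod (b - 1) q
  have h2 := Nat.mod_lt (b - 1) (show 0 < q by omega)
  rw [← h] at h1
  have hb : b ≠ 0 := by
    rintro rfl
    simp at h
    exact hab h
  omega

theorem heap_maxDegree (q n : ℕ) (hq : 2 ≤ q) (hn : 2 * q + 1 ≤ n) :
    (heapGraph q n).maxDegree = q + 1 := by
  apply le_antisymm
  · apply SimpleGraph.maxDegree_le_of_forall_degree_le
    intro v
    rw [← SimpleGraph.card_neighborFinset_eq_degree,
      ← Finset.card_map Fin.valEmbedding]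
    have : ((heapGraph q n).neighborFinset v).map Fin.valEmbedding ⊆
        insert ((v.val - 1) / q) (Finset.Icc (q * v.val + 1) (q * v.val + q)) := by
      intro x hx
      simp only [Finset.mem_map, SimpleGraph.mem_neighborFinset] at hx
      obtain ⟨w, hw, rfl⟩ := hx
      obtain ⟨hne, h | h⟩ := hw
      · have := heap_parent q v.val w.val hq h (fun h => hne (Fin.ext h))
        simp only [Finset.mem_insert, Finset.mem_Icc]
        right
        exact this
      · simp only [Finset.mem_insert]
        left
        exact h
    refine (Finset.card_le_card this).trans ((Finset.card_insert_le _ _).trans ?_)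
    simp
  · refine le_trans ?_ ((heapGraph q n).degree_le_maxDegree ⟨1, by omega⟩)
    rw [← SimpleGraph.card_neighborFinset_eq_degree,
      ← Finset.card_map Fin.valEmbedding]
    have : insert 0 (Finset.Icc (q + 1) (q + q)) ⊆
        ((heapGraph q n).neighborFinset ⟨1, by omega⟩).map Fin.valEmbedding := by
      intro x hx
      simp only [Finset.mem_insert, Finset.mem_Icc] at hx
      simp only [Finset.mem_map, SimpleGraph.mem_neighborFinset]
      refine ⟨⟨x, by omega⟩, ⟨?_, ?_⟩, rfl⟩
      · intro h
        have := congrArg Fin.val h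
        simp at this
        omega
      · rcases hx with rfl | hx
        · right; simp
        · left
          symm
          show (x - 1) / q = 1
          rw [Nat.div_eq_iff (by omega)]
          omega
    refine le_trans ?_ (Finset.card_le_card this)
    rw [Finset.card_insert_of_notMem (by simp)]
    simp

theorem heap_edist (q n : ℕ) (hq : 2 ≤ q) (hn : 0 < n) : ∀ i (hi : i < n),
    (heapGraph q n).edist ⟨i, hi⟩ ⟨0, hn⟩ ≤ (Nat.log 2 (i + 1) : ℕ) := by
  intro i
  induction i using Nat.strong_induction_on with
  | _ i ih =>
    intro hi
    rcases Nat.eq_zero_or_pos i with rfl | hpos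
    · simp
    · have hle : (i - 1) / q ≤ (i - 1) / 2 := Nat.div_le_div_left hq (by norm_num)
      have hlt : (i - 1) / q < i := by omega
      have h1 := ih _ hlt (hlt.trans hi)
      have hadj : (heapGraph q n).Adj ⟨i, hi⟩ ⟨(i - 1) / q, hlt.trans hi⟩ := by
        refine ⟨?_, Or.inr rfl⟩
        intro h
        have := congrArg Fin.val h
        simp only at this
        omega
      have h2 := SimpleGraph.edist_eq_one_iff_adj.mpr hadj
      have h3 := (heapGraph q n).edist_triangle (u := ⟨i, hi⟩)
        (v := ⟨(i - 1) / q, hlt.trans hi⟩) (w := ⟨0, hn⟩)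
      rw [h2] at h3
      have h4 : Nat.log 2 ((i - 1) / q + 1) + 1 ≤ Nat.log 2 (i + 1) := by
        rw [Nat.log_of_one_lt_of_le (b := 2) (n := i + 1) (by norm_num) (by omega)]
        exact Nat.add_le_add_right (Nat.log_mono_right (by omega)) 1
      calc _ ≤ _ := h3
        _ ≤ 1 + ((Nat.log 2 ((i - 1) / q + 1) : ℕ) : ℕ∞) := by gcongr
        _ ≤ _ := by
          rw [add_comm]
          exact_mod_cast h4

theorem union_bound (n t D : ℕ) (f : Fin n → Finset ℕ) (hf : ∀ v, (f v).card = t)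
    (hD : ∀ u v, u ≠ v → (f u ∩ f v).card ≤ D) (S : Finset (Fin n)) :
    2 * S.card * t + D * S.card ≤ 2 * (S.biUnion f).card + D * S.card * S.card := by
  classical
  induction S using Finset.induction_on with
  | empty => simp
  | insert a S ha ih =>
    rw [Finset.card_insert_of_notMem ha, Finset.biUnion_insert]
    have h1 := Finset.card_union_add_card_inter (f a) (S.biUnion f)
    have h2 : (f a ∩ S.biUnion f).card ≤ S.card * D := by
      rw [Finset.inter_biUnion]
      refine Finset.card_biUnion_le_card_mul _ _ _ ?_
      intro v hv
      exact hD a v (by rintro rfl; exact ha hv)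
    rw [hf a] at h1
    nlinarith

theorem tone_exists (n t : ℕ) (G : SimpleGraph (Fin n)) :
    ∃ k, ∃ f : Fin n → Finset ℕ, IsTToneColoring G t k f := by
  refine ⟨n * t, fun v => Finset.Ioc (v.val * t) (v.val * t + t), ?_, ?_⟩
  · intro v
    refine ⟨by simp, ?_⟩
    intro x hx
    simp only [Finset.mem_Ioc, Finset.mem_Icc] at hx ⊢
    have : (v.val + 1) * t ≤ n * t := Nat.mul_le_mul_right _ v.isLt
    constructor
    · omega
    · nlinarith
  · intro u v huv
    have : Finset.Ioc (u.val * t) (u.val * t + t) ∩ Finset.Ioc (v.val * t) (v.val * t + t) = ∅ := by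
      ext x
      simp only [Finset.mem_inter, Finset.mem_Ioc, Finset.notMem_empty, iff_false]
      rintro ⟨⟨h1, h2⟩, h3, h4⟩
      rcases lt_or_gt_of_ne (fun h => huv (Fin.ext h)) with h | h
      · have : (u.val + 1) * t ≤ v.val * t := Nat.mul_le_mul_right _ h
        nlinarith
      · have : (v.val + 1) * t ≤ u.val * t := Nat.mul_le_mul_right _ h
        nlinarith
    simp only [this, Finset.card_empty, Nat.cast_zero]
    exact pos_iff_ne_zero.mpr (fun h => huv (SimpleGraph.edist_eq_zero_iff.mp h))

set_option maxHeartbeats 1000000 in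
theorem exists_graph_toneNumber_ge (r : ℕ) (hr : 3 ≤ r) :
    ∃ c : ℝ, 0 < c ∧
      ∀ t : ℕ, 2 ≤ t →
        ∃ (n : ℕ) (G : SimpleGraph (Fin n)) (_ : DecidableRel G.Adj),
          G.maxDegree = r ∧
          c * (t : ℝ) ^ 2 / Real.logb 2 (t : ℝ) ≤ (toneNumber G t : ℝ) := by
  have hr' : (3 : ℝ) ≤ r := by exact_mod_cast hr
  have hL : 0 < Real.logb 2 (2 * r) := Real.logb_pos (by norm_num) (by linarith)
  set C : ℝ := 2 + 2 * Real.logb 2 (2 * r) with hC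
  have hCpos : 0 < C := by positivity
  refine ⟨1 / (2 * C), by positivity, ?_⟩
  intro t ht
  have ht' : (2 : ℝ) ≤ t := by exact_mod_cast ht
  obtain ⟨q, rfl⟩ : ∃ q, r = q + 1 := ⟨r - 1, by omega⟩
  set n := t + 2 * (q + 1) with hn
  refine ⟨n, heapGraph q n, inferInstance, heap_maxDegree q n (by omega) (by omega), ?_⟩
  obtain ⟨f, hf1, hf2⟩ := Nat.sInf_mem (tone_exists n t (heapGraph q n))
  change ∀ v, (f v).card = t ∧ f v ⊆ Finset.Icc 1 (toneNumber (heapGraph q n) t) at hf1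
  set k := toneNumber (heapGraph q n) t
  set D := 2 * Nat.log 2 n with hDdef
  have hDpos : 0 < D := by
    have := Nat.log_pos (b := 2) (n := n) (by norm_num) (by omega)
    omega
  have hD : ∀ u v, u ≠ v → (f u ∩ f v).card ≤ D := by
    intro u v huv
    have h1 := heap_edist q n (by omega) (by omega) u.val u.isLt
    have h2 := heap_edist q n (by omega) (by omega) v.val v.isLt
    have h3 := (heapGraph q n).edist_triangle (u := u) (v := ⟨0, by omega⟩) (w := v)
    rw [(heapGraph q n).edist_comm (u := (⟨0, by omega⟩ : Fin n)) (v := v)] at h3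
    have h4 := hf2 u v huv
    have h5 : Nat.log 2 (u.val + 1) ≤ Nat.log 2 n := Nat.log_mono_right u.isLt
    have h6 : Nat.log 2 (v.val + 1) ≤ Nat.log 2 n := Nat.log_mono_right v.isLt
    have h7 : (((f u ∩ f v).card : ℕ) : ℕ∞) ≤
        ((Nat.log 2 (u.val + 1) + Nat.log 2 (v.val + 1) : ℕ) : ℕ∞) := by
      refine h4.le.trans (h3.trans ?_)
      push_cast
      exact add_le_add h1 h2
    have h8 := Nat.cast_le.mp h7
    omega
  have hm : t / D + 1 ≤ (Finset.univ : Finset (Fin n)).card := by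
    have := Nat.div_le_self t D
    simp
    omega
  obtain ⟨S, -, hS⟩ := Finset.exists_subset_card_eq hm
  have hU := union_bound n t D f (fun v => (hf1 v).1) hD S
  have hk : (S.biUnion f).card ≤ k := by
    have : S.biUnion f ⊆ Finset.Icc 1 k := Finset.biUnion_subset.mpr (fun v _ => (hf1 v).2)
    simpa using Finset.card_le_card this
  have e1 : D * (t / D) ≤ t := Nat.mul_div_le t D
  have e2 : t < D * (t / D + 1) := Nat.lt_mul_div_succ t hDpos
  rw [hS] at hU
  have key : t * t ≤ 2 * k * D := by
    set m := t / D
    have a1 : D * m * (m + 1) ≤ t * (m + 1) := Nat.mul_le_mul_right _ e1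
    have a2 : t * (m + 1) ≤ 2 * k := by nlinarith
    calc t * t ≤ t * (D * (m + 1)) := Nat.mul_le_mul_left _ e2.le
      _ = t * (m + 1) * D := by ring
      _ ≤ _ := Nat.mul_le_mul_right _ a2
  have keyR : (t : ℝ) * t ≤ 2 * k * D := by exact_mod_cast key
  have hlt : 1 ≤ Real.logb 2 t := by
    rw [Real.le_logb_iff_rpow_le (by norm_num) (by linarith)]
    simpa using ht'
  have hDC : (D : ℝ) ≤ C * Real.logb 2 t := by
    have b1 : (Nat.log 2 n : ℝ) ≤ Real.logb 2 n := by
      exact_mod_cast Real.natLog_le_logb n 2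
    have b2 : Real.logb 2 n ≤ Real.logb 2 ((2 * ((q + 1 : ℕ) : ℝ)) * t) := by
      apply Real.logb_le_logb_of_le (by norm_num)
      · have : 0 < n := by omega
        exact_mod_cast this
      · rw [hn]
        push_cast at hr' ⊢
        nlinarith
    rw [Real.logb_mul (by positivity) (by positivity)] at b2
    have : (D : ℝ) = 2 * Nat.log 2 n := by rw [hDdef]; push_cast; ring
    rw [this, hC]
    nlinarith
  rw [div_le_iff₀ (by linarith), div_mul_eq_mul_div, div_le_iff₀ (by positivity)]
  have hk0 : (0 : ℝ) ≤ k := Nat.cast_nonneg _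
  have := mul_le_mul_of_nonneg_left hDC (show (0 : ℝ) ≤ 2 * k by positivity)
  nlinarith
end
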